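/- Assume ε > 1/2, η satisfies (H₀)–(H₄) and V satisfies (H'₀)–(H'₃) (all with this ε), and let a ≤ b be real numbers such that the interval [a,b] contains none of −1/2, −1/3, 1 and contains no eigenvalue of H̃ := Δ̃ + V(Q). Then there exists M > 0 such that for all λ ∈ [a,b] and all ρ ∈ (0,1], the operator H̃ − (λ + iρ) is invertible in the bounded operators on ℓ²(ℤ²,ℂ) and ‖Λ^{−ε}(Q) ∘ (H̃ − (λ + iρ))⁻¹ ∘ Λ^{−ε}(Q)‖ ≤ M (limiting absorption principle). -/

import Mathlib

open scoped ENNReal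
open Filter

noncomputable section

/-- The Hilbert space `ℓ²(ℤ², ℂ)`. -/
abbrev H2 : Type := lp (fun _ : ℤ × ℤ => ℂ) 2

/-- The triangular-lattice Laplacian, acting pointwise on functions `ℤ² → ℂ`. -/
def lapT (f : ℤ × ℤ → ℂ) : ℤ × ℤ → ℂ := fun n =>
  (1/6 : ℂ) * (f (n.1 + 1, n.2) + f (n.1 - 1, n.2) + f (n.1, n.2 + 1)
    + f (n.1, n.2 - 1) + f (n.1 + 1, n.2 - 1) + f (n.1 - 1, n.2 + 1))

/-- The symbol `F(x₁,x₂) = (1/3)(cos x₁ + cos x₂ + cos (x₁ - x₂))`. -/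
def symbF (x : ℝ × ℝ) : ℝ := (1/3) * (Real.cos x.1 + Real.cos x.2 + Real.cos (x.1 - x.2))

/-- `∂₁ F`. -/
def d1F (x : ℝ × ℝ) : ℝ := -(1/3) * (Real.sin x.1 + Real.sin (x.1 - x.2))

/-- `∂₂ F`. -/
def d2F (x : ℝ × ℝ) : ℝ := -(1/3) * (Real.sin x.2 - Real.sin (x.1 - x.2))

/-- Japanese bracket `⟨t⟩ = √(1/2 + t²)`. -/
def jap (t : ℝ) : ℝ := Real.sqrt (1/2 + t^2)

/-- The weight `Λ(n₁,n₂) = ⟨n₁⟩ + ⟨n₂⟩`. -/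
def Lam (n : ℤ × ℤ) : ℝ := jap (n.1 : ℝ) + jap (n.2 : ℝ)

/-- The conjugate operator `A`, acting pointwise on functions `ℤ² → ℂ`. -/
def opA (f : ℤ × ℤ → ℂ) : ℤ × ℤ → ℂ := fun n =>
  (Complex.I / 6) *
    (((n.1 : ℂ) + 1/2) * f (n.1 + 1, n.2) - ((n.1 : ℂ) - 1/2) * f (n.1 - 1, n.2)
      + ((n.2 : ℂ) + 1/2) * f (n.1, n.2 + 1) - ((n.2 : ℂ) - 1/2) * f (n.1, n.2 - 1)
      + ((n.2 : ℂ) - (n.1 : ℂ) + 1) * f (n.1 - 1, n.2 + 1)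
      + ((n.1 : ℂ) - (n.2 : ℂ) + 1) * f (n.1 + 1, n.2 - 1))

/-- The perturbed Laplacian `Δ̃` with weight `m`, acting pointwise on functions `ℤ² → ℂ`:
`(Δ̃ f)(n) = (1/6) Σ_{l ∼ n} f(l) / (√(m n) √(m l))`. -/
def lapPert (m : ℤ × ℤ → ℝ) (f : ℤ × ℤ → ℂ) : ℤ × ℤ → ℂ := fun n =>
  (1/6 : ℂ) *
    (f (n.1 + 1, n.2) / ((Real.sqrt (m n) * Real.sqrt (m (n.1 + 1, n.2)) : ℝ) : ℂ)
      + f (n.1 - 1, n.2) / ((Real.sqrt (m n) * Real.sqrt (m (n.1 - 1, n.2)) : ℝ) : ℂ)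
      + f (n.1, n.2 + 1) / ((Real.sqrt (m n) * Real.sqrt (m (n.1, n.2 + 1)) : ℝ) : ℂ)
      + f (n.1, n.2 - 1) / ((Real.sqrt (m n) * Real.sqrt (m (n.1, n.2 - 1)) : ℝ) : ℂ)
      + f (n.1 + 1, n.2 - 1) / ((Real.sqrt (m n) * Real.sqrt (m (n.1 + 1, n.2 - 1)) : ℝ) : ℂ)
      + f (n.1 - 1, n.2 + 1) / ((Real.sqrt (m n) * Real.sqrt (m (n.1 - 1, n.2 + 1)) : ℝ) : ℂ))

/-! ### Square-summable sequences on `ℤ²` -/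

/-- Square-summable functions `ℤ² → ℂ`. -/
def SqSummable (v : ℤ × ℤ → ℂ) : Prop := Summable fun n => ‖v n‖ ^ 2

lemma H2.sqSummable (f : H2) : SqSummable f := by
  have h := (lp.memℓp f).summable (by simp)
  simpa [SqSummable] using h

lemma H2.norm_sq (f : H2) : ‖f‖ ^ 2 = ∑' n, ‖f n‖ ^ 2 := by
  have h := lp.norm_rpow_eq_tsum (p := 2) (by simp) f
  simpa using h

/-- The element of `ℓ²(ℤ²)` given by a square-summable function. -/
def SqSummable.toH2 {v : ℤ × ℤ → ℂ} (h : SqSummable v) : H2 :=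
  ⟨v, memℓp_gen (by simpa [SqSummable] using h)⟩

@[simp] lemma SqSummable.toH2_apply {v : ℤ × ℤ → ℂ} (h : SqSummable v) (n : ℤ × ℤ) :
    h.toH2 n = v n := rfl

lemma SqSummable.of_norm_le {v : ℤ × ℤ → ℂ} {g : ℤ × ℤ → ℝ} (hg : Summable g)
    (h : ∀ n, ‖v n‖ ^ 2 ≤ g n) : SqSummable v :=
  Summable.of_nonneg_of_le (fun _ => by positivity) h hg

lemma SqSummable.shift {v : ℤ × ℤ → ℂ} (h : SqSummable v) (k : ℤ × ℤ) :
    SqSummable fun n => v (n + k) :=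
  (Equiv.addRight k).summable_iff.mpr h

lemma SqSummable.add {v w : ℤ × ℤ → ℂ} (hv : SqSummable v) (hw : SqSummable w) :
    SqSummable fun n => v n + w n := (hv.toH2 + hw.toH2).sqSummable

lemma SqSummable.sub {v w : ℤ × ℤ → ℂ} (hv : SqSummable v) (hw : SqSummable w) :
    SqSummable fun n => v n - w n := (hv.toH2 - hw.toH2).sqSummable

lemma SqSummable.const_mul {v : ℤ × ℤ → ℂ} (hv : SqSummable v) (c : ℂ) :
    SqSummable fun n => c * v n := (c • hv.toH2).sqSummable

lemma SqSummable.finset_sum {ι : Type*} (s : Finset ι) {v : ι → ℤ × ℤ → ℂ}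
    (hv : ∀ i ∈ s, SqSummable (v i)) : SqSummable fun n => ∑ i ∈ s, v i n := by
  classical
  induction s using Finset.induction_on with
  | empty => simp [SqSummable, summable_zero]
  | insert a s ha ih =>
    simp only [Finset.sum_insert ha]
    exact (hv a (by simp)).add (ih fun i hi => hv i (by simp [hi]))

lemma SqSummable.mul_bounded {v : ℤ × ℤ → ℂ} (hv : SqSummable v) {K : ℤ × ℤ → ℂ} {C : ℝ}
    (hK : ∀ n, ‖K n‖ ≤ C) : SqSummable fun n => K n * v n := by
  refine SqSummable.of_norm_le (Summable.mul_left (C ^ 2) hv) fun n => ?_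
  rw [norm_mul, mul_pow]
  have := hK n
  gcongr

lemma SqSummable.summable_mul_norm {u v : ℤ × ℤ → ℂ} (hu : SqSummable u) (hv : SqSummable v)
    {K : ℤ × ℤ → ℝ} {C : ℝ} (hK : ∀ n, |K n| ≤ C) :
    Summable fun n => K n * (‖u n‖ * ‖v n‖) := by
  refine Summable.of_norm_bounded (g := fun n => C * (‖u n‖ ^ 2 + ‖v n‖ ^ 2))
    ((Summable.add hu hv).mul_left C) fun n => ?_
  rw [norm_mul, Real.norm_eq_abs, Real.norm_eq_abs,
    abs_of_nonneg (a := ‖u n‖ * ‖v n‖) (by positivity)]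
  have hC : 0 ≤ C := (abs_nonneg _).trans (hK n)
  have := hK n
  gcongr
  nlinarith [sq_nonneg (‖u n‖ - ‖v n‖), norm_nonneg (u n), norm_nonneg (v n)]

lemma SqSummable.summable_mul_sq {u : ℤ × ℤ → ℂ} (hu : SqSummable u)
    {K : ℤ × ℤ → ℝ} {C : ℝ} (hK : ∀ n, |K n| ≤ C) :
    Summable fun n => K n * ‖u n‖ ^ 2 := by
  simpa [sq] using hu.summable_mul_norm hu hK

lemma abs_re_conj_mul_le (x y : ℂ) : |((starRingEnd ℂ) x * y).re| ≤ ‖x‖ * ‖y‖ := by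
  refine (Complex.abs_re_le_norm _).trans ?_
  simp

lemma abs_im_conj_mul_le (x y : ℂ) : |((starRingEnd ℂ) x * y).im| ≤ ‖x‖ * ‖y‖ := by
  refine (Complex.abs_im_le_norm _).trans ?_
  simp

lemma SqSummable.summable_mul_re {u v : ℤ × ℤ → ℂ} (hu : SqSummable u) (hv : SqSummable v)
    {K : ℤ × ℤ → ℝ} {C : ℝ} (hK : ∀ n, |K n| ≤ C) :
    Summable fun n => K n * ((starRingEnd ℂ) (u n) * v n).re := by
  refine Summable.of_norm_bounded (hu.summable_mul_norm hv (K := fun n => |K n|) (C := C)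
    (fun n => by simpa using hK n)) fun n => ?_
  rw [norm_mul, Real.norm_eq_abs, Real.norm_eq_abs]
  gcongr
  exact abs_re_conj_mul_le _ _

lemma SqSummable.summable_im {u v : ℤ × ℤ → ℂ} (hu : SqSummable u) (hv : SqSummable v) :
    Summable fun n => ((starRingEnd ℂ) (u n) * v n).im := by
  refine Summable.of_norm_bounded (hu.summable_mul_norm hv (K := fun n => 1) (C := 1)
    (fun n => by simp)) fun n => ?_
  rw [one_mul]
  exact abs_im_conj_mul_le _ _

lemma tsum_shift {α : Type*} [AddCommMonoid α] [TopologicalSpace α] (g : ℤ × ℤ → α)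
    (k : ℤ × ℤ) : ∑' n, g (n + k) = ∑' n, g n :=
  (Equiv.addRight k).tsum_eq g

lemma summable_shift {g : ℤ × ℤ → ℝ} (hg : Summable g) (k : ℤ × ℤ) :
    Summable fun n => g (n + k) :=
  (Equiv.addRight k).summable_iff.mpr hg

/-! ### The triangular lattice -/

/-- The six neighbours of the origin. -/
def nbrs : Finset (ℤ × ℤ) := {(1, 0), (-1, 0), (0, 1), (0, -1), (1, -1), (-1, 1)}

lemma sum_nbrs {α : Type*} [AddCommMonoid α] (g : ℤ × ℤ → α) :
    ∑ e ∈ nbrs, g e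
      = g (1, 0) + (g (-1, 0) + (g (0, 1) + (g (0, -1) + (g (1, -1) + g (-1, 1))))) := by
  simp [nbrs]

lemma neg_mem_nbrs {e : ℤ × ℤ} (he : e ∈ nbrs) : -e ∈ nbrs := by
  revert e; decide

lemma sum_nbrs_neg {α : Type*} [AddCommMonoid α] (g : ℤ × ℤ → α) :
    ∑ e ∈ nbrs, g (-e) = ∑ e ∈ nbrs, g e :=
  Finset.sum_nbij' (fun e => -e) (fun e => -e) (fun _ h => neg_mem_nbrs h)
    (fun _ h => neg_mem_nbrs h) (fun _ _ => neg_neg _) (fun _ _ => neg_neg _) (fun _ _ => rfl)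

/-- Sum over the six neighbours. -/
def nbrSum (v : ℤ × ℤ → ℂ) (n : ℤ × ℤ) : ℂ := ∑ e ∈ nbrs, v (n + e)

/-- First velocity component: `Σ_e e₁ v(n+e)`. -/
def vel1 (v : ℤ × ℤ → ℂ) (n : ℤ × ℤ) : ℂ := ∑ e ∈ nbrs, (e.1 : ℂ) * v (n + e)

/-- Second velocity component: `Σ_e e₂ v(n+e)`. -/
def vel2 (v : ℤ × ℤ → ℂ) (n : ℤ × ℤ) : ℂ := ∑ e ∈ nbrs, (e.2 : ℂ) * v (n + e)

lemma SqSummable.nbrSum {v : ℤ × ℤ → ℂ} (hv : SqSummable v) : SqSummable (nbrSum v) :=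
  SqSummable.finset_sum _ fun e _ => hv.shift e

lemma SqSummable.vel1 {v : ℤ × ℤ → ℂ} (hv : SqSummable v) : SqSummable (vel1 v) :=
  SqSummable.finset_sum _ fun e _ => (hv.shift e).const_mul _

lemma SqSummable.vel2 {v : ℤ × ℤ → ℂ} (hv : SqSummable v) : SqSummable (vel2 v) :=
  SqSummable.finset_sum _ fun e _ => (hv.shift e).const_mul _

/-! ### The velocity controls the norm away from critical energies -/

/-- The shift `(T_k f)(n) = f(n+k)` as a bounded operator. -/
def shiftOp (k : ℤ × ℤ) : H2 →L[ℂ] H2 :=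
  LinearMap.mkContinuous
    { toFun := fun f => (f.sqSummable.shift k).toH2
      map_add' := fun f g => by ext n; simp
      map_smul' := fun c f => by ext n; simp } 1 fun f => by
    have h : ‖(f.sqSummable.shift k).toH2‖ ^ 2 = ‖f‖ ^ 2 := by
      rw [H2.norm_sq, H2.norm_sq]
      exact tsum_shift (fun n => ‖f n‖ ^ 2) k
    rw [one_mul]
    exact (pow_le_pow_iff_left₀ (norm_nonneg _) (norm_nonneg _) two_ne_zero).mp h.le

@[simp] lemma shiftOp_apply (k : ℤ × ℤ) (f : H2) (n : ℤ × ℤ) : shiftOp k f n = f (n + k) := rfl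

lemma shiftOp_mul (k l : ℤ × ℤ) : shiftOp k * shiftOp l = shiftOp (k + l) := by
  ext f n
  simp [add_assoc]

lemma shiftOp_zero : shiftOp 0 = 1 := by
  ext f n
  simp

/-- The sum of the six shifts, `6` times the triangular Laplacian. -/
def nbrOp : H2 →L[ℂ] H2 := ∑ e ∈ nbrs, shiftOp e

/-- First velocity operator. -/
def velOp1 : H2 →L[ℂ] H2 := ∑ e ∈ nbrs, e.1 • shiftOp e

/-- Second velocity operator. -/
def velOp2 : H2 →L[ℂ] H2 := ∑ e ∈ nbrs, e.2 • shiftOp e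

/-- The critical values `6`, `-2`, `-3` are the roots of a cubic lying in the ideal generated by
the velocities. -/
lemma exists_cubic_eq_velocity : ∃ a b : H2 →L[ℂ] H2,
    nbrOp * nbrOp * nbrOp - nbrOp * nbrOp - (24 : ℤ) • nbrOp - (36 : ℤ) • 1
      = a * velOp1 + b * velOp2 := by
  refine ⟨-(shiftOp (-2, 0) - shiftOp (2, 0)) - (7 : ℤ) • (shiftOp (-2, 1) - shiftOp (2, -1))
      + (2 : ℤ) • (shiftOp (-1, -1) - shiftOp (1, 1)) - (6 : ℤ) • (shiftOp (-1, 0) - shiftOp (1, 0))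
      - (5 : ℤ) • (shiftOp (-1, 1) - shiftOp (1, -1)),
    -((5 : ℤ) • (shiftOp (-2, 0) - shiftOp (2, 0))) - (4 : ℤ) • (shiftOp (-2, 1) - shiftOp (2, -1))
      + (shiftOp (-2, 2) - shiftOp (2, -2)) - (3 : ℤ) • (shiftOp (-1, -1) - shiftOp (1, 1))
      - (shiftOp (-1, 0) - shiftOp (1, 0)) + (4 : ℤ) • (shiftOp (-1, 1) - shiftOp (1, -1))
      + (2 : ℤ) • (shiftOp (-1, 2) - shiftOp (1, -2)) - (shiftOp (0, -2) - shiftOp (0, 2)), ?_⟩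
  rw [nbrOp, velOp1, velOp2]
  simp only [sum_nbrs, mul_add, add_mul, sub_mul, neg_mul, shiftOp_mul, Prod.mk_add_mk,
    ← shiftOp_zero, smul_mul_assoc, mul_smul_comm, ← Prod.mk_zero_zero, Int.reduceAdd,
    Int.reduceNeg, zero_add, add_zero]
  abel

lemma velocity_lower_bound {a b : ℝ} (hthr : ∀ L ∈ Set.Icc a b, (L - 6) * (L + 2) * (L + 3) ≠ 0) :
    ∃ C : ℝ, 0 < C ∧ ∀ L ∈ Set.Icc a b, ∀ v : ℤ × ℤ → ℂ, SqSummable v →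
      ∑' n, ‖v n‖ ^ 2 ≤ C * (∑' n, ‖vel1 v n‖ ^ 2 + ∑' n, ‖vel2 v n‖ ^ 2
        + ∑' n, ‖nbrSum v n - L * v n‖ ^ 2) := by
  obtain ⟨α, β, hid⟩ := exists_cubic_eq_velocity
  obtain ⟨p₀, hp₀, hp⟩ : ∃ p₀ : ℝ, 0 < p₀ ∧
      ∀ L ∈ Set.Icc a b, p₀ ≤ |(L - 6) * (L + 2) * (L + 3)| := by
    rcases (Set.Icc a b).eq_empty_or_nonempty with h | h
    · exact ⟨1, one_pos, by simp [h]⟩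
    · obtain ⟨L₀, hL₀, hmin⟩ := isCompact_Icc.exists_isMinOn h
        (f := fun L : ℝ => |(L - 6) * (L + 2) * (L + 3)|) (by fun_prop)
      exact ⟨_, abs_pos.mpr (hthr L₀ hL₀), fun L hL => hmin hL⟩
  set Q : ℝ → H2 →L[ℂ] H2 := fun L => ((L ^ 2 - L - 24 : ℝ) : ℂ) • 1 + ((L - 1 : ℝ) : ℂ) • nbrOp
    + nbrOp * nbrOp with hQ
  obtain ⟨M, hM⟩ : ∃ M : ℝ, ∀ L ∈ Set.Icc a b, ‖Q L‖ ≤ M :=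
    isCompact_Icc.exists_bound_of_continuousOn (f := Q) (by rw [hQ]; fun_prop)
  set B := ‖α‖ + ‖β‖ + |M| + 1 with hB
  have hBpos : 0 < B := by positivity
  refine ⟨3 * (B / p₀) ^ 2, by positivity, fun L hL v hv => ?_⟩
  set f : H2 := hv.toH2
  set z : H2 := nbrOp f - (L : ℂ) • f with hz
  have e1 : ∑' n, ‖vel1 v n‖ ^ 2 = ‖velOp1 f‖ ^ 2 := by
    rw [H2.norm_sq]
    refine tsum_congr fun n => ?_
    simp [velOp1, vel1, sum_nbrs, f]
  have e2 : ∑' n, ‖vel2 v n‖ ^ 2 = ‖velOp2 f‖ ^ 2 := by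
    rw [H2.norm_sq]
    refine tsum_congr fun n => ?_
    simp [velOp2, vel2, sum_nbrs, f]
  have e3 : ∑' n, ‖nbrSum v n - L * v n‖ ^ 2 = ‖z‖ ^ 2 := by
    rw [H2.norm_sq]
    refine tsum_congr fun n => ?_
    have h1 : z n = nbrOp f n - L * f n := rfl
    have h2 : nbrOp f n = nbrSum v n := by simp [nbrOp, nbrSum, sum_nbrs, f]
    rw [h1, h2]
    rfl
  have e0 : ∑' n, ‖v n‖ ^ 2 = ‖f‖ ^ 2 := by
    rw [H2.norm_sq]; rfl
  rw [e0, e1, e2, e3]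
  have hkey : (((L - 6) * (L + 2) * (L + 3) : ℝ) : ℂ) • f
      = α (velOp1 f) + β (velOp2 f) - Q L z := by
    have h := congrArg (fun T : H2 →L[ℂ] H2 => T f) hid
    simp only [sub_apply, add_apply,
      mul_apply_eq_comp, smul_apply,
      one_apply_eq_self] at h
    rw [← h, hz, hQ]
    simp only [add_apply, smul_apply,
      one_apply_eq_self, mul_apply_eq_comp, map_sub, map_smul]
    push_cast
    module
  have hn : p₀ * ‖f‖ ≤ B * (‖velOp1 f‖ + ‖velOp2 f‖ + ‖z‖) := by
    calc p₀ * ‖f‖ ≤ |(L - 6) * (L + 2) * (L + 3)| * ‖f‖ := by gcongr; exact hp L hL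
      _ = ‖(((L - 6) * (L + 2) * (L + 3) : ℝ) : ℂ) • f‖ := by
        rw [norm_smul, Complex.norm_real, Real.norm_eq_abs]
      _ ≤ ‖α (velOp1 f)‖ + ‖β (velOp2 f)‖ + ‖Q L z‖ := by
        rw [hkey]; exact (norm_sub_le _ _).trans (by gcongr; exact norm_add_le _ _)
      _ ≤ ‖α‖ * ‖velOp1 f‖ + ‖β‖ * ‖velOp2 f‖ + ‖Q L‖ * ‖z‖ := by
        gcongr <;> exact ContinuousLinearMap.le_opNorm _ _
      _ ≤ B * ‖velOp1 f‖ + B * ‖velOp2 f‖ + B * ‖z‖ := by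
        have h1 : ‖α‖ ≤ B := by
          rw [hB]; linarith [norm_nonneg β, abs_nonneg M]
        have h2 : ‖β‖ ≤ B := by
          rw [hB]; linarith [norm_nonneg α, abs_nonneg M]
        have h3 : ‖Q L‖ ≤ B := by
          rw [hB]; linarith [norm_nonneg α, norm_nonneg β, hM L hL, le_abs_self M]
        gcongr
      _ = _ := by ring
  have hn' : ‖f‖ ≤ B / p₀ * (‖velOp1 f‖ + ‖velOp2 f‖ + ‖z‖) := by
    rw [div_mul_eq_mul_div, le_div_iff₀ hp₀]; linarith
  calc ‖f‖ ^ 2 ≤ (B / p₀ * (‖velOp1 f‖ + ‖velOp2 f‖ + ‖z‖)) ^ 2 := by gcongr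
    _ = (B / p₀) ^ 2 * (‖velOp1 f‖ + ‖velOp2 f‖ + ‖z‖) ^ 2 := by ring
    _ ≤ (B / p₀) ^ 2 * (3 * (‖velOp1 f‖ ^ 2 + ‖velOp2 f‖ ^ 2 + ‖z‖ ^ 2)) := by
      gcongr
      nlinarith [sq_nonneg (‖velOp1 f‖ - ‖velOp2 f‖), sq_nonneg (‖velOp1 f‖ - ‖z‖),
        sq_nonneg (‖velOp2 f‖ - ‖z‖)]
    _ = _ := by ring

/-! ### Finite differences of powers of the regularised square radius -/

/-- Euclidean inner product on `ℝ²`. -/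
def dot2 (x y : ℝ × ℝ) : ℝ := x.1 * y.1 + x.2 * y.2

/-- Regularised square radius `R² + |x|²`. -/
def sqRad (R : ℝ) (x : ℝ × ℝ) : ℝ := R ^ 2 + dot2 x x

/-- Hessian of `sqRad R ^ α`, as a bilinear form. -/
def hessPow (α R : ℝ) (x e e' : ℝ × ℝ) : ℝ :=
  2 * α * sqRad R x ^ (α - 1) * dot2 e e'
    + 4 * α * (α - 1) * sqRad R x ^ (α - 2) * (dot2 x e * dot2 x e')

lemma dot2_self_nonneg (x : ℝ × ℝ) : 0 ≤ dot2 x x :=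
  add_nonneg (mul_self_nonneg _) (mul_self_nonneg _)

lemma dot2_sq_le (x y : ℝ × ℝ) : dot2 x y ^ 2 ≤ dot2 x x * dot2 y y := by
  unfold dot2
  nlinarith [sq_nonneg (x.1 * y.2 - x.2 * y.1)]

lemma sqRad_pos {R : ℝ} (hR : 4 ≤ R) (x : ℝ × ℝ) : 0 < sqRad R x := by
  have := dot2_self_nonneg x
  unfold sqRad; positivity

lemma sq_le_sqRad (R : ℝ) (x : ℝ × ℝ) : R ^ 2 ≤ sqRad R x := by
  have := dot2_self_nonneg x
  unfold sqRad; linarith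

lemma sixteen_le_sqRad {R : ℝ} (hR : 4 ≤ R) (x : ℝ × ℝ) : 16 ≤ sqRad R x :=
  le_trans (by nlinarith) (sq_le_sqRad R x)

lemma sqRad_add_le {R : ℝ} (hR : 4 ≤ R) (x : ℝ × ℝ) {d : ℝ × ℝ} (hd : dot2 d d ≤ 8) :
    sqRad R (x + d) ≤ 3 * sqRad R x := by
  have h := sixteen_le_sqRad hR x
  unfold sqRad dot2 at *
  simp only [Prod.fst_add, Prod.snd_add]
  nlinarith [sq_nonneg (x.1 - d.1), sq_nonneg (x.2 - d.2)]

lemma le_sqRad_add {R : ℝ} (hR : 4 ≤ R) (x : ℝ × ℝ) {d : ℝ × ℝ} (hd : dot2 d d ≤ 8) :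
    sqRad R x ≤ 3 * sqRad R (x + d) := by
  have h := sqRad_add_le hR (x + d) (d := -d) (by simpa [dot2] using hd)
  simpa using h

lemma sqRad_add_rpow_le {R : ℝ} (hR : 4 ≤ R) (x : ℝ × ℝ) {d : ℝ × ℝ} (hd : dot2 d d ≤ 8) (γ : ℝ) :
    sqRad R (x + d) ^ γ ≤ 3 ^ |γ| * sqRad R x ^ γ := by
  have hx := sqRad_pos hR x
  have hy := sqRad_pos hR (x + d)
  rcases le_total 0 γ with hγ | hγ
  · rw [abs_of_nonneg hγ, ← Real.mul_rpow (by norm_num) hx.le]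
    exact Real.rpow_le_rpow hy.le (sqRad_add_le hR x hd) hγ
  · rw [abs_of_nonpos hγ, Real.rpow_neg (by norm_num), ← Real.inv_rpow (by norm_num),
      ← Real.mul_rpow (by norm_num) hx.le]
    refine Real.rpow_le_rpow_of_nonpos (by positivity) ?_ hγ
    linarith [le_sqRad_add hR x hd]

lemma abs_dot2_le {R : ℝ} (hR : 4 ≤ R) (x : ℝ × ℝ) {e : ℝ × ℝ} (he : dot2 e e ≤ 8) :
    |dot2 x e| ≤ 3 * sqRad R x ^ (1 / 2 : ℝ) := by
  rw [← Real.sqrt_eq_rpow]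
  have hx := sqRad_pos hR x
  refine abs_le_of_sq_le_sq ?_ (by positivity)
  rw [mul_pow, Real.sq_sqrt hx.le]
  have h := dot2_sq_le x e
  have h2 := dot2_self_nonneg x
  have h3 : dot2 x x ≤ sqRad R x := by unfold sqRad; nlinarith
  nlinarith

lemma hasDerivAt_sqRad_rpow {R : ℝ} (hR : 4 ≤ R) (α : ℝ) (x d : ℝ × ℝ) (t : ℝ) :
    HasDerivAt (fun t : ℝ => sqRad R (x + t • d) ^ α)
      (2 * α * sqRad R (x + t • d) ^ (α - 1) * dot2 (x + t • d) d) t := by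
  have h1 : HasDerivAt (fun t : ℝ => sqRad R (x + t • d)) (2 * dot2 (x + t • d) d) t := by
    have ha : HasDerivAt (fun t : ℝ => x.1 + t * d.1) d.1 t := by
      simpa using ((hasDerivAt_id t).mul_const d.1).const_add x.1
    have hb : HasDerivAt (fun t : ℝ => x.2 + t * d.2) d.2 t := by
      simpa using ((hasDerivAt_id t).mul_const d.2).const_add x.2
    have h := ((ha.mul ha).add (hb.mul hb)).const_add (R ^ 2)
    refine h.congr_deriv ?_
    simp only [dot2, Prod.fst_add, Prod.snd_add, Prod.smul_fst, Prod.smul_snd, smul_eq_mul]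
    ring
  convert h1.rpow_const (p := α) (Or.inl (sqRad_pos hR _).ne') using 1
  ring

lemma hasDerivAt_dot2 (x d e : ℝ × ℝ) (t : ℝ) :
    HasDerivAt (fun t : ℝ => dot2 (x + t • d) e) (dot2 d e) t := by
  have h : (fun t : ℝ => dot2 (x + t • d) e) = fun t => dot2 x e + t * dot2 d e := by
    funext t
    simp only [dot2, Prod.fst_add, Prod.snd_add, Prod.smul_fst, Prod.smul_snd, smul_eq_mul]
    ring
  rw [h]
  simpa using ((hasDerivAt_id t).mul_const (dot2 d e)).const_add (dot2 x e)

lemma dot2_smul_self_le {d : ℝ × ℝ} {c : ℝ} (hd : dot2 d d ≤ c) {t : ℝ}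
    (ht : t ∈ Set.Ico (0 : ℝ) 1) : dot2 (t • d) (t • d) ≤ c := by
  have h : dot2 (t • d) (t • d) = t ^ 2 * dot2 d d := by
    simp only [dot2, Prod.smul_fst, Prod.smul_snd, smul_eq_mul]; ring
  rw [h]
  have := dot2_self_nonneg d
  have h1 : t ^ 2 ≤ 1 := by nlinarith [ht.1, ht.2]
  nlinarith

lemma abs_sub_le_of_hasDerivAt {f f' : ℝ → ℝ} {C : ℝ} (hf : ∀ t, HasDerivAt f (f' t) t)
    (hC : ∀ t ∈ Set.Ico (0 : ℝ) 1, |f' t| ≤ C) : |f 1 - f 0| ≤ C :=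
  norm_image_sub_le_of_norm_deriv_le_segment_01' (fun t _ => (hf t).hasDerivWithinAt) hC

lemma sqRad_rpow_diff_le (α : ℝ) : ∃ C : ℝ, 0 < C ∧ ∀ R : ℝ, 4 ≤ R → ∀ x e : ℝ × ℝ,
    dot2 e e ≤ 2 →
    |sqRad R (x + e) ^ α - sqRad R x ^ α| ≤ C * (sqRad R x ^ (α - 1) * (|dot2 x e| + 2)) := by
  refine ⟨2 * |α| * 3 ^ |α - 1| + 1, by positivity, fun R hR x e he => ?_⟩
  have h := abs_sub_le_of_hasDerivAt (hasDerivAt_sqRad_rpow hR α x e)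
    (C := (2 * |α| * 3 ^ |α - 1| + 1) * (sqRad R x ^ (α - 1) * (|dot2 x e| + 2))) fun t ht => by
      have hq := sqRad_pos hR x
      have hq' := sqRad_pos hR (x + t • e)
      have h1 := sqRad_add_rpow_le hR x (d := t • e)
        ((dot2_smul_self_le he ht).trans (by norm_num)) (α - 1)
      have h2 : |dot2 (x + t • e) e| ≤ |dot2 x e| + 2 := by
        have : dot2 (x + t • e) e = dot2 x e + t * dot2 e e := by
          simp only [dot2, Prod.fst_add, Prod.snd_add, Prod.smul_fst, Prod.smul_snd, smul_eq_mul]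
          ring
        rw [this]
        refine (abs_add_le _ _).trans ?_
        have h3 := dot2_self_nonneg e
        rw [abs_of_nonneg (mul_nonneg ht.1 h3)]
        nlinarith [ht.1, ht.2]
      rw [abs_mul, abs_mul, abs_mul, abs_two, abs_of_nonneg (Real.rpow_nonneg hq'.le _)]
      calc 2 * |α| * sqRad R (x + t • e) ^ (α - 1) * |dot2 (x + t • e) e|
          ≤ 2 * |α| * (3 ^ |α - 1| * sqRad R x ^ (α - 1)) * (|dot2 x e| + 2) := by gcongr
        _ = 2 * |α| * 3 ^ |α - 1| * (sqRad R x ^ (α - 1) * (|dot2 x e| + 2)) := by ring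
        _ ≤ _ := by gcongr; linarith
  simpa using h

lemma hessPow_diff_le (α : ℝ) : ∃ C : ℝ, 0 < C ∧ ∀ R : ℝ, 4 ≤ R → ∀ x d e e' : ℝ × ℝ,
    dot2 d d ≤ 8 → dot2 e e ≤ 2 → dot2 e' e' ≤ 2 →
    |hessPow α R (x + d) e e' - hessPow α R x e e'| ≤ C * sqRad R x ^ (α - 3 / 2) := by
  set A := |2 * α| * (|2 * (α - 1)| * 3) * 8 + |4 * α * (α - 1)| * (|2 * (α - 2)| * 3 * 9 + 48)
    with hA
  refine ⟨A * 3 ^ |α - 3 / 2| + 1, by positivity, fun R hR x d e e' hd he he' => ?_⟩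
  have he8 : dot2 e e ≤ 8 := by linarith
  have he8' : dot2 e' e' ≤ 8 := by linarith
  have dotle : ∀ {a b : ℝ × ℝ}, dot2 a a ≤ 8 → dot2 b b ≤ 8 → |dot2 a b| ≤ 8 := by
    intro a b ha hb
    refine abs_le_of_sq_le_sq ?_ (by norm_num)
    have := dot2_sq_le a b
    nlinarith [dot2_self_nonneg a, dot2_self_nonneg b]
  have hder : ∀ t : ℝ, HasDerivAt (fun t : ℝ => hessPow α R (x + t • d) e e')
      (2 * α * (2 * (α - 1) * sqRad R (x + t • d) ^ (α - 1 - 1) * dot2 (x + t • d) d) * dot2 e e'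
        + 4 * α * (α - 1) * ((2 * (α - 2) * sqRad R (x + t • d) ^ (α - 2 - 1)
            * dot2 (x + t • d) d) * (dot2 (x + t • d) e * dot2 (x + t • d) e')
          + sqRad R (x + t • d) ^ (α - 2) * (dot2 d e * dot2 (x + t • d) e'
            + dot2 (x + t • d) e * dot2 d e'))) t := by
    intro t
    have h1 := ((hasDerivAt_sqRad_rpow hR (α - 1) x d t).const_mul (2 * α)).mul_const (dot2 e e')
    have h2 := ((hasDerivAt_sqRad_rpow hR (α - 2) x d t).const_mul (4 * α * (α - 1))).mul
      ((hasDerivAt_dot2 x d e t).mul (hasDerivAt_dot2 x d e' t))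
    refine (h1.add h2).congr_deriv ?_
    simp only [Pi.mul_apply]
    ring
  have h := abs_sub_le_of_hasDerivAt hder
    (C := (A * 3 ^ |α - 3 / 2| + 1) * sqRad R x ^ (α - 3 / 2)) fun t ht => by
      have hq := sqRad_pos hR x
      set y := x + t • d with hy
      have hq' := sqRad_pos hR y
      have h1 : sqRad R y ^ (α - 3 / 2) ≤ 3 ^ |α - 3 / 2| * sqRad R x ^ (α - 3 / 2) :=
        sqRad_add_rpow_le hR x (dot2_smul_self_le hd ht) _
      set p := sqRad R y ^ (1 / 2 : ℝ) with hp
      have hp0 : 0 < p := Real.rpow_pos_of_pos hq' _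
      set r := sqRad R y ^ (α - 3 / 2) with hr
      have hr0 : 0 < r := Real.rpow_pos_of_pos hq' _
      have e1 : sqRad R y ^ (α - 1 - 1) * p = r := by
        rw [hp, hr, ← Real.rpow_add hq']; ring_nf
      have e2 : sqRad R y ^ (α - 2) * p = r := by
        rw [hp, hr, ← Real.rpow_add hq']; ring_nf
      have e3 : sqRad R y ^ (α - 2 - 1) * (p * (p * p)) = r := by
        rw [hp, hr, ← Real.rpow_add hq', ← Real.rpow_add hq', ← Real.rpow_add hq']; ring_nf
      have b1 : |dot2 y d| ≤ 3 * p := abs_dot2_le hR y hd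
      have b2 : |dot2 y e| ≤ 3 * p := abs_dot2_le hR y he8
      have b3 : |dot2 y e'| ≤ 3 * p := abs_dot2_le hR y he8'
      have c1 := dotle he8 he8'
      have c2 := dotle hd he8
      have c3 := dotle hd he8'
      have n1 : 0 ≤ sqRad R y ^ (α - 1 - 1) := Real.rpow_nonneg hq'.le _
      have n2 : 0 ≤ sqRad R y ^ (α - 2) := Real.rpow_nonneg hq'.le _
      have n3 : 0 ≤ sqRad R y ^ (α - 2 - 1) := Real.rpow_nonneg hq'.le _
      have hmain : |2 * α * (2 * (α - 1) * sqRad R y ^ (α - 1 - 1) * dot2 y d) * dot2 e e'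
        + 4 * α * (α - 1) * ((2 * (α - 2) * sqRad R y ^ (α - 2 - 1)
            * dot2 y d) * (dot2 y e * dot2 y e')
          + sqRad R y ^ (α - 2) * (dot2 d e * dot2 y e'
            + dot2 y e * dot2 d e'))| ≤ A * r := by
        calc _ ≤ |2 * α| * (|2 * (α - 1)| * sqRad R y ^ (α - 1 - 1) * |dot2 y d|) * |dot2 e e'|
            + |4 * α * (α - 1)| * ((|2 * (α - 2)| * sqRad R y ^ (α - 2 - 1)
            * |dot2 y d|) * (|dot2 y e| * |dot2 y e'|)
            + sqRad R y ^ (α - 2) * (|dot2 d e| * |dot2 y e'|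
            + |dot2 y e| * |dot2 d e'|)) := by
              refine (abs_add_le _ _).trans (add_le_add ?_ ?_)
              · rw [abs_mul, abs_mul, abs_mul (2 * (α - 1) * _), abs_mul (2 * (α - 1)),
                  abs_of_nonneg n1]
              · rw [abs_mul]
                refine mul_le_mul_of_nonneg_left ((abs_add_le _ _).trans (add_le_add ?_ ?_))
                  (abs_nonneg _)
                · rw [abs_mul, abs_mul (2 * (α - 2) * _), abs_mul (2 * (α - 2)), abs_of_nonneg n3,
                    abs_mul (dot2 y e)]
                · rw [abs_mul, abs_of_nonneg n2]
                  refine mul_le_mul_of_nonneg_left ((abs_add_le _ _).trans_eq ?_) n2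
                  rw [abs_mul, abs_mul]
          _ ≤ |2 * α| * (|2 * (α - 1)| * sqRad R y ^ (α - 1 - 1) * (3 * p)) * 8
            + |4 * α * (α - 1)| * ((|2 * (α - 2)| * sqRad R y ^ (α - 2 - 1)
            * (3 * p)) * ((3 * p) * (3 * p))
            + sqRad R y ^ (α - 2) * (8 * (3 * p) + (3 * p) * 8)) := by gcongr
          _ = |2 * α| * (|2 * (α - 1)| * 3) * 8 * (sqRad R y ^ (α - 1 - 1) * p)
            + |4 * α * (α - 1)| * (|2 * (α - 2)| * 3 * 9 * (sqRad R y ^ (α - 2 - 1) * (p * (p * p)))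
              + 48 * (sqRad R y ^ (α - 2) * p)) := by ring
          _ = A * r := by rw [e1, e2, e3, hA]; ring
      refine hmain.trans ?_
      have hA0 : 0 ≤ A := by positivity
      have h0 : 0 ≤ sqRad R x ^ (α - 3 / 2) := Real.rpow_nonneg hq.le _
      nlinarith [mul_le_mul_of_nonneg_left h1 hA0]
  simpa using h

lemma sqRad_rpow_second_diff (α : ℝ) : ∃ C : ℝ, 0 < C ∧ ∀ R : ℝ, 4 ≤ R → ∀ x e e' : ℝ × ℝ,
    dot2 e e ≤ 2 → dot2 e' e' ≤ 2 →
    |sqRad R (x + e + e') ^ α - sqRad R (x + e) ^ α - sqRad R (x + e') ^ α + sqRad R x ^ α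
      - hessPow α R x e e'| ≤ C * sqRad R x ^ (α - 3 / 2) := by
  obtain ⟨C, hC, hH⟩ := hessPow_diff_le α
  refine ⟨C, hC, fun R hR x e e' he he' => ?_⟩
  have h := abs_sub_le_of_hasDerivAt
    (f := fun t : ℝ => sqRad R (x + e' + t • e) ^ α - sqRad R (x + t • e) ^ α
      - t * hessPow α R x e e')
    (f' := fun t : ℝ => 2 * α * sqRad R (x + e' + t • e) ^ (α - 1) * dot2 (x + e' + t • e) e
      - 2 * α * sqRad R (x + t • e) ^ (α - 1) * dot2 (x + t • e) e - hessPow α R x e e')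
    (C := C * sqRad R x ^ (α - 3 / 2)) (fun t => by
      have h3 : HasDerivAt (fun t : ℝ => t * hessPow α R x e e') (hessPow α R x e e') t := by
        simpa using (hasDerivAt_id t).mul_const (hessPow α R x e e')
      exact ((hasDerivAt_sqRad_rpow hR α (x + e') e t).sub
        (hasDerivAt_sqRad_rpow hR α x e t)).sub h3) fun t ht => by
      have h := abs_sub_le_of_hasDerivAt
        (f := fun r : ℝ => 2 * α * sqRad R (x + t • e + r • e') ^ (α - 1)
          * dot2 (x + t • e + r • e') e - r * hessPow α R x e e')
        (f' := fun r : ℝ => hessPow α R (x + t • e + r • e') e e' - hessPow α R x e e')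
        (C := C * sqRad R x ^ (α - 3 / 2)) (fun r => by
          have h3 : HasDerivAt (fun t : ℝ => t * hessPow α R x e e') (hessPow α R x e e') r := by
            simpa using (hasDerivAt_id r).mul_const (hessPow α R x e e')
          have h4 := ((hasDerivAt_sqRad_rpow hR (α - 1) (x + t • e) e' r).const_mul (2 * α)).mul
            (hasDerivAt_dot2 (x + t • e) e' e r)
          refine (HasDerivAt.congr_deriv (h4.sub h3) ?_)
          have hcomm : dot2 e' e = dot2 e e' := by unfold dot2; ring
          have hexp : α - 1 - 1 = α - 2 := by ring
          simp only [hessPow, hcomm, hexp]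
          ring) fun r hr => by
          have hd : dot2 (t • e + r • e') (t • e + r • e') ≤ 8 := by
            have h1 := dot2_smul_self_le he ht
            have h2 := dot2_smul_self_le he' hr
            unfold dot2 at *
            simp only [Prod.fst_add, Prod.snd_add]
            nlinarith [sq_nonneg ((t • e).1 - (r • e').1), sq_nonneg ((t • e).2 - (r • e').2)]
          have := hH R hR x (t • e + r • e') e e' hd he he'
          rwa [← add_assoc] at this
      have e1 : x + t • e + e' = x + e' + t • e := by abel
      simp only [one_smul, zero_smul, add_zero, one_mul, zero_mul, sub_zero, e1] at h
      convert h using 2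
      ring
  have e1 : x + e' + e = x + e + e' := by abel
  simp only [one_smul, zero_smul, add_zero, one_mul, zero_mul, sub_zero, e1] at h
  convert h using 2
  ring

/-! ### The escape function and its weight -/

/-- A lattice point as a point of `ℝ²`. -/
def latPt (n : ℤ × ℤ) : ℝ × ℝ := ((n.1 : ℝ), (n.2 : ℝ))

lemma latPt_add (n k : ℤ × ℤ) : latPt (n + k) = latPt n + latPt k := by
  simp [latPt]

lemma dot2_latPt_le_two {e : ℤ × ℤ} (he : e ∈ nbrs) : dot2 (latPt e) (latPt e) ≤ 2 := by
  simp only [nbrs, Finset.mem_insert, Finset.mem_singleton] at he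
  rcases he with rfl | rfl | rfl | rfl | rfl | rfl <;> norm_num [dot2, latPt]

/-- Squared radius at a lattice point. -/
def latRad (R : ℝ) (n : ℤ × ℤ) : ℝ := sqRad R (latPt n)

/-- The weight `(R² + |n|²)^{-s/2}`. -/
def wt (s R : ℝ) (n : ℤ × ℤ) : ℝ := latRad R n ^ (-s / 2)

/-- The escape function; its Hessian is bounded below by `wt²`. -/
def esc (s R : ℝ) (n : ℤ × ℤ) : ℝ :=
  2 * s / (2 * s - 1) * R ^ (1 - 2 * s) * latRad R n ^ (1 / 2 : ℝ)
    - 1 / ((2 * s - 1) * (2 - 2 * s)) * latRad R n ^ (1 - s)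

lemma jap_pos (t : ℝ) : 0 < jap t := by
  unfold jap; positivity

lemma jap_sq (t : ℝ) : jap t ^ 2 = 1 / 2 + t ^ 2 := by
  unfold jap; exact Real.sq_sqrt (by positivity)

lemma abs_add_two_le_jap (t : ℝ) : |t| + 2 ≤ 4 * jap t := by
  have h := jap_sq t
  have hp := jap_pos t
  have : |t| ^ 2 = t ^ 2 := sq_abs t
  nlinarith [abs_nonneg t, sq_nonneg (|t| - 1)]

lemma jap_add_le (t d : ℝ) (hd : |d| ≤ 1) : jap (t + d) ≤ 3 * jap t := by
  refine le_of_sq_le_sq ?_ (by have := jap_pos t; positivity)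
  rw [mul_pow, jap_sq, jap_sq]
  have : d ^ 2 ≤ 1 := by rw [← sq_abs]; nlinarith [abs_nonneg d]
  nlinarith [sq_nonneg (t - d)]

lemma one_le_Lam (n : ℤ × ℤ) : 1 ≤ Lam n := by
  have h1 := jap_sq n.1
  have h2 := jap_sq n.2
  have p1 := jap_pos n.1
  have p2 := jap_pos n.2
  unfold Lam
  nlinarith [sq_nonneg (n.1 : ℝ), sq_nonneg (n.2 : ℝ)]

lemma Lam_pos (n : ℤ × ℤ) : 0 < Lam n := one_pos.trans_le (one_le_Lam n)

lemma Lam_add_le (n : ℤ × ℤ) {e : ℤ × ℤ} (he : e ∈ nbrs) : Lam (n + e) ≤ 3 * Lam n := by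
  have h : |(e.1 : ℝ)| ≤ 1 ∧ |(e.2 : ℝ)| ≤ 1 := by
    simp only [nbrs, Finset.mem_insert, Finset.mem_singleton] at he
    rcases he with rfl | rfl | rfl | rfl | rfl | rfl <;> norm_num
  unfold Lam
  simp only [Prod.fst_add, Prod.snd_add, Int.cast_add]
  linarith [jap_add_le n.1 e.1 h.1, jap_add_le n.2 e.2 h.2]

lemma latRad_le_Lam {R : ℝ} (hR : 4 ≤ R) (n : ℤ × ℤ) : latRad R n ≤ R ^ 2 * Lam n ^ 2 := by
  have h1 := jap_sq n.1
  have h2 := jap_sq n.2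
  have p1 := jap_pos n.1
  have p2 := jap_pos n.2
  have h : 1 + ((n.1 : ℝ) ^ 2 + (n.2 : ℝ) ^ 2) ≤ Lam n ^ 2 := by
    unfold Lam; nlinarith [mul_pos p1 p2]
  have h3 : latRad R n = R ^ 2 + ((n.1 : ℝ) ^ 2 + (n.2 : ℝ) ^ 2) := by
    simp [latRad, sqRad, dot2, latPt]; ring
  rw [h3]
  have h4 : (1 : ℝ) ≤ R ^ 2 := by nlinarith
  nlinarith [sq_nonneg (n.1 : ℝ), sq_nonneg (n.2 : ℝ)]

lemma latRad_pos {R : ℝ} (hR : 4 ≤ R) (n : ℤ × ℤ) : 0 < latRad R n := sqRad_pos hR _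

lemma one_le_latRad {R : ℝ} (hR : 4 ≤ R) (n : ℤ × ℤ) : 1 ≤ latRad R n :=
  le_trans (by norm_num) (sixteen_le_sqRad hR _)

lemma latRad_rpow_le {R : ℝ} (hR : 4 ≤ R) (n : ℤ × ℤ) {e : ℤ × ℤ} (he : e ∈ nbrs) (γ : ℝ) :
    latRad R n ^ γ ≤ 3 ^ |γ| * latRad R (n + e) ^ γ := by
  have h := sqRad_add_rpow_le hR (latPt (n + e)) (d := latPt (-e))
    ((dot2_latPt_le_two (neg_mem_nbrs he)).trans (by norm_num)) γ
  rw [← latPt_add, add_neg_cancel_right] at h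
  exact h

lemma latRad_rpow_neg_half_le {R : ℝ} (hR : 4 ≤ R) (n : ℤ × ℤ) :
    latRad R n ^ (-(1 / 2) : ℝ) ≤ 1 / R := by
  have h := sq_le_sqRad R (latPt n)
  have hR0 : 0 < R := by linarith
  rw [Real.rpow_neg (latRad_pos hR n).le, ← Real.sqrt_eq_rpow, one_div]
  refine inv_anti₀ hR0 ?_
  exact Real.le_sqrt_of_sq_le h

lemma wt_pos {s R : ℝ} (hR : 4 ≤ R) (n : ℤ × ℤ) : 0 < wt s R n :=
  Real.rpow_pos_of_pos (latRad_pos hR n) _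

lemma wt_sq {s R : ℝ} (hR : 4 ≤ R) (n : ℤ × ℤ) : wt s R n ^ 2 = latRad R n ^ (-s) := by
  unfold wt
  rw [← Real.rpow_natCast, ← Real.rpow_mul (latRad_pos hR n).le]
  congr 1
  push_cast; ring

lemma wt_le_one {s R : ℝ} (hs : 0 ≤ s) (hR : 4 ≤ R) (n : ℤ × ℤ) : wt s R n ≤ 1 :=
  Real.rpow_le_one_of_one_le_of_nonpos (one_le_latRad hR n) (by linarith)

lemma wt_le_mul_wt_add {s R : ℝ} (hR : 4 ≤ R) (n : ℤ × ℤ) {e : ℤ × ℤ} (he : e ∈ nbrs) :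
    wt s R n ≤ 3 ^ |-s / 2| * wt s R (n + e) :=
  latRad_rpow_le hR n he _

lemma Lam_rpow_neg_le_wt {s R : ℝ} (hs : 0 ≤ s) (hR : 4 ≤ R) (n : ℤ × ℤ) :
    Lam n ^ (-s) ≤ R ^ s * wt s R n := by
  have hR0 : 0 < R := by linarith
  have hL := Lam_pos n
  have h := Real.rpow_le_rpow_of_nonpos (latRad_pos hR n) (latRad_le_Lam hR n)
    (z := -s / 2) (by linarith)
  rw [← mul_pow, ← Real.rpow_natCast, ← Real.rpow_mul (by positivity),
    show ((2 : ℕ) : ℝ) * (-s / 2) = -s by push_cast; ring,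
    Real.mul_rpow hR0.le hL.le, Real.rpow_neg hR0.le] at h
  have hRs : 0 < R ^ s := Real.rpow_pos_of_pos hR0 _
  calc Lam n ^ (-s) = R ^ s * ((R ^ s)⁻¹ * Lam n ^ (-s)) := by field_simp
    _ ≤ R ^ s * wt s R n := by gcongr; exact h

lemma latRad_rpow_diff_le (α : ℝ) : ∃ C : ℝ, 0 < C ∧ ∀ R : ℝ, 4 ≤ R → ∀ n e : ℤ × ℤ, e ∈ nbrs →
    |latRad R (n + e) ^ α - latRad R n ^ α|
      ≤ C * (latRad R n ^ (α - 1) * (|dot2 (latPt n) (latPt e)| + 2)) := by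
  obtain ⟨C, hC, h⟩ := sqRad_rpow_diff_le α
  refine ⟨C, hC, fun R hR n e he => ?_⟩
  have := h R hR (latPt n) (latPt e) (dot2_latPt_le_two he)
  rwa [← latPt_add] at this

lemma abs_dot2_add_two_le {R : ℝ} (hR : 4 ≤ R) (n : ℤ × ℤ) {e : ℤ × ℤ} (he : e ∈ nbrs) :
    |dot2 (latPt n) (latPt e)| + 2 ≤ 4 * latRad R n ^ (1 / 2 : ℝ) := by
  have h1 := abs_dot2_le hR (latPt n) (e := latPt e) ((dot2_latPt_le_two he).trans (by norm_num))
  have h2 : (2 : ℝ) ≤ latRad R n ^ (1 / 2 : ℝ) := by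
    rw [← Real.sqrt_eq_rpow]
    refine Real.le_sqrt_of_sq_le ?_
    have := sixteen_le_sqRad hR (latPt n)
    unfold latRad; linarith
  unfold latRad at *
  linarith

lemma wt_diff_le (s : ℝ) : ∃ C : ℝ, 0 < C ∧ ∀ R : ℝ, 4 ≤ R → ∀ n e : ℤ × ℤ, e ∈ nbrs →
    |wt s R (n + e) - wt s R n| ≤ C / R * wt s R n := by
  obtain ⟨C, hC, h⟩ := latRad_rpow_diff_le (-s / 2)
  refine ⟨C * 4, by positivity, fun R hR n e he => (h R hR n e he).trans ?_⟩
  have hq := latRad_pos hR n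
  have hR0 : 0 < R := by linarith
  have hw := wt_pos (s := s) hR n
  calc C * (latRad R n ^ (-s / 2 - 1) * (|dot2 (latPt n) (latPt e)| + 2))
      ≤ C * (latRad R n ^ (-s / 2 - 1) * (4 * latRad R n ^ (1 / 2 : ℝ))) := by
        gcongr; exact abs_dot2_add_two_le hR n he
    _ = C * 4 * (wt s R n * latRad R n ^ (-(1 / 2) : ℝ)) := by
        unfold wt
        rw [← Real.rpow_add hq, show -s / 2 + -(1 / 2 : ℝ) = (-s / 2 - 1) + 1 / 2 by ring,
          Real.rpow_add hq]
        ring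
    _ ≤ C * 4 * (wt s R n * (1 / R)) := by gcongr; exact latRad_rpow_neg_half_le hR n
    _ = _ := by ring

/-- The radius `latRad` raised to `1/2 - s` is controlled by its value at the origin. -/
lemma latRad_rpow_le_R {s R : ℝ} (hs : 1 / 2 < s) (hR : 4 ≤ R) (n : ℤ × ℤ) :
    latRad R n ^ (1 / 2 - s) ≤ R ^ (1 - 2 * s) := by
  have hR0 : 0 < R := by linarith
  have h := Real.rpow_le_rpow_of_nonpos (by positivity) (sq_le_sqRad R (latPt n))
    (z := 1 / 2 - s) (by linarith)
  rw [← Real.rpow_natCast, ← Real.rpow_mul hR0.le] at h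
  rwa [show ((2 : ℕ) : ℝ) * (1 / 2 - s) = 1 - 2 * s by push_cast; ring] at h

lemma esc_diff_le {s : ℝ} (hs : 1 / 2 < s) : ∃ C : ℝ, 0 < C ∧ ∀ R : ℝ, 4 ≤ R →
    ∀ n e : ℤ × ℤ, e ∈ nbrs → |esc s R (n + e) - esc s R n|
      ≤ C * (R ^ (1 - 2 * s) * latRad R n ^ (-(1 / 2) : ℝ)
        * (|dot2 (latPt n) (latPt e)| + 2)) := by
  obtain ⟨C₁, hC₁, h₁⟩ := latRad_rpow_diff_le (1 / 2)
  obtain ⟨C₂, hC₂, h₂⟩ := latRad_rpow_diff_le (1 - s)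
  set a := 2 * s / (2 * s - 1)
  set b := 1 / ((2 * s - 1) * (2 - 2 * s))
  refine ⟨|a| * C₁ + |b| * C₂ + 1, by positivity, fun R hR n e he => ?_⟩
  have hR0 : 0 < R := by linarith
  have hRs : 0 < R ^ (1 - 2 * s) := Real.rpow_pos_of_pos hR0 _
  have hq := latRad_pos hR n
  have hqh : 0 < latRad R n ^ (-(1 / 2) : ℝ) := Real.rpow_pos_of_pos hq _
  have H₁ := h₁ R hR n e he
  have H₂ := h₂ R hR n e he
  rw [show (1 / 2 - 1 : ℝ) = -(1 / 2) by norm_num] at H₁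
  rw [show (1 - s - 1 : ℝ) = (1 / 2 - s) + (-(1 / 2)) by ring, Real.rpow_add hq] at H₂
  have hle := latRad_rpow_le_R hs hR n
  set D := |dot2 (latPt n) (latPt e)| + 2 with hD
  have hD0 : 0 < D := by positivity
  have e1 : esc s R (n + e) - esc s R n
      = a * R ^ (1 - 2 * s) * (latRad R (n + e) ^ (1 / 2 : ℝ) - latRad R n ^ (1 / 2 : ℝ))
        - b * (latRad R (n + e) ^ (1 - s) - latRad R n ^ (1 - s)) := by
    unfold esc; ring
  calc |esc s R (n + e) - esc s R n|
      ≤ |a| * R ^ (1 - 2 * s) * |latRad R (n + e) ^ (1 / 2 : ℝ) - latRad R n ^ (1 / 2 : ℝ)|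
        + |b| * |latRad R (n + e) ^ (1 - s) - latRad R n ^ (1 - s)| := by
        rw [e1]
        refine (abs_sub _ _).trans_eq ?_
        rw [abs_mul, abs_mul, abs_mul, abs_of_pos hRs]
    _ ≤ |a| * R ^ (1 - 2 * s) * (C₁ * (latRad R n ^ (-(1 / 2) : ℝ) * D))
        + |b| * (C₂ * (R ^ (1 - 2 * s) * latRad R n ^ (-(1 / 2) : ℝ) * D)) := by
        gcongr
        refine H₂.trans ?_
        gcongr
    _ = (|a| * C₁ + |b| * C₂) * (R ^ (1 - 2 * s) * latRad R n ^ (-(1 / 2) : ℝ) * D) := by ring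
    _ ≤ _ := mul_le_mul_of_nonneg_right (by linarith) (by positivity)

lemma esc_diff_bounded {s : ℝ} (hs : 1 / 2 < s) : ∃ C : ℝ, 0 < C ∧ ∀ R : ℝ, 4 ≤ R →
    ∀ n e : ℤ × ℤ, e ∈ nbrs → |esc s R (n + e) - esc s R n| ≤ C := by
  obtain ⟨C, hC, h⟩ := esc_diff_le hs
  refine ⟨C * 4, by positivity, fun R hR n e he => (h R hR n e he).trans ?_⟩
  have hq := latRad_pos hR n
  have hqh : 0 < latRad R n ^ (-(1 / 2) : ℝ) := Real.rpow_pos_of_pos hq _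
  have hR1 : R ^ (1 - 2 * s) ≤ 1 :=
    Real.rpow_le_one_of_one_le_of_nonpos (by linarith) (by linarith)
  calc C * (R ^ (1 - 2 * s) * latRad R n ^ (-(1 / 2) : ℝ) * (|dot2 (latPt n) (latPt e)| + 2))
      ≤ C * (1 * latRad R n ^ (-(1 / 2) : ℝ) * (4 * latRad R n ^ (1 / 2 : ℝ))) := by
        gcongr; exact abs_dot2_add_two_le hR n he
    _ = C * 4 * (latRad R n ^ (-(1 / 2) : ℝ) * latRad R n ^ (1 / 2 : ℝ)) := by ring
    _ = C * 4 := by rw [← Real.rpow_add hq]; simp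

lemma esc_diff_le_Lam {s : ℝ} (hs : 1 / 2 < s) : ∃ C : ℝ, 0 < C ∧ ∀ R : ℝ, 4 ≤ R →
    ∀ n e : ℤ × ℤ, e ∈ nbrs → |esc s R (n + e) - esc s R n|
      ≤ C * (wt s R n ^ 2 * Lam n ^ (s - 1) * (Lam n ^ s * jap (dot2 (latPt n) (latPt e)))) := by
  obtain ⟨C, hC, h⟩ := esc_diff_le hs
  refine ⟨C * 4, by positivity, fun R hR n e he => (h R hR n e he).trans ?_⟩
  have hR0 : 0 < R := by linarith
  have hL := Lam_pos n
  have hq := latRad_pos hR n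
  have hqs : 0 < latRad R n ^ (-s) := Real.rpow_pos_of_pos hq _
  have hRs : 0 < R ^ (1 - 2 * s) := Real.rpow_pos_of_pos hR0 _
  have key : latRad R n ^ (s - 1 / 2) ≤ R ^ (2 * s - 1) * Lam n ^ (2 * s - 1) := by
    have := Real.rpow_le_rpow hq.le (latRad_le_Lam hR n) (z := s - 1 / 2) (by linarith)
    rw [← mul_pow, ← Real.rpow_natCast, ← Real.rpow_mul (by positivity),
      show ((2 : ℕ) : ℝ) * (s - 1 / 2) = 2 * s - 1 by push_cast; ring,
      Real.mul_rpow hR0.le hL.le] at this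
    exact this
  rw [wt_sq hR]
  have e1 : latRad R n ^ (-(1 / 2) : ℝ) = latRad R n ^ (-s) * latRad R n ^ (s - 1 / 2) := by
    rw [← Real.rpow_add hq]; congr 1; ring
  have e2 : Lam n ^ (2 * s - 1) = Lam n ^ (s - 1) * Lam n ^ s := by
    rw [← Real.rpow_add hL]; congr 1; ring
  have e3 : R ^ (1 - 2 * s) * R ^ (2 * s - 1) = 1 := by
    rw [← Real.rpow_add hR0]; simp
  have hj := abs_add_two_le_jap (dot2 (latPt n) (latPt e))
  have hjp := jap_pos (dot2 (latPt n) (latPt e))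
  calc C * (R ^ (1 - 2 * s) * latRad R n ^ (-(1 / 2) : ℝ) * (|dot2 (latPt n) (latPt e)| + 2))
      ≤ C * (R ^ (1 - 2 * s) * (latRad R n ^ (-s) * (R ^ (2 * s - 1) * Lam n ^ (2 * s - 1)))
        * (4 * jap (dot2 (latPt n) (latPt e)))) := by
        rw [e1]; gcongr
    _ = C * 4 * (R ^ (1 - 2 * s) * R ^ (2 * s - 1)) * (latRad R n ^ (-s) * Lam n ^ (2 * s - 1)
        * jap (dot2 (latPt n) (latPt e))) := by ring
    _ = _ := by rw [e3, e2]; ring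

/-! ### Coercivity of the Hessian of the escape function -/

lemma sum_sum_mul_re {ι : Type*} (t : Finset ι) (c : ι → ℝ) (z : ι → ℂ) :
    ∑ e ∈ t, ∑ e' ∈ t, c e * c e' * ((starRingEnd ℂ) (z e') * z e).re
      = ‖∑ e ∈ t, (c e : ℂ) * z e‖ ^ 2 := by
  have h : ((‖∑ e ∈ t, (c e : ℂ) * z e‖ ^ 2 : ℝ) : ℂ)
      = (starRingEnd ℂ) (∑ e ∈ t, (c e : ℂ) * z e) * ∑ e ∈ t, (c e : ℂ) * z e := by
    rw [Complex.conj_mul']; push_cast; rfl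
  have h2 := congrArg Complex.re h
  rw [Complex.ofReal_re] at h2
  rw [h2, map_sum, mul_comm, Finset.sum_mul_sum, Complex.re_sum]
  refine Finset.sum_congr rfl fun e _ => ?_
  rw [Complex.re_sum]
  refine Finset.sum_congr rfl fun e' _ => ?_
  simp only [map_mul, Complex.conj_ofReal]
  rw [show (c e : ℂ) * z e * ((c e' : ℂ) * (starRingEnd ℂ) (z e'))
    = ((c e * c e' : ℝ) : ℂ) * ((starRingEnd ℂ) (z e') * z e) by push_cast; ring,
    Complex.re_ofReal_mul]

lemma abs_sum_sum_mul_re_le (E : ℝ) (d : ℤ × ℤ → ℤ × ℤ → ℝ) (z : ℤ × ℤ → ℂ)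
    (hd : ∀ e ∈ nbrs, ∀ e' ∈ nbrs, |d e e'| ≤ E) :
    |∑ e ∈ nbrs, ∑ e' ∈ nbrs, d e e' * ((starRingEnd ℂ) (z e') * z e).re|
      ≤ 6 * E * ∑ e ∈ nbrs, ‖z e‖ ^ 2 := by
  have hE : 0 ≤ E := (abs_nonneg _).trans (hd (1, 0) (by decide) (1, 0) (by decide))
  calc |∑ e ∈ nbrs, ∑ e' ∈ nbrs, d e e' * ((starRingEnd ℂ) (z e') * z e).re|
      ≤ ∑ e ∈ nbrs, ∑ e' ∈ nbrs, E * (‖z e‖ * ‖z e'‖) := by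
        refine (Finset.abs_sum_le_sum_abs _ _).trans (Finset.sum_le_sum fun e he => ?_)
        refine (Finset.abs_sum_le_sum_abs _ _).trans (Finset.sum_le_sum fun e' he' => ?_)
        rw [abs_mul, mul_comm ‖z e‖]
        exact mul_le_mul (hd e he e' he') (abs_re_conj_mul_le _ _) (abs_nonneg _) hE
    _ = E * (∑ e ∈ nbrs, ‖z e‖) ^ 2 := by
        rw [sq, Finset.sum_mul_sum, Finset.mul_sum]
        simp only [Finset.mul_sum]
    _ ≤ E * (6 * ∑ e ∈ nbrs, ‖z e‖ ^ 2) := by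
        gcongr
        have := sq_sum_le_card_mul_sum_sq (s := nbrs) (f := fun e => ‖z e‖)
        rwa [show nbrs.card = 6 from rfl] at this
    _ = _ := by ring

/-- Second difference of the escape function. -/
def escDD (s R : ℝ) (n e e' : ℤ × ℤ) : ℝ :=
  esc s R (n + e + e') - esc s R (n + e) - esc s R (n + e') + esc s R n

/-- The Hessian of the escape function. -/
def escHess (s R : ℝ) (n e e' : ℤ × ℤ) : ℝ :=
  2 * s / (2 * s - 1) * R ^ (1 - 2 * s) * hessPow (1 / 2) R (latPt n) (latPt e) (latPt e')
    - 1 / ((2 * s - 1) * (2 - 2 * s)) * hessPow (1 - s) R (latPt n) (latPt e) (latPt e')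

lemma escDD_sub_escHess_le {s : ℝ} (hs : 1 / 2 < s) (hs1 : s < 1) : ∃ C : ℝ, 0 < C ∧
    ∀ R : ℝ, 4 ≤ R → ∀ n e e' : ℤ × ℤ, e ∈ nbrs → e' ∈ nbrs →
    |escDD s R n e e' - escHess s R n e e'| ≤ C / R * wt s R n ^ 2 := by
  obtain ⟨C₁, hC₁, h₁⟩ := sqRad_rpow_second_diff (1 / 2)
  obtain ⟨C₂, hC₂, h₂⟩ := sqRad_rpow_second_diff (1 - s)
  have ha : 0 < 2 * s / (2 * s - 1) := div_pos (by linarith) (by linarith)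
  have hb : 0 < 1 / ((2 * s - 1) * (2 - 2 * s)) :=
    div_pos one_pos (mul_pos (by linarith) (by linarith))
  refine ⟨2 * s / (2 * s - 1) * C₁ + 1 / ((2 * s - 1) * (2 - 2 * s)) * C₂, by positivity,
    fun R hR n e e' he he' => ?_⟩
  have hR0 : 0 < R := by linarith
  have hq := latRad_pos hR n
  have H₁ := h₁ R hR (latPt n) (latPt e) (latPt e') (dot2_latPt_le_two he) (dot2_latPt_le_two he')
  have H₂ := h₂ R hR (latPt n) (latPt e) (latPt e') (dot2_latPt_le_two he) (dot2_latPt_le_two he')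
  simp only [← latPt_add] at H₁ H₂
  change |latRad R (n + e + e') ^ (1 / 2 : ℝ) - latRad R (n + e) ^ (1 / 2 : ℝ)
    - latRad R (n + e') ^ (1 / 2 : ℝ) + latRad R n ^ (1 / 2 : ℝ) - _|
      ≤ C₁ * latRad R n ^ (1 / 2 - 3 / 2 : ℝ) at H₁
  change |latRad R (n + e + e') ^ (1 - s) - latRad R (n + e) ^ (1 - s)
    - latRad R (n + e') ^ (1 - s) + latRad R n ^ (1 - s) - _|
      ≤ C₂ * latRad R n ^ (1 - s - 3 / 2) at H₂
  set a := 2 * s / (2 * s - 1)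
  set b := 1 / ((2 * s - 1) * (2 - 2 * s))
  have hRs : 0 < R ^ (1 - 2 * s) := Real.rpow_pos_of_pos hR0 _
  have hqs : 0 < latRad R n ^ (-s) := Real.rpow_pos_of_pos hq _
  have E₁ : R ^ (1 - 2 * s) * latRad R n ^ (1 / 2 - 3 / 2 : ℝ) ≤ 1 / R * latRad R n ^ (-s) := by
    have h := latRad_rpow_le_R (s := 3 / 2 - s) (by linarith) hR n
    rw [show (1 / 2 - 3 / 2 : ℝ) = -s + (1 / 2 - (3 / 2 - s)) by ring, Real.rpow_add hq]
    calc _ ≤ R ^ (1 - 2 * s) * (latRad R n ^ (-s) * R ^ (1 - 2 * (3 / 2 - s))) := by gcongr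
      _ = R ^ (1 - 2 * s) * R ^ (1 - 2 * (3 / 2 - s)) * latRad R n ^ (-s) := by ring
      _ = _ := by
        rw [← Real.rpow_add hR0, show 1 - 2 * s + (1 - 2 * (3 / 2 - s)) = -1 by ring,
          Real.rpow_neg_one, one_div]
  have E₂ : latRad R n ^ (1 - s - 3 / 2) ≤ 1 / R * latRad R n ^ (-s) := by
    rw [show 1 - s - 3 / 2 = -(1 / 2) + -s by ring, Real.rpow_add hq]
    gcongr
    exact latRad_rpow_neg_half_le hR n
  rw [wt_sq hR]
  set X := latRad R (n + e + e') ^ (1 / 2 : ℝ) - latRad R (n + e) ^ (1 / 2 : ℝ)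
    - latRad R (n + e') ^ (1 / 2 : ℝ) + latRad R n ^ (1 / 2 : ℝ)
    - hessPow (1 / 2) R (latPt n) (latPt e) (latPt e') with hX
  set Y := latRad R (n + e + e') ^ (1 - s) - latRad R (n + e) ^ (1 - s)
    - latRad R (n + e') ^ (1 - s) + latRad R n ^ (1 - s)
    - hessPow (1 - s) R (latPt n) (latPt e) (latPt e') with hY
  have e1 : escDD s R n e e' - escHess s R n e e' = a * R ^ (1 - 2 * s) * X - b * Y := by
    simp only [escDD, escHess, esc, hX, hY, a, b]; ring
  calc |escDD s R n e e' - escHess s R n e e'|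
      ≤ a * R ^ (1 - 2 * s) * |X| + b * |Y| := by
        rw [e1]
        refine (abs_sub _ _).trans_eq ?_
        rw [abs_mul, abs_mul, abs_mul, abs_of_pos hRs, abs_of_pos ha, abs_of_pos hb]
    _ ≤ a * R ^ (1 - 2 * s) * (C₁ * latRad R n ^ (1 / 2 - 3 / 2 : ℝ))
        + b * (C₂ * (1 / R * latRad R n ^ (-s))) := by
        gcongr
        exact H₂.trans (by gcongr)
    _ = a * C₁ * (R ^ (1 - 2 * s) * latRad R n ^ (1 / 2 - 3 / 2 : ℝ))
        + b * C₂ * (1 / R * latRad R n ^ (-s)) := by ring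
    _ ≤ a * C₁ * (1 / R * latRad R n ^ (-s)) + b * C₂ * (1 / R * latRad R n ^ (-s)) := by
        gcongr
    _ = _ := by ring

lemma sum_sum_hessPow (α R : ℝ) (x : ℝ × ℝ) (z : ℤ × ℤ → ℂ) :
    ∑ e ∈ nbrs, ∑ e' ∈ nbrs, hessPow α R x (latPt e) (latPt e')
        * ((starRingEnd ℂ) (z e') * z e).re
      = 2 * α * sqRad R x ^ (α - 1) * (‖∑ e ∈ nbrs, (e.1 : ℂ) * z e‖ ^ 2
          + ‖∑ e ∈ nbrs, (e.2 : ℂ) * z e‖ ^ 2)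
        + 4 * α * (α - 1) * sqRad R x ^ (α - 2)
          * ‖∑ e ∈ nbrs, (dot2 x (latPt e) : ℂ) * z e‖ ^ 2 := by
  have h1 := sum_sum_mul_re nbrs (fun e => (e.1 : ℝ)) z
  have h2 := sum_sum_mul_re nbrs (fun e => (e.2 : ℝ)) z
  have h3 := sum_sum_mul_re nbrs (fun e => dot2 x (latPt e)) z
  simp only [Complex.ofReal_intCast] at h1 h2
  rw [← h1, ← h2, ← h3, ← Finset.sum_add_distrib, Finset.mul_sum, Finset.mul_sum,
    ← Finset.sum_add_distrib]
  refine Finset.sum_congr rfl fun e _ => ?_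
  rw [← Finset.sum_add_distrib, Finset.mul_sum, Finset.mul_sum, ← Finset.sum_add_distrib]
  refine Finset.sum_congr rfl fun e' _ => ?_
  simp only [hessPow, show dot2 (latPt e) (latPt e') = (e.1 : ℝ) * e'.1 + (e.2 : ℝ) * e'.2 from rfl]
  ring

lemma norm_sq_lin_comb_le (x : ℝ × ℝ) (w₁ w₂ : ℂ) :
    ‖(x.1 : ℂ) * w₁ + (x.2 : ℂ) * w₂‖ ^ 2 ≤ dot2 x x * (‖w₁‖ ^ 2 + ‖w₂‖ ^ 2) := by
  have h : ‖(x.1 : ℂ) * w₁ + (x.2 : ℂ) * w₂‖ ≤ |x.1| * ‖w₁‖ + |x.2| * ‖w₂‖ := by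
    refine (norm_add_le _ _).trans_eq ?_
    simp
  have h2 : (|x.1| * ‖w₁‖ + |x.2| * ‖w₂‖) ^ 2 ≤ dot2 x x * (‖w₁‖ ^ 2 + ‖w₂‖ ^ 2) := by
    have h3 := sq_nonneg (|x.1| * ‖w₂‖ - |x.2| * ‖w₁‖)
    unfold dot2
    rw [← abs_mul_abs_self x.1, ← abs_mul_abs_self x.2]
    nlinarith
  exact (pow_le_pow_left₀ (norm_nonneg _) h 2).trans h2

lemma le_sum_sum_escHess {s R : ℝ} (hs : 1 / 2 < s) (hs1 : s < 1) (hR : 4 ≤ R) (n : ℤ × ℤ)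
    (z : ℤ × ℤ → ℂ) :
    wt s R n ^ 2 * (‖∑ e ∈ nbrs, (e.1 : ℂ) * z e‖ ^ 2 + ‖∑ e ∈ nbrs, (e.2 : ℂ) * z e‖ ^ 2)
      ≤ ∑ e ∈ nbrs, ∑ e' ∈ nbrs, escHess s R n e e' * ((starRingEnd ℂ) (z e') * z e).re := by
  have hq := latRad_pos hR n
  set q := latRad R n with hqdef
  have hqs : 0 < q ^ (-s) := Real.rpow_pos_of_pos hq _
  set w₁ := ∑ e ∈ nbrs, (e.1 : ℂ) * z e with hw₁
  set w₂ := ∑ e ∈ nbrs, (e.2 : ℂ) * z e with hw₂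
  set P := ‖∑ e ∈ nbrs, (dot2 (latPt n) (latPt e) : ℂ) * z e‖ ^ 2 with hP
  have hPle : P ≤ q * (‖w₁‖ ^ 2 + ‖w₂‖ ^ 2) := by
    have e1 : ∑ e ∈ nbrs, (dot2 (latPt n) (latPt e) : ℂ) * z e
        = ((latPt n).1 : ℂ) * w₁ + ((latPt n).2 : ℂ) * w₂ := by
      rw [hw₁, hw₂, Finset.mul_sum, Finset.mul_sum, ← Finset.sum_add_distrib]
      refine Finset.sum_congr rfl fun e _ => ?_
      simp only [dot2, latPt]; push_cast; ring
    rw [hP, e1]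
    refine (norm_sq_lin_comb_le _ _ _).trans ?_
    gcongr
    rw [hqdef, latRad, sqRad]
    linarith [sq_nonneg R]
  set Z := ‖w₁‖ ^ 2 + ‖w₂‖ ^ 2 with hZ
  have hs2 : 2 * s - 1 ≠ 0 := by linarith
  have hs3 : 1 - s ≠ 0 := by linarith
  set A := 2 * s / (2 * s - 1) * R ^ (1 - 2 * s) * q ^ (-(1 / 2) : ℝ) with hA
  have hAle : 2 * s / (2 * s - 1) * q ^ (-s) ≤ A := by
    have h := latRad_rpow_le_R hs hR n
    have ha : 0 < 2 * s / (2 * s - 1) := div_pos (by linarith) (by linarith)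
    rw [hA, show -s = 1 / 2 - s + -(1 / 2) by ring, Real.rpow_add hq, ← mul_assoc]
    gcongr
  have hsum : ∑ e ∈ nbrs, ∑ e' ∈ nbrs, escHess s R n e e' * ((starRingEnd ℂ) (z e') * z e).re
      = (A - 1 / (2 * s - 1) * q ^ (-s)) * Z
        - (A - 2 * s / (2 * s - 1) * q ^ (-s)) * (P / q) := by
    simp only [escHess, sub_mul, Finset.sum_sub_distrib, mul_assoc, ← Finset.mul_sum]
    simp only [← mul_assoc]
    rw [sum_sum_hessPow, sum_sum_hessPow, ← hP, ← hZ, hA]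
    change _ * (2 * (1 / 2) * q ^ (1 / 2 - 1 : ℝ) * Z
        + 4 * (1 / 2) * (1 / 2 - 1) * q ^ (1 / 2 - 2 : ℝ) * P)
      - _ * (2 * (1 - s) * q ^ (1 - s - 1) * Z + 4 * (1 - s) * (1 - s - 1) * q ^ (1 - s - 2) * P)
      = _
    rw [show (1 / 2 - 2 : ℝ) = -(1 / 2) - 1 by norm_num,
      show (1 / 2 - 1 : ℝ) = -(1 / 2) by norm_num,
      show 1 - s - 2 = -s - 1 by ring, show 1 - s - 1 = -s by ring, Real.rpow_sub_one hq.ne',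
      Real.rpow_sub_one hq.ne']
    field_simp
    ring
  rw [hsum, wt_sq hR, ← hqdef]
  have hPq : P / q ≤ Z := by rw [div_le_iff₀ hq]; linarith
  have h1 : (A - 2 * s / (2 * s - 1) * q ^ (-s)) * (P / q)
      ≤ (A - 2 * s / (2 * s - 1) * q ^ (-s)) * Z :=
    mul_le_mul_of_nonneg_left hPq (by linarith)
  have h2 : 2 * s / (2 * s - 1) - 1 / (2 * s - 1) = 1 := by field_simp
  have h3 : (A - 1 / (2 * s - 1) * q ^ (-s)) * Z - (A - 2 * s / (2 * s - 1) * q ^ (-s)) * Z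
      = (2 * s / (2 * s - 1) - 1 / (2 * s - 1)) * q ^ (-s) * Z := by ring
  rw [h2, one_mul] at h3
  linarith

lemma le_sum_sum_escDD {s : ℝ} (hs : 1 / 2 < s) (hs1 : s < 1) : ∃ C : ℝ, 0 < C ∧
    ∀ R : ℝ, 4 ≤ R → ∀ (n : ℤ × ℤ) (u : ℤ × ℤ → ℂ),
    wt s R n ^ 2 * (‖vel1 u n‖ ^ 2 + ‖vel2 u n‖ ^ 2)
      ≤ ∑ e ∈ nbrs, ∑ e' ∈ nbrs,
          escDD s R n e e' * ((starRingEnd ℂ) (u (n + e')) * u (n + e)).re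
        + C / R * wt s R n ^ 2 * ∑ e ∈ nbrs, ‖u (n + e)‖ ^ 2 := by
  obtain ⟨C, hC, h⟩ := escDD_sub_escHess_le hs hs1
  refine ⟨6 * C, by positivity, fun R hR n u => ?_⟩
  have h1 := le_sum_sum_escHess hs hs1 hR n (fun e => u (n + e))
  have h2 := abs_sum_sum_mul_re_le _ (fun e e' => escDD s R n e e' - escHess s R n e e')
    (fun e => u (n + e)) (fun e he e' he' => h R hR n e e' he he')
  simp only [sub_mul, Finset.sum_sub_distrib] at h2
  have h3 := neg_le_of_abs_le h2
  have h4 : 6 * (C / R * wt s R n ^ 2) = 6 * C / R * wt s R n ^ 2 := by ring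
  rw [h4] at h3
  unfold vel1 vel2
  linarith

/-! ### The commutator identity -/

lemma re_conj_mul_comm (x y : ℂ) :
    ((starRingEnd ℂ) x * y).re = ((starRingEnd ℂ) y * x).re := by
  simp only [Complex.mul_re, Complex.conj_re, Complex.conj_im]; ring

lemma tsum_sum_sum_translate_eq_zero {θ : ℤ × ℤ → ℝ} {K : ℝ}
    (hθ : ∀ n, ∀ e ∈ nbrs, |θ (n + e) - θ n| ≤ K) {u : ℤ × ℤ → ℂ} (hu : SqSummable u) :
    ∑' n, ∑ e ∈ nbrs, ∑ e' ∈ nbrs,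
      (θ (n + e + e') - θ n) * ((starRingEnd ℂ) (u (n + e')) * u (n + e)).re = 0 := by
  have hs : ∀ e ∈ nbrs, ∀ e' ∈ nbrs, Summable fun n =>
      (θ (n + e + e') - θ n) * ((starRingEnd ℂ) (u (n + e')) * u (n + e)).re := by
    intro e he e' he'
    refine (hu.shift e').summable_mul_re (hu.shift e) (C := K + K) fun n => ?_
    have h := abs_add_le (θ (n + e + e') - θ (n + e)) (θ (n + e) - θ n)
    rw [sub_add_sub_cancel] at h
    exact h.trans (add_le_add (hθ _ e' he') (hθ _ e he))
  set T : ℤ × ℤ → ℤ × ℤ → ℝ := fun e e' =>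
    ∑' n, (θ (n + e + e') - θ n) * ((starRingEnd ℂ) (u (n + e')) * u (n + e)).re with hT
  have h1 : ∑' n, ∑ e ∈ nbrs, ∑ e' ∈ nbrs,
      (θ (n + e + e') - θ n) * ((starRingEnd ℂ) (u (n + e')) * u (n + e)).re
        = ∑ e ∈ nbrs, ∑ e' ∈ nbrs, T e e' := by
    rw [Summable.tsum_finsetSum fun e he => summable_sum fun e' he' => hs e he e' he']
    exact Finset.sum_congr rfl fun e he => Summable.tsum_finsetSum fun e' he' => hs e he e' he'
  have h2 : ∀ e e', T e e' = -T (-e') (-e) := by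
    intro e e'
    simp only [hT]
    rw [← tsum_neg, ← tsum_shift (fun n => -((θ (n + -e' + -e) - θ n)
      * ((starRingEnd ℂ) (u (n + -e)) * u (n + -e')).re)) (e + e')]
    refine tsum_congr fun n => ?_
    rw [show n + (e + e') + -e' + -e = n by abel, show n + (e + e') + -e = n + e' by abel,
      show n + (e + e') + -e' = n + e by abel, show n + (e + e') = n + e + e' by abel,
      re_conj_mul_comm]
    ring
  have h3 : ∑ e ∈ nbrs, ∑ e' ∈ nbrs, T e e' = -∑ e ∈ nbrs, ∑ e' ∈ nbrs, T e e' := by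
    conv_rhs => rw [← sum_nbrs_neg]
    rw [← Finset.sum_neg_distrib, Finset.sum_comm]
    refine Finset.sum_congr rfl fun e _ => ?_
    rw [← sum_nbrs_neg (fun e' => T (-e) e'), ← Finset.sum_neg_distrib]
    exact Finset.sum_congr rfl fun e' _ => h2 e' e
  rw [h1]
  linarith

lemma sum_sum_second_diff (θ : ℤ × ℤ → ℝ) (u : ℤ × ℤ → ℂ) (n : ℤ × ℤ) :
    ∑ e ∈ nbrs, ∑ e' ∈ nbrs, (θ (n + e + e') - θ (n + e) - θ (n + e') + θ n)
        * ((starRingEnd ℂ) (u (n + e')) * u (n + e)).re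
      = ∑ e ∈ nbrs, ∑ e' ∈ nbrs,
          (θ (n + e + e') - θ n) * ((starRingEnd ℂ) (u (n + e')) * u (n + e)).re
        - 2 * ∑ e ∈ nbrs, (θ (n + e) - θ n) * ((starRingEnd ℂ) (nbrSum u n) * u (n + e)).re := by
  have h1 : ∑ e ∈ nbrs, (θ (n + e) - θ n) * ((starRingEnd ℂ) (nbrSum u n) * u (n + e)).re
      = ∑ e ∈ nbrs, ∑ e' ∈ nbrs,
        (θ (n + e) - θ n) * ((starRingEnd ℂ) (u (n + e')) * u (n + e)).re := by
    refine Finset.sum_congr rfl fun e _ => ?_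
    rw [nbrSum, map_sum, Finset.sum_mul, Complex.re_sum, Finset.mul_sum]
  have h2 : ∑ e ∈ nbrs, (θ (n + e) - θ n) * ((starRingEnd ℂ) (nbrSum u n) * u (n + e)).re
      = ∑ e ∈ nbrs, ∑ e' ∈ nbrs,
        (θ (n + e') - θ n) * ((starRingEnd ℂ) (u (n + e')) * u (n + e)).re := by
    rw [h1, Finset.sum_comm]
    refine Finset.sum_congr rfl fun e _ => Finset.sum_congr rfl fun e' _ => ?_
    rw [re_conj_mul_comm]
  rw [two_mul]
  nth_rewrite 1 [h1]
  rw [h2]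
  simp only [← Finset.sum_add_distrib, ← Finset.sum_sub_distrib]
  refine Finset.sum_congr rfl fun e _ => Finset.sum_congr rfl fun e' _ => ?_
  ring

/-- Half of the six neighbours. -/
def posNbrs : Finset (ℤ × ℤ) := {(1, 0), (0, 1), (1, -1)}

lemma mem_nbrs_of_mem_posNbrs {e : ℤ × ℤ} (he : e ∈ posNbrs) : e ∈ nbrs := by
  revert e; decide

lemma sum_nbrs_eq_sum_posNbrs (g : ℤ × ℤ → ℝ) :
    ∑ e ∈ nbrs, g e = ∑ e ∈ posNbrs, (g e + g (-e)) := by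
  rw [sum_nbrs]
  simp [posNbrs]
  ring

/-- The potential part of the commutator only sees differences of the potential. -/
lemma tsum_sum_potential {θ c : ℤ × ℤ → ℝ} {K B : ℝ}
    (hθ : ∀ n, ∀ e ∈ nbrs, |θ (n + e) - θ n| ≤ K) (hc : ∀ n, |c n| ≤ B)
    {u : ℤ × ℤ → ℂ} (hu : SqSummable u) :
    ∑' n, ∑ e ∈ nbrs, c n * (θ (n + e) - θ n) * ((starRingEnd ℂ) (u n) * u (n + e)).re
      = ∑ e ∈ posNbrs, ∑' n, (c n - c (n + e)) * (θ (n + e) - θ n)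
          * ((starRingEnd ℂ) (u n) * u (n + e)).re := by
  have hb : ∀ (k : ℤ × ℤ), ∀ e ∈ nbrs, ∀ n, |c (n + k) * (θ (n + e) - θ n)| ≤ B * K := by
    intro k e he n
    rw [abs_mul]
    exact mul_le_mul (hc _) (hθ n e he) (abs_nonneg _) ((abs_nonneg _).trans (hc 0))
  have hs : ∀ (k : ℤ × ℤ), ∀ e ∈ nbrs, Summable fun n =>
      c (n + k) * (θ (n + e) - θ n) * ((starRingEnd ℂ) (u n) * u (n + e)).re :=
    fun k e he => hu.summable_mul_re (hu.shift e) (hb k e he)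
  have hs0 : ∀ e ∈ nbrs, Summable fun n =>
      c n * (θ (n + e) - θ n) * ((starRingEnd ℂ) (u n) * u (n + e)).re := by
    intro e he; simpa using hs 0 e he
  rw [Summable.tsum_finsetSum hs0, sum_nbrs_eq_sum_posNbrs]
  refine Finset.sum_congr rfl fun e he => ?_
  have he' := mem_nbrs_of_mem_posNbrs he
  have h1 : ∑' n, c n * (θ (n + -e) - θ n) * ((starRingEnd ℂ) (u n) * u (n + -e)).re
      = -∑' n, c (n + e) * (θ (n + e) - θ n) * ((starRingEnd ℂ) (u n) * u (n + e)).re := by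
    rw [← tsum_neg, ← tsum_shift _ e]
    refine tsum_congr fun n => ?_
    rw [add_neg_cancel_right, re_conj_mul_comm]
    ring
  rw [h1, ← sub_eq_add_neg, ← (hs0 e he').tsum_sub (hs e e he')]
  refine tsum_congr fun n => ?_
  ring

lemma mul_le_young {τ : ℝ} (hτ : 0 < τ) (x y : ℝ) : x * y ≤ τ * x ^ 2 + 1 / τ * y ^ 2 := by
  have h : 0 ≤ (τ * x - y) ^ 2 / τ := by positivity
  have h2 : (τ * x - y) ^ 2 / τ = τ * x ^ 2 - 2 * (x * y) + 1 / τ * y ^ 2 := by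
    field_simp
    ring
  have h3 : 0 ≤ τ * x ^ 2 := by positivity
  have h4 : 0 ≤ 1 / τ * y ^ 2 := by positivity
  by_cases hxy : 0 ≤ x * y <;> nlinarith

lemma summable_wt_sq {s R : ℝ} (hs : 0 ≤ s) (hR : 4 ≤ R) {u : ℤ × ℤ → ℂ} (hu : SqSummable u) :
    Summable fun n => wt s R n ^ 2 * ‖u n‖ ^ 2 :=
  hu.summable_mul_sq (C := 1) fun n => by
    have h := wt_pos (s := s) hR n
    rw [abs_of_pos (by positivity)]
    exact pow_le_one₀ h.le (wt_le_one hs hR n)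

/-- Absorption estimate: the imaginary part of the spectral parameter is controlled by the source
term. -/
lemma rho_tsum_le {s R G ρ m₀ M τ : ℝ} (hs : 0 ≤ s) (hR : 4 ≤ R) (hG : 0 ≤ G) (hρ : 0 ≤ ρ)
    (hτ : 0 < τ) {u g φ : ℤ × ℤ → ℂ} {m c : ℤ × ℤ → ℝ} (hu : SqSummable u) (hφ : SqSummable φ)
    (hg : ∀ n, ‖g n‖ ≤ G * (wt s R n * ‖φ n‖)) (hm₀ : ∀ n, m₀ ≤ m n) (hm : ∀ n, |m n| ≤ M)
    (heq : ∀ n, nbrSum u n = 6 * (c n * u n + (g n + Complex.I * (ρ * m n) * u n))) :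
    m₀ * (ρ * ∑' n, ‖u n‖ ^ 2)
      ≤ G * (τ * ∑' n, wt s R n ^ 2 * ‖u n‖ ^ 2 + 1 / τ * ∑' n, ‖φ n‖ ^ 2) := by
  have hN := summable_wt_sq hs hR hu
  have hdom : Summable fun n => G * (τ * (wt s R n ^ 2 * ‖u n‖ ^ 2) + 1 / τ * ‖φ n‖ ^ 2) :=
    ((hN.mul_left τ).add (Summable.mul_left (1 / τ) hφ)).mul_left G
  have hbd : ∀ n, |((starRingEnd ℂ) (u n) * g n).im|
      ≤ G * (τ * (wt s R n ^ 2 * ‖u n‖ ^ 2) + 1 / τ * ‖φ n‖ ^ 2) := by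
    intro n
    calc _ ≤ ‖u n‖ * ‖g n‖ := abs_im_conj_mul_le _ _
      _ ≤ ‖u n‖ * (G * (wt s R n * ‖φ n‖)) := by gcongr; exact hg n
      _ = G * ((wt s R n * ‖u n‖) * ‖φ n‖) := by ring
      _ ≤ G * (τ * (wt s R n * ‖u n‖) ^ 2 + 1 / τ * ‖φ n‖ ^ 2) := by
        gcongr; exact mul_le_young hτ _ _
      _ = _ := by ring
  have hgs : Summable fun n => ((starRingEnd ℂ) (u n) * g n).im :=
    Summable.of_norm_bounded hdom hbd
  have hms : Summable fun n => m n * ‖u n‖ ^ 2 := hu.summable_mul_sq hm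
  have hsym : ∑' n, ((starRingEnd ℂ) (u n) * nbrSum u n).im = 0 := by
    have hse : ∀ e ∈ nbrs, Summable fun n => ((starRingEnd ℂ) (u n) * u (n + e)).im :=
      fun e _ => hu.summable_im (hu.shift e)
    have h1 : ∑' n, ((starRingEnd ℂ) (u n) * nbrSum u n).im
        = ∑ e ∈ nbrs, ∑' n, ((starRingEnd ℂ) (u n) * u (n + e)).im := by
      rw [← Summable.tsum_finsetSum hse]
      refine tsum_congr fun n => ?_
      rw [nbrSum, Finset.mul_sum, Complex.im_sum]
    rw [h1, sum_nbrs_eq_sum_posNbrs]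
    refine Finset.sum_eq_zero fun e _ => ?_
    rw [← tsum_shift (fun n => ((starRingEnd ℂ) (u n) * u (n + -e)).im) e, add_comm,
      ← eq_neg_iff_add_eq_zero, ← tsum_neg]
    refine tsum_congr fun n => ?_
    rw [add_neg_cancel_right]
    simp only [Complex.mul_im, Complex.conj_re, Complex.conj_im]; ring
  have hpt : ∀ n, ((starRingEnd ℂ) (u n) * nbrSum u n).im
      = 6 * (((starRingEnd ℂ) (u n) * g n).im + ρ * (m n * ‖u n‖ ^ 2)) := by
    intro n
    rw [heq, Complex.sq_norm, Complex.normSq_apply]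
    simp [Complex.mul_im, Complex.mul_re]
    ring
  rw [tsum_congr hpt, tsum_mul_left, hgs.tsum_add (hms.mul_left ρ), tsum_mul_left] at hsym
  have h1 : m₀ * ∑' n, ‖u n‖ ^ 2 ≤ ∑' n, m n * ‖u n‖ ^ 2 := by
    rw [← tsum_mul_left]
    refine Summable.tsum_le_tsum (fun n => ?_) (Summable.mul_left m₀ hu) hms
    have := hm₀ n
    gcongr
  have h2 : |∑' n, ((starRingEnd ℂ) (u n) * g n).im|
      ≤ ∑' n, G * (τ * (wt s R n ^ 2 * ‖u n‖ ^ 2) + 1 / τ * ‖φ n‖ ^ 2) :=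
    by
    rw [← Real.norm_eq_abs]
    exact tsum_of_norm_bounded hdom.hasSum hbd
  rw [tsum_mul_left, (hN.mul_left τ).tsum_add (Summable.mul_left (1 / τ) hφ), tsum_mul_left,
    tsum_mul_left] at h2
  have h3 := neg_le_of_abs_le h2
  calc m₀ * (ρ * ∑' n, ‖u n‖ ^ 2) = ρ * (m₀ * ∑' n, ‖u n‖ ^ 2) := by ring
    _ ≤ ρ * ∑' n, m n * ‖u n‖ ^ 2 := by gcongr
    _ ≤ _ := by linarith

/-! ### The weighted velocity estimate -/

lemma tsum_weight_shift_le {p : ℤ × ℤ → ℝ} {A : ℝ} (hp0 : ∀ n, 0 ≤ p n) (hp1 : ∀ n, p n ≤ 1)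
    {e : ℤ × ℤ} (hA : ∀ n, p n ≤ A * p (n + e)) {u : ℤ × ℤ → ℂ} (hu : SqSummable u) :
    ∑' n, p n * ‖u (n + e)‖ ^ 2 ≤ A * ∑' n, p n * ‖u n‖ ^ 2 := by
  have hb : ∀ n, |p n| ≤ 1 := fun n => by rw [abs_of_nonneg (hp0 n)]; exact hp1 n
  have h := hu.summable_mul_sq hb
  rw [← tsum_shift (fun n => p n * ‖u n‖ ^ 2) e, ← tsum_mul_left]
  refine Summable.tsum_le_tsum (fun n => ?_) ((hu.shift e).summable_mul_sq hb)
    ((summable_shift h e).mul_left A)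
  rw [← mul_assoc]
  exact mul_le_mul_of_nonneg_right (hA n) (by positivity)

lemma wt_sq_le_one {s R : ℝ} (hs : 0 ≤ s) (hR : 4 ≤ R) (n : ℤ × ℤ) : wt s R n ^ 2 ≤ 1 :=
  pow_le_one₀ (wt_pos hR n).le (wt_le_one hs hR n)

lemma wt_sq_le_mul_wt_sq_add {s R : ℝ} (hR : 4 ≤ R) (n : ℤ × ℤ) {e : ℤ × ℤ} (he : e ∈ nbrs) :
    wt s R n ^ 2 ≤ (3 ^ |-s / 2|) ^ 2 * wt s R (n + e) ^ 2 := by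
  rw [← mul_pow]
  exact pow_le_pow_left₀ (wt_pos hR n).le (wt_le_mul_wt_add hR n he) 2

/-- The weight `wt² Λ^{s-1}` of the commutator error terms. -/
def errWt (s R : ℝ) (n : ℤ × ℤ) : ℝ := wt s R n ^ 2 * Lam n ^ (s - 1)

lemma errWt_nonneg {s R : ℝ} (n : ℤ × ℤ) : 0 ≤ errWt s R n :=
  mul_nonneg (sq_nonneg _) (Real.rpow_nonneg (Lam_pos n).le _)

lemma errWt_le_one {s R : ℝ} (hs : 0 ≤ s) (hs1 : s < 1) (hR : 4 ≤ R) (n : ℤ × ℤ) :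
    errWt s R n ≤ 1 :=
  mul_le_one₀ (wt_sq_le_one hs hR n) (Real.rpow_nonneg (Lam_pos n).le _)
    (Real.rpow_le_one_of_one_le_of_nonpos (one_le_Lam n) (by linarith))

lemma errWt_le_mul_errWt_add {s R : ℝ} (hs : 0 ≤ s) (hs1 : s < 1) (hR : 4 ≤ R) (n : ℤ × ℤ)
    {e : ℤ × ℤ} (he : e ∈ nbrs) :
    errWt s R n ≤ (3 ^ |-s / 2|) ^ 2 * 3 * errWt s R (n + e) := by
  have hL := Lam_pos n
  have hL' := Lam_pos (n + e)
  have h1 : Lam n ^ (s - 1) ≤ 3 * Lam (n + e) ^ (s - 1) := by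
    have h := Real.rpow_le_rpow_of_nonpos hL' (Lam_add_le n he) (z := s - 1) (by linarith)
    rw [Real.mul_rpow (by norm_num) hL.le] at h
    have h3 : (3 : ℝ) ^ (s - 1) * 3 ^ (1 - s) = 1 := by
      rw [← Real.rpow_add (by norm_num)]; simp
    have h4 : (3 : ℝ) ^ (1 - s) ≤ 3 := by
      have := Real.rpow_le_rpow_of_exponent_le (x := 3) (by norm_num) (show 1 - s ≤ 1 by linarith)
      rwa [Real.rpow_one] at this
    have hp : 0 < Lam (n + e) ^ (s - 1) := Real.rpow_pos_of_pos hL' _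
    calc Lam n ^ (s - 1) = 3 ^ (1 - s) * (3 ^ (s - 1) * Lam n ^ (s - 1)) := by
          rw [← mul_assoc, mul_comm ((3 : ℝ) ^ (1 - s)), h3, one_mul]
      _ ≤ 3 * Lam (n + e) ^ (s - 1) := by gcongr
  have h2 := wt_sq_le_mul_wt_sq_add (s := s) hR n he
  calc errWt s R n ≤ ((3 ^ |-s / 2|) ^ 2 * wt s R (n + e) ^ 2) * (3 * Lam (n + e) ^ (s - 1)) := by
        unfold errWt; gcongr
    _ = _ := by unfold errWt; ring

lemma potential_part_le {s : ℝ} (hs : 1 / 2 < s) (hs1 : s < 1) : ∃ C : ℝ, 0 < C ∧ ∀ R : ℝ, 4 ≤ R →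
    ∀ (D : ℝ) (c : ℤ × ℤ → ℝ) (u : ℤ × ℤ → ℂ), SqSummable u →
    (∀ e ∈ posNbrs, ∀ n, Lam n ^ s * jap (dot2 (latPt n) (latPt e)) * |c n - c (n + e)| ≤ D) →
    |∑ e ∈ posNbrs, ∑' n, (c n - c (n + e)) * (esc s R (n + e) - esc s R n)
        * ((starRingEnd ℂ) (u n) * u (n + e)).re|
      ≤ C * (D * ∑' n, errWt s R n * ‖u n‖ ^ 2) := by
  obtain ⟨C, hC, h⟩ := esc_diff_le_Lam hs
  set A : ℝ := (3 ^ |-s / 2|) ^ 2 * 3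
  have hA : 0 < A := by positivity
  refine ⟨3 * (C * (1 + A)), by positivity, fun R hR D c u hu hD => ?_⟩
  have hD0 : 0 ≤ D := le_trans (mul_nonneg (mul_nonneg (Real.rpow_nonneg (Lam_pos _).le _)
    (jap_pos _).le) (abs_nonneg _)) (hD (1, 0) (by decide) 0)
  have hbd : ∀ n, |errWt s R n| ≤ 1 := fun n => by
    rw [abs_of_nonneg (errWt_nonneg n)]; exact errWt_le_one (by linarith) hs1 hR n
  set Y := ∑' n, errWt s R n * ‖u n‖ ^ 2
  have key : ∀ e ∈ posNbrs, |∑' n, (c n - c (n + e)) * (esc s R (n + e) - esc s R n)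
        * ((starRingEnd ℂ) (u n) * u (n + e)).re| ≤ C * D * (1 + A) * Y := by
    intro e he
    have he' := mem_nbrs_of_mem_posNbrs he
    have hs1' := hu.summable_mul_sq hbd
    have hs2' := (hu.shift e).summable_mul_sq hbd
    have hle := tsum_weight_shift_le (p := errWt s R) (A := A) errWt_nonneg
      (errWt_le_one (by linarith) hs1 hR)
      (fun n => errWt_le_mul_errWt_add (by linarith) hs1 hR n he') hu
    have hsum := (hs1'.add hs2').mul_left (C * D)
    have hpt : ∀ n, ‖(c n - c (n + e)) * (esc s R (n + e) - esc s R n)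
        * ((starRingEnd ℂ) (u n) * u (n + e)).re‖
          ≤ C * D * (errWt s R n * ‖u n‖ ^ 2 + errWt s R n * ‖u (n + e)‖ ^ 2) := by
      intro n
      rw [norm_mul, norm_mul, Real.norm_eq_abs, Real.norm_eq_abs, Real.norm_eq_abs]
      have h1 := h R hR n e he'
      have h2 := hD e he n
      have hp := errWt_nonneg (s := s) (R := R) n
      have h3 : |((starRingEnd ℂ) (u n) * u (n + e)).re| ≤ ‖u n‖ ^ 2 + ‖u (n + e)‖ ^ 2 := by
        refine (abs_re_conj_mul_le _ _).trans ?_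
        nlinarith [sq_nonneg (‖u n‖ - ‖u (n + e)‖), sq_nonneg ‖u n‖, sq_nonneg ‖u (n + e)‖]
      calc |c n - c (n + e)| * |esc s R (n + e) - esc s R n|
            * |((starRingEnd ℂ) (u n) * u (n + e)).re|
          ≤ |c n - c (n + e)| * (C * (errWt s R n * (Lam n ^ s
              * jap (dot2 (latPt n) (latPt e))))) * (‖u n‖ ^ 2 + ‖u (n + e)‖ ^ 2) := by
            have hL := Lam_pos n
            have hj := jap_pos (dot2 (latPt n) (latPt e))
            exact mul_le_mul (mul_le_mul_of_nonneg_left h1 (abs_nonneg _)) h3 (abs_nonneg _)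
              (by positivity)
        _ = C * (Lam n ^ s * jap (dot2 (latPt n) (latPt e)) * |c n - c (n + e)|)
              * (errWt s R n * (‖u n‖ ^ 2 + ‖u (n + e)‖ ^ 2)) := by ring
        _ ≤ C * D * (errWt s R n * (‖u n‖ ^ 2 + ‖u (n + e)‖ ^ 2)) := by gcongr
        _ = _ := by ring
    rw [← Real.norm_eq_abs]
    refine (tsum_of_norm_bounded hsum.hasSum hpt).trans ?_
    rw [tsum_mul_left, hs1'.tsum_add hs2']
    have : C * D * (1 + A) * Y = C * D * (Y + A * Y) := by ring
    rw [this]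
    gcongr
  calc _ ≤ ∑ e ∈ posNbrs, C * D * (1 + A) * Y :=
        (Finset.abs_sum_le_sum_abs _ _).trans (Finset.sum_le_sum key)
    _ = _ := by
        rw [Finset.sum_const, show posNbrs.card = 3 from rfl]
        simp; ring

lemma source_part_le {s : ℝ} (hs : 1 / 2 < s) : ∃ C : ℝ, 0 < C ∧ ∀ R : ℝ, 4 ≤ R →
    ∀ (G M ρ τ : ℝ) (u g φ r : ℤ × ℤ → ℂ), 0 ≤ G → 0 ≤ M → 0 ≤ ρ → 0 < τ →
    SqSummable u → SqSummable φ → (∀ n, ‖g n‖ ≤ G * (wt s R n * ‖φ n‖)) →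
    (∀ n, ‖r n‖ ≤ ‖g n‖ + ρ * M * ‖u n‖) →
    |∑' n, ∑ e ∈ nbrs, (esc s R (n + e) - esc s R n) * ((starRingEnd ℂ) (r n) * u (n + e)).re|
      ≤ C * (G * (τ * ∑' n, wt s R n ^ 2 * ‖u n‖ ^ 2 + 1 / τ * ∑' n, ‖φ n‖ ^ 2)
        + M * (ρ * ∑' n, ‖u n‖ ^ 2)) := by
  obtain ⟨K, hK, h⟩ := esc_diff_bounded hs
  set A : ℝ := (3 ^ |-s / 2|) ^ 2
  have hA : 0 < A := by positivity
  refine ⟨6 * K * (A + 2), by positivity, ?_⟩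
  intro R hR G M ρ τ u g φ r hG hM hρ hτ hu hφ hg hr
  have hbd : ∀ n, |wt s R n ^ 2| ≤ 1 := fun n => by
    rw [abs_of_nonneg (sq_nonneg _)]; exact wt_sq_le_one (by linarith) hR n
  set N := ∑' n, wt s R n ^ 2 * ‖u n‖ ^ 2
  set Φ := ∑' n, ‖φ n‖ ^ 2
  set U := ∑' n, ‖u n‖ ^ 2
  have hN0 : 0 ≤ N := tsum_nonneg fun n => by positivity
  have hΦ0 : 0 ≤ Φ := tsum_nonneg fun n => by positivity
  have hU0 : 0 ≤ U := tsum_nonneg fun n => by positivity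
  have hφ' : Summable fun n => ‖φ n‖ ^ 2 := hφ
  have hu' : Summable fun n => ‖u n‖ ^ 2 := hu
  have key : ∀ e ∈ nbrs, Summable (fun n =>
        (esc s R (n + e) - esc s R n) * ((starRingEnd ℂ) (r n) * u (n + e)).re) ∧
      |∑' n, (esc s R (n + e) - esc s R n) * ((starRingEnd ℂ) (r n) * u (n + e)).re|
        ≤ K * (A + 2) * (G * (τ * N + 1 / τ * Φ) + M * (ρ * U)) := by
    intro e he
    have hue' : Summable fun n => ‖u (n + e)‖ ^ 2 := hu.shift e
    have hwe := (hu.shift e).summable_mul_sq hbd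
    have hle := tsum_weight_shift_le (p := fun n => wt s R n ^ 2) (A := A) (fun n => sq_nonneg _)
      (wt_sq_le_one (by linarith) hR) (fun n => wt_sq_le_mul_wt_sq_add hR n he) hu
    have hsumA := ((hwe.mul_left τ).add (hφ'.mul_left (1 / τ))).mul_left (K * G)
    have hsumB := (hu'.add hue').mul_left (K * (ρ * M))
    have hpt : ∀ n, ‖(esc s R (n + e) - esc s R n) * ((starRingEnd ℂ) (r n) * u (n + e)).re‖
        ≤ K * G * (τ * (wt s R n ^ 2 * ‖u (n + e)‖ ^ 2) + 1 / τ * ‖φ n‖ ^ 2)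
          + K * (ρ * M) * (‖u n‖ ^ 2 + ‖u (n + e)‖ ^ 2) := by
      intro n
      rw [norm_mul, Real.norm_eq_abs, Real.norm_eq_abs]
      have hy := mul_le_young hτ (wt s R n * ‖u (n + e)‖) ‖φ n‖
      have hy2 : ‖u n‖ * ‖u (n + e)‖ ≤ ‖u n‖ ^ 2 + ‖u (n + e)‖ ^ 2 := by
        nlinarith [sq_nonneg (‖u n‖ - ‖u (n + e)‖), sq_nonneg ‖u n‖, sq_nonneg ‖u (n + e)‖]
      calc _ ≤ K * (‖r n‖ * ‖u (n + e)‖) :=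
            mul_le_mul (h R hR n e he) (abs_re_conj_mul_le _ _) (abs_nonneg _) hK.le
        _ ≤ K * ((G * (wt s R n * ‖φ n‖) + ρ * M * ‖u n‖) * ‖u (n + e)‖) := by
            gcongr
            exact (hr n).trans (by gcongr; exact hg n)
        _ = K * G * (wt s R n * ‖u (n + e)‖ * ‖φ n‖)
            + K * (ρ * M) * (‖u n‖ * ‖u (n + e)‖) := by ring
        _ ≤ K * G * (τ * (wt s R n * ‖u (n + e)‖) ^ 2 + 1 / τ * ‖φ n‖ ^ 2)
            + K * (ρ * M) * (‖u n‖ ^ 2 + ‖u (n + e)‖ ^ 2) := by gcongr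
        _ = _ := by ring
    refine ⟨Summable.of_norm_bounded (hsumA.add hsumB) hpt, ?_⟩
    rw [← Real.norm_eq_abs]
    refine (tsum_of_norm_bounded (hsumA.add hsumB).hasSum hpt).trans ?_
    rw [hsumA.tsum_add hsumB, tsum_mul_left, tsum_mul_left,
      (hwe.mul_left τ).tsum_add (hφ'.mul_left (1 / τ)), hu'.tsum_add hue', tsum_mul_left,
      tsum_mul_left, tsum_shift (fun n => ‖u n‖ ^ 2) e]
    change K * G * (τ * _ + 1 / τ * Φ) + K * (ρ * M) * (U + U) ≤ _
    have h1 : K * G * (τ * ∑' n, wt s R n ^ 2 * ‖u (n + e)‖ ^ 2 + 1 / τ * Φ)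
        ≤ K * G * (τ * (A * N) + 1 / τ * Φ) := by gcongr
    have h2 : 0 ≤ K * G * (τ * N) * 2 + K * G * (1 / τ * Φ) * (A + 1) + K * (ρ * M) * U * A := by
      positivity
    nlinarith
  rw [Summable.tsum_finsetSum fun e he => (key e he).1]
  calc _ ≤ ∑ e ∈ nbrs, K * (A + 2) * (G * (τ * N + 1 / τ * Φ) + M * (ρ * U)) :=
        (Finset.abs_sum_le_sum_abs _ _).trans (Finset.sum_le_sum fun e he => (key e he).2)
    _ = _ := by
        rw [Finset.sum_const, show nbrs.card = 6 from rfl]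
        simp; ring

/-- The weighted velocity of a solution is controlled by lower-order terms. -/
lemma velocity_le {s : ℝ} (hs : 1 / 2 < s) (hs1 : s < 1) : ∃ C : ℝ, 0 < C ∧ ∀ R : ℝ, 4 ≤ R →
    ∀ (G D M B ρ τ : ℝ) (u g φ : ℤ × ℤ → ℂ) (m c : ℤ × ℤ → ℝ), 0 ≤ G → 0 ≤ M → 0 ≤ ρ → 0 < τ →
    SqSummable u → SqSummable φ → (∀ n, ‖g n‖ ≤ G * (wt s R n * ‖φ n‖)) →
    (∀ n, |m n| ≤ M) → (∀ n, |c n| ≤ B) →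
    (∀ e ∈ posNbrs, ∀ n, Lam n ^ s * jap (dot2 (latPt n) (latPt e)) * |c n - c (n + e)| ≤ D) →
    (∀ n, nbrSum u n = 6 * (c n * u n + (g n + Complex.I * (ρ * m n) * u n))) →
    ∑' n, wt s R n ^ 2 * (‖vel1 u n‖ ^ 2 + ‖vel2 u n‖ ^ 2)
      ≤ C * (1 / R * ∑' n, wt s R n ^ 2 * ‖u n‖ ^ 2 + D * ∑' n, errWt s R n * ‖u n‖ ^ 2
        + G * (τ * ∑' n, wt s R n ^ 2 * ‖u n‖ ^ 2 + 1 / τ * ∑' n, ‖φ n‖ ^ 2)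
        + M * (ρ * ∑' n, ‖u n‖ ^ 2)) := by
  obtain ⟨K, hK, hesc⟩ := esc_diff_bounded hs
  obtain ⟨C₁, hC₁, h₁⟩ := le_sum_sum_escDD hs hs1
  obtain ⟨C₂, hC₂, h₂⟩ := potential_part_le hs hs1
  obtain ⟨C₃, hC₃, h₃⟩ := source_part_le hs
  set A : ℝ := (3 ^ |-s / 2|) ^ 2
  have hA : 0 < A := by positivity
  refine ⟨C₁ * (6 * A) + 12 * C₂ + 12 * C₃, by positivity, ?_⟩
  intro R hR G D M B ρ τ u g φ m c hG hM hρ hτ hu hφ hg hm hc hD heq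
  have hR0 : 0 < R := by linarith
  have hbd : ∀ n, |wt s R n ^ 2| ≤ 1 := fun n => by
    rw [abs_of_nonneg (sq_nonneg _)]; exact wt_sq_le_one (by linarith) hR n
  have hθ := hesc R hR
  have hD0 : 0 ≤ D := le_trans (mul_nonneg (mul_nonneg (Real.rpow_nonneg (Lam_pos _).le _)
    (jap_pos _).le) (abs_nonneg _)) (hD (1, 0) (by decide) 0)
  set r : ℤ × ℤ → ℂ := fun n => g n + Complex.I * (ρ * m n) * u n with hr
  have hrn : ∀ n, ‖r n‖ ≤ ‖g n‖ + ρ * M * ‖u n‖ := by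
    intro n
    refine (norm_add_le _ _).trans ?_
    rw [norm_mul, norm_mul, norm_mul, Complex.norm_I, one_mul, Complex.norm_real,
      Complex.norm_real, Real.norm_eq_abs, Real.norm_eq_abs, abs_of_nonneg hρ]
    have := hm n
    gcongr
  have hgs : SqSummable g := by
    refine SqSummable.of_norm_le (Summable.mul_left (G ^ 2) hφ) fun n => ?_
    have h1 : wt s R n * ‖φ n‖ ≤ 1 * ‖φ n‖ :=
      mul_le_mul_of_nonneg_right (wt_le_one (by linarith) hR n) (norm_nonneg _)
    rw [← mul_pow]
    refine pow_le_pow_left₀ (norm_nonneg _) ((hg n).trans ?_) 2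
    gcongr
    linarith
  have hrs : SqSummable r := by
    refine hgs.add (hu.mul_bounded (C := ρ * M) fun n => ?_)
    rw [norm_mul, norm_mul, Complex.norm_I, one_mul, Complex.norm_real,
      Complex.norm_real, Real.norm_eq_abs, Real.norm_eq_abs, abs_of_nonneg hρ]
    have := hm n
    gcongr
  set P := ∑' n, ∑ e ∈ nbrs, c n * (esc s R (n + e) - esc s R n)
    * ((starRingEnd ℂ) (u n) * u (n + e)).re with hP
  set S := ∑' n, ∑ e ∈ nbrs, (esc s R (n + e) - esc s R n)
    * ((starRingEnd ℂ) (r n) * u (n + e)).re with hS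
  have hPs : Summable fun n => ∑ e ∈ nbrs, c n * (esc s R (n + e) - esc s R n)
      * ((starRingEnd ℂ) (u n) * u (n + e)).re := by
    refine summable_sum fun e he => hu.summable_mul_re (hu.shift e) (C := B * K) fun n => ?_
    rw [abs_mul]
    exact mul_le_mul (hc _) (hθ n e he) (abs_nonneg _) ((abs_nonneg _).trans (hc 0))
  have hSs : Summable fun n => ∑ e ∈ nbrs, (esc s R (n + e) - esc s R n)
      * ((starRingEnd ℂ) (r n) * u (n + e)).re :=
    summable_sum fun e he => hrs.summable_mul_re (hu.shift e) fun n => hθ n e he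
  have hTs : Summable fun n => ∑ e ∈ nbrs, ∑ e' ∈ nbrs,
      (esc s R (n + e + e') - esc s R n) * ((starRingEnd ℂ) (u (n + e')) * u (n + e)).re := by
    refine summable_sum fun e he => summable_sum fun e' he' =>
      (hu.shift e').summable_mul_re (hu.shift e) (C := K + K) fun n => ?_
    have h := abs_add_le (esc s R (n + e + e') - esc s R (n + e)) (esc s R (n + e) - esc s R n)
    rw [sub_add_sub_cancel] at h
    exact h.trans (add_le_add (hθ _ e' he') (hθ _ e he))
  have hpt : ∀ n, ∑ e ∈ nbrs, ∑ e' ∈ nbrs,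
        escDD s R n e e' * ((starRingEnd ℂ) (u (n + e')) * u (n + e)).re
      = ∑ e ∈ nbrs, ∑ e' ∈ nbrs,
          (esc s R (n + e + e') - esc s R n) * ((starRingEnd ℂ) (u (n + e')) * u (n + e)).re
        - 12 * (∑ e ∈ nbrs, c n * (esc s R (n + e) - esc s R n)
            * ((starRingEnd ℂ) (u n) * u (n + e)).re
          + ∑ e ∈ nbrs, (esc s R (n + e) - esc s R n)
            * ((starRingEnd ℂ) (r n) * u (n + e)).re) := by
    intro n
    simp only [escDD]
    rw [sum_sum_second_diff, ← Finset.sum_add_distrib]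
    congr 1
    rw [show (12 : ℝ) = 2 * 6 by norm_num, mul_assoc]
    congr 1
    rw [Finset.mul_sum]
    refine Finset.sum_congr rfl fun e _ => ?_
    rw [heq, show (starRingEnd ℂ) (6 * (c n * u n + (g n + Complex.I * (ρ * m n) * u n)))
        * u (n + e)
      = ((6 : ℝ) : ℂ) * ((c n : ℂ) * ((starRingEnd ℂ) (u n) * u (n + e))
        + (starRingEnd ℂ) (r n) * u (n + e)) by
        simp only [hr, map_mul, map_add, Complex.conj_ofReal, map_ofNat]; push_cast; ring,
      Complex.re_ofReal_mul, Complex.add_re, Complex.re_ofReal_mul]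
    ring
  have hDDs : Summable fun n => ∑ e ∈ nbrs, ∑ e' ∈ nbrs,
        escDD s R n e e' * ((starRingEnd ℂ) (u (n + e')) * u (n + e)).re := by
    rw [summable_congr hpt]
    exact hTs.sub ((hPs.add hSs).mul_left 12)
  have hDD : ∑' n, ∑ e ∈ nbrs, ∑ e' ∈ nbrs,
        escDD s R n e e' * ((starRingEnd ℂ) (u (n + e')) * u (n + e)).re = -12 * (P + S) := by
    rw [tsum_congr hpt, hTs.tsum_sub ((hPs.add hSs).mul_left 12),
      tsum_sum_sum_translate_eq_zero hθ hu, tsum_mul_left, hPs.tsum_add hSs]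
    ring
  have hEs : ∀ e ∈ nbrs, Summable fun n => wt s R n ^ 2 * ‖u (n + e)‖ ^ 2 :=
    fun e _ => (hu.shift e).summable_mul_sq hbd
  have hE : ∑' n, ∑ e ∈ nbrs, wt s R n ^ 2 * ‖u (n + e)‖ ^ 2
      ≤ 6 * A * ∑' n, wt s R n ^ 2 * ‖u n‖ ^ 2 := by
    rw [Summable.tsum_finsetSum hEs]
    refine (Finset.sum_le_sum fun e he => tsum_weight_shift_le (A := A) (fun n => sq_nonneg _)
      (wt_sq_le_one (by linarith) hR) (fun n => wt_sq_le_mul_wt_sq_add hR n he) hu).trans_eq ?_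
    rw [Finset.sum_const, show nbrs.card = 6 from rfl]
    simp; ring
  have hV : ∑' n, wt s R n ^ 2 * (‖vel1 u n‖ ^ 2 + ‖vel2 u n‖ ^ 2)
      ≤ -12 * (P + S) + C₁ / R * (6 * A * ∑' n, wt s R n ^ 2 * ‖u n‖ ^ 2) := by
    have hs1 : Summable fun n => wt s R n ^ 2 * (‖vel1 u n‖ ^ 2 + ‖vel2 u n‖ ^ 2) := by
      simp only [mul_add]
      exact (hu.vel1.summable_mul_sq hbd).add (hu.vel2.summable_mul_sq hbd)
    have hs2 : Summable fun n => C₁ / R * ∑ e ∈ nbrs, wt s R n ^ 2 * ‖u (n + e)‖ ^ 2 :=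
      (summable_sum hEs).mul_left _
    calc _ ≤ ∑' n, (∑ e ∈ nbrs, ∑ e' ∈ nbrs,
            escDD s R n e e' * ((starRingEnd ℂ) (u (n + e')) * u (n + e)).re
          + C₁ / R * ∑ e ∈ nbrs, wt s R n ^ 2 * ‖u (n + e)‖ ^ 2) := by
          refine Summable.tsum_le_tsum (fun n => ?_) hs1 (hDDs.add hs2)
          have := h₁ R hR n u
          rwa [mul_assoc (C₁ / R), Finset.mul_sum] at this
      _ ≤ _ := by
          rw [hDDs.tsum_add hs2, hDD, tsum_mul_left]
          gcongr
  have hPle := h₂ R hR D c u hu hD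
  rw [← tsum_sum_potential hθ hc hu, ← hP] at hPle
  have hSle := h₃ R hR G M ρ τ u g φ r hG hM hρ hτ hu hφ hg hrn
  rw [← hS] at hSle
  have hP1 := neg_le_of_abs_le hPle
  have hS1 := neg_le_of_abs_le hSle
  set N := ∑' n, wt s R n ^ 2 * ‖u n‖ ^ 2
  set Y := ∑' n, errWt s R n * ‖u n‖ ^ 2
  set Φ := ∑' n, ‖φ n‖ ^ 2
  set U := ∑' n, ‖u n‖ ^ 2
  have hN0 : 0 ≤ 1 / R * N := mul_nonneg (by positivity) (tsum_nonneg fun n => by positivity)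
  have hY0 : 0 ≤ D * Y := mul_nonneg hD0
    (tsum_nonneg fun n => mul_nonneg (errWt_nonneg n) (by positivity))
  have hS0 : 0 ≤ G * (τ * N + 1 / τ * Φ) + M * (ρ * U) := by
    have h1 : 0 ≤ N := tsum_nonneg fun n => by positivity
    have h2 : 0 ≤ Φ := tsum_nonneg fun n => by positivity
    have h3 : 0 ≤ U := tsum_nonneg fun n => by positivity
    positivity
  have hN1 : C₁ / R * (6 * A * N) = C₁ * (6 * A) * (1 / R * N) := by ring
  rw [hN1] at hV
  have hx : 0 ≤ C₁ * (6 * A) := by positivity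
  calc _ ≤ C₁ * (6 * A) * (1 / R * N) + 12 * C₂ * (D * Y)
        + 12 * C₃ * (G * (τ * N + 1 / τ * Φ) + M * (ρ * U)) := by linarith
    _ ≤ (C₁ * (6 * A) + 12 * C₂ + 12 * C₃) * (1 / R * N)
        + (C₁ * (6 * A) + 12 * C₂ + 12 * C₃) * (D * Y)
        + (C₁ * (6 * A) + 12 * C₂ + 12 * C₃) * (G * (τ * N + 1 / τ * Φ) + M * (ρ * U)) := by
        gcongr <;> linarith
    _ = _ := by ring

/-! ### A compactness estimate in the absence of eigenvalues -/

lemma tsum_mul_norm_sq_le_add_sum {y : ℤ × ℤ → ℝ} {B t : ℝ} (hy0 : ∀ n, 0 ≤ y n)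
    (hyB : ∀ n, y n ≤ B) (ht : 0 ≤ t) (F : Finset (ℤ × ℤ)) (hF : ∀ n ∉ F, y n ≤ t)
    {v : ℤ × ℤ → ℂ} (hv : SqSummable v) :
    ∑' n, y n * ‖v n‖ ^ 2 ≤ t * ∑' n, ‖v n‖ ^ 2 + ∑ n ∈ F, B * ‖v n‖ ^ 2 := by
  classical
  have hB : 0 ≤ B := (hy0 0).trans (hyB 0)
  have hv' : Summable fun n => ‖v n‖ ^ 2 := hv
  set f : ℤ × ℤ → ℝ := fun n => if n ∈ F then B * ‖v n‖ ^ 2 else 0 with hf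
  have hf0 : ∀ n ∉ F, f n = 0 := fun n hn => by simp [hf, hn]
  have hfs : Summable f := summable_of_ne_finset_zero hf0
  have hft : ∑' n, f n = ∑ n ∈ F, B * ‖v n‖ ^ 2 := by
    rw [tsum_eq_sum hf0]
    exact Finset.sum_congr rfl fun n hn => by simp [hf, hn]
  rw [← hft, ← tsum_mul_left, ← (hv'.mul_left t).tsum_add hfs]
  refine Summable.tsum_le_tsum (fun n => ?_)
    (hv.summable_mul_sq (C := B) fun n => by rw [abs_of_nonneg (hy0 n)]; exact hyB n)
    ((hv'.mul_left t).add hfs)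
  by_cases hn : n ∈ F
  · simp only [hf, hn, if_true]
    have := hyB n
    have h1 : y n * ‖v n‖ ^ 2 ≤ B * ‖v n‖ ^ 2 := by gcongr
    have h2 : 0 ≤ t * ‖v n‖ ^ 2 := by positivity
    linarith
  · simp only [hf, hn, if_false, add_zero]
    have := hF n hn
    gcongr

lemma continuous_nbrSum_sub (V m : ℤ × ℤ → ℝ) (n : ℤ × ℤ) :
    Continuous fun p : ℝ × (ℤ × ℤ → ℂ) =>
      nbrSum p.2 n - 6 * (((p.1 - V n) * m n : ℝ) : ℂ) * p.2 n := by
  unfold nbrSum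
  fun_prop

lemma exists_tsum_le_of_no_eigenvalue {a b : ℝ} {y V m : ℤ × ℤ → ℝ} {B : ℝ}
    (hy0 : ∀ n, 0 ≤ y n) (hyB : ∀ n, y n ≤ B) (hy : Tendsto y cofinite (nhds 0))
    {Cb : ℝ} (hcb : ∀ lam ∈ Set.Icc a b, ∀ n, |(lam - V n) * m n| ≤ Cb)
    (heig : ∀ lam ∈ Set.Icc a b, ∀ v : ℤ × ℤ → ℂ, SqSummable v →
      (∀ n, nbrSum v n = 6 * (((lam - V n) * m n : ℝ) : ℂ) * v n) → ∀ n, v n = 0)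
    {δ : ℝ} (hδ : 0 < δ) :
    ∃ C : ℝ, 0 < C ∧ ∀ lam ∈ Set.Icc a b, ∀ v : ℤ × ℤ → ℂ, SqSummable v →
      ∑' n, y n * ‖v n‖ ^ 2 ≤ δ * ∑' n, ‖v n‖ ^ 2
        + C * ∑' n, ‖nbrSum v n - 6 * (((lam - V n) * m n : ℝ) : ℂ) * v n‖ ^ 2 := by
  by_contra! hcon
  have hB : 0 ≤ B := (hy0 0).trans (hyB 0)
  have hPs : ∀ lam ∈ Set.Icc a b, ∀ v : ℤ × ℤ → ℂ, SqSummable v → SqSummable fun n =>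
      nbrSum v n - 6 * (((lam - V n) * m n : ℝ) : ℂ) * v n := by
    intro lam hlam v hv
    refine hv.nbrSum.sub (hv.mul_bounded (C := 6 * Cb) fun n => ?_)
    rw [norm_mul, Complex.norm_real, Real.norm_eq_abs]
    have := hcb lam hlam n
    simpa using this
  have hseq : ∀ k : ℕ, ∃ p : ℝ × (ℤ × ℤ → ℂ), p.1 ∈ Set.Icc a b ∧ SqSummable p.2 ∧
      ∑' n, ‖p.2 n‖ ^ 2 = 1 ∧ δ ≤ ∑' n, y n * ‖p.2 n‖ ^ 2 ∧
      ∀ n, ‖nbrSum p.2 n - 6 * (((p.1 - V n) * m n : ℝ) : ℂ) * p.2 n‖ ^ 2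
        ≤ B * (1 / ((k : ℝ) + 1)) := by
    intro k
    have hk : (0 : ℝ) < (k : ℝ) + 1 := by positivity
    obtain ⟨lam, hlam, v, hv, hlt⟩ := hcon (k + 1) hk
    set S := ∑' n, ‖v n‖ ^ 2 with hS
    set Q := ∑' n, ‖nbrSum v n - 6 * (((lam - V n) * m n : ℝ) : ℂ) * v n‖ ^ 2 with hQ
    have hv' : Summable fun n => ‖v n‖ ^ 2 := hv
    have hS0 : 0 ≤ S := tsum_nonneg fun n => by positivity
    have hQ0 : 0 ≤ Q := tsum_nonneg fun n => by positivity
    have hyS : ∑' n, y n * ‖v n‖ ^ 2 ≤ B * S := by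
      rw [hS, ← tsum_mul_left]
      refine Summable.tsum_le_tsum (fun n => ?_)
        (hv.summable_mul_sq (C := B) fun n => by rw [abs_of_nonneg (hy0 n)]; exact hyB n)
        (hv'.mul_left B)
      have := hyB n
      gcongr
    have hSpos : 0 < S := by
      rcases hS0.lt_or_eq with h | h
      · exact h
      · rw [← h] at hyS hlt
        nlinarith [mul_nonneg hk.le hQ0]
    have hsq : ∀ z : ℂ, ‖((Real.sqrt S)⁻¹ : ℂ) * z‖ ^ 2 = S⁻¹ * ‖z‖ ^ 2 := by
      intro z
      rw [norm_mul, mul_pow, norm_inv, Complex.norm_real, Real.norm_eq_abs, inv_pow, sq_abs,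
        Real.sq_sqrt hS0]
    refine ⟨(lam, fun n => ((Real.sqrt S)⁻¹ : ℂ) * v n), hlam, hv.const_mul _, ?_, ?_, fun n => ?_⟩
    · simp only [hsq]
      rw [tsum_mul_left, ← hS, inv_mul_cancel₀ hSpos.ne']
    · simp only [hsq]
      have : ∀ n, y n * (S⁻¹ * ‖v n‖ ^ 2) = S⁻¹ * (y n * ‖v n‖ ^ 2) := fun n => by ring
      simp only [this]
      rw [tsum_mul_left, inv_mul_eq_div, le_div_iff₀ hSpos]
      nlinarith [mul_nonneg hk.le hQ0]
    · have h1 : nbrSum (fun n => ((Real.sqrt S)⁻¹ : ℂ) * v n) n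
          - 6 * (((lam - V n) * m n : ℝ) : ℂ) * (((Real.sqrt S)⁻¹ : ℂ) * v n)
          = ((Real.sqrt S)⁻¹ : ℂ) * (nbrSum v n - 6 * (((lam - V n) * m n : ℝ) : ℂ) * v n) := by
        simp only [nbrSum, ← Finset.mul_sum]; ring
      change ‖nbrSum (fun n => ((Real.sqrt S)⁻¹ : ℂ) * v n) n
          - 6 * (((lam - V n) * m n : ℝ) : ℂ) * (((Real.sqrt S)⁻¹ : ℂ) * v n)‖ ^ 2 ≤ _
      rw [h1, hsq]
      have h2 : ‖nbrSum v n - 6 * (((lam - V n) * m n : ℝ) : ℂ) * v n‖ ^ 2 ≤ Q :=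
        Summable.le_tsum (hPs lam hlam v hv) n fun _ _ => by positivity
      have h3 : Q * ((k : ℝ) + 1) ≤ B * S := by nlinarith
      rw [inv_mul_eq_div, mul_one_div, div_le_div_iff₀ hSpos hk]
      nlinarith
  choose p hpI hpS hp1 hpδ hpP using hseq
  have hcomp : IsCompact
      (Set.Icc a b ×ˢ Set.univ.pi fun _ : ℤ × ℤ => Metric.closedBall (0 : ℂ) 1) :=
    isCompact_Icc.prod (isCompact_univ_pi fun _ => isCompact_closedBall _ _)
  have hmem : ∀ k, p k ∈
      Set.Icc a b ×ˢ Set.univ.pi fun _ : ℤ × ℤ => Metric.closedBall (0 : ℂ) 1 := by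
    intro k
    refine ⟨hpI k, fun n _ => ?_⟩
    rw [mem_closedBall_zero_iff]
    have : ‖(p k).2 n‖ ^ 2 ≤ 1 := by
      rw [← hp1 k]
      exact Summable.le_tsum (hpS k) n fun _ _ => by positivity
    exact (sq_le_one_iff₀ (norm_nonneg _)).mp this
  obtain ⟨q, hq, σ, hσ, hlim⟩ := hcomp.tendsto_subseq hmem
  have hptlim : ∀ n, Tendsto (fun k => (p (σ k)).2 n) atTop (nhds (q.2 n)) := fun n =>
    (((continuous_apply n).comp continuous_snd).tendsto q).comp hlim
  have hqS : SqSummable q.2 := by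
    refine summable_of_sum_le (c := 1) (fun n => by positivity) fun F => ?_
    refine le_of_tendsto (tendsto_finsetSum F fun n _ => ((hptlim n).norm.pow 2))
      (Eventually.of_forall fun k => ?_)
    rw [← hp1 (σ k)]
    exact Summable.sum_le_tsum F (fun _ _ => by positivity) (hpS (σ k))
  have hq0 : ∀ n, q.2 n = 0 := by
    refine heig q.1 hq.1 q.2 hqS fun n => ?_
    have h1 := (((continuous_nbrSum_sub V m n).norm.pow 2).tendsto q).comp hlim
    have h2 : Tendsto (fun k => B * (1 / ((σ k : ℝ) + 1))) atTop (nhds (B * 0)) :=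
      ((tendsto_one_div_add_atTop_nhds_zero_nat (𝕜 := ℝ)).comp hσ.tendsto_atTop).const_mul B
    have h3 := le_of_tendsto_of_tendsto' h1 h2 fun k => hpP (σ k) n
    rw [mul_zero] at h3
    have h4 := pow_eq_zero_iff (two_ne_zero) |>.mp (le_antisymm h3 (by positivity))
    exact sub_eq_zero.mp (norm_eq_zero.mp h4)
  have hfin : {n | ¬ y n ≤ δ / 2}.Finite :=
    (hy.eventually (ge_mem_nhds (by linarith : (0 : ℝ) < δ / 2)))
  have hle : ∀ k, δ ≤ δ / 2 + ∑ n ∈ hfin.toFinset, B * ‖(p (σ k)).2 n‖ ^ 2 := by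
    intro k
    have h := tsum_mul_norm_sq_le_add_sum hy0 hyB (by linarith : 0 ≤ δ / 2) hfin.toFinset
      (fun n hn => by simpa using hn) (hpS (σ k))
    rw [hp1, mul_one] at h
    exact (hpδ _).trans h
  have hlim2 : Tendsto (fun k => δ / 2 + ∑ n ∈ hfin.toFinset, B * ‖(p (σ k)).2 n‖ ^ 2) atTop
      (nhds (δ / 2 + ∑ n ∈ hfin.toFinset, B * ‖q.2 n‖ ^ 2)) :=
    (tendsto_finsetSum _ fun n _ => ((hptlim n).norm.pow 2).const_mul B).const_add _
  have h := ge_of_tendsto' hlim2 hle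
  simp only [hq0] at h
  simp at h
  linarith

/-! ### The a priori estimate -/

lemma norm_add_sq_le_two (x y : ℂ) : ‖x + y‖ ^ 2 ≤ 2 * ‖x‖ ^ 2 + 2 * ‖y‖ ^ 2 := by
  have h := pow_le_pow_left₀ (norm_nonneg _) (norm_add_le x y) 2
  nlinarith [sq_nonneg (‖x‖ - ‖y‖)]

/-- Commuting the weight past a finite-range operator. -/
lemma tsum_wt_commute_le {s : ℝ} (hs : 0 ≤ s) : ∃ C : ℝ, 0 < C ∧ ∀ R : ℝ, 4 ≤ R →
    ∀ (u : ℤ × ℤ → ℂ) (α k : ℤ × ℤ → ℂ) (B : ℝ), SqSummable u → (∀ e ∈ nbrs, ‖α e‖ ≤ 1) →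
    (∀ n, ‖k n‖ ≤ B) →
    ∑' n, ‖∑ e ∈ nbrs, α e * (wt s R (n + e) * u (n + e)) + k n * (wt s R n * u n)‖ ^ 2
      ≤ 2 * ∑' n, wt s R n ^ 2 * ‖∑ e ∈ nbrs, α e * u (n + e) + k n * u n‖ ^ 2
        + C * (1 / R * ∑' n, wt s R n ^ 2 * ‖u n‖ ^ 2) := by
  obtain ⟨C, hC, h⟩ := wt_diff_le s
  set A : ℝ := (3 ^ |-s / 2|) ^ 2
  have hA : 0 < A := by positivity
  refine ⟨72 * A * C ^ 2, by positivity, fun R hR u α k B hu hα hk => ?_⟩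
  have hR0 : 0 < R := by linarith
  have hbd : ∀ n, |wt s R n ^ 2| ≤ 1 := fun n => by
    rw [abs_of_nonneg (sq_nonneg _)]; exact wt_sq_le_one hs hR n
  have hop : SqSummable fun n => ∑ e ∈ nbrs, α e * u (n + e) + k n * u n :=
    (SqSummable.finset_sum _ fun e _ => (hu.shift e).const_mul _).add (hu.mul_bounded hk)
  have hEs : ∀ e ∈ nbrs, Summable fun n => wt s R n ^ 2 * ‖u (n + e)‖ ^ 2 :=
    fun e _ => (hu.shift e).summable_mul_sq hbd
  have hs1 := (hop.summable_mul_sq hbd).mul_left 2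
  have hs2 := (summable_sum hEs).mul_left (12 * (C / R) ^ 2)
  have hpt : ∀ n, ‖∑ e ∈ nbrs, α e * (wt s R (n + e) * u (n + e)) + k n * (wt s R n * u n)‖ ^ 2
      ≤ 2 * (wt s R n ^ 2 * ‖∑ e ∈ nbrs, α e * u (n + e) + k n * u n‖ ^ 2)
        + 12 * (C / R) ^ 2 * ∑ e ∈ nbrs, wt s R n ^ 2 * ‖u (n + e)‖ ^ 2 := by
    intro n
    have e1 : ∑ e ∈ nbrs, α e * (wt s R (n + e) * u (n + e)) + k n * (wt s R n * u n)
        = (wt s R n : ℂ) * (∑ e ∈ nbrs, α e * u (n + e) + k n * u n)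
          + ∑ e ∈ nbrs, α e * ((wt s R (n + e) - wt s R n : ℝ) * u (n + e)) := by
      have : ∀ e, α e * ((wt s R (n + e) - wt s R n : ℝ) * u (n + e))
          = α e * (wt s R (n + e) * u (n + e)) - (wt s R n : ℂ) * (α e * u (n + e)) := by
        intro e; push_cast; ring
      simp only [this, Finset.sum_sub_distrib, ← Finset.mul_sum]
      ring
    have e2 : ‖∑ e ∈ nbrs, α e * ((wt s R (n + e) - wt s R n : ℝ) * u (n + e))‖
        ≤ ∑ e ∈ nbrs, C / R * (wt s R n * ‖u (n + e)‖) := by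
      refine (norm_sum_le _ _).trans (Finset.sum_le_sum fun e he => ?_)
      rw [norm_mul, norm_mul, Complex.norm_real, Real.norm_eq_abs, ← mul_assoc]
      have h1 := h R hR n e he
      have h2 := hα e he
      calc _ ≤ 1 * (C / R * wt s R n * ‖u (n + e)‖) := by rw [mul_assoc]; gcongr
        _ = _ := by ring
    have e3 := pow_le_pow_left₀ (norm_nonneg _) e2 2
    have e4 := sq_sum_le_card_mul_sum_sq (s := nbrs)
      (f := fun e => C / R * (wt s R n * ‖u (n + e)‖))
    rw [show nbrs.card = 6 from rfl] at e4
    have e5 : ∑ e ∈ nbrs, (C / R * (wt s R n * ‖u (n + e)‖)) ^ 2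
        = (C / R) ^ 2 * ∑ e ∈ nbrs, wt s R n ^ 2 * ‖u (n + e)‖ ^ 2 := by
      rw [Finset.mul_sum]
      exact Finset.sum_congr rfl fun e _ => by ring
    rw [e5] at e4
    rw [e1]
    refine (norm_add_sq_le_two _ _).trans ?_
    rw [norm_mul, mul_pow, Complex.norm_real, Real.norm_eq_abs, sq_abs]
    push_cast at e4
    linarith
  have hE : ∑' n, ∑ e ∈ nbrs, wt s R n ^ 2 * ‖u (n + e)‖ ^ 2
      ≤ 6 * A * ∑' n, wt s R n ^ 2 * ‖u n‖ ^ 2 := by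
    rw [Summable.tsum_finsetSum hEs]
    refine (Finset.sum_le_sum fun e he => tsum_weight_shift_le (A := A) (fun n => sq_nonneg _)
      (wt_sq_le_one hs hR) (fun n => wt_sq_le_mul_wt_sq_add hR n he) hu).trans_eq ?_
    rw [Finset.sum_const, show nbrs.card = 6 from rfl]
    simp; ring
  have hN0 : 0 ≤ ∑' n, wt s R n ^ 2 * ‖u n‖ ^ 2 := tsum_nonneg fun n => by positivity
  set N := ∑' n, wt s R n ^ 2 * ‖u n‖ ^ 2
  have hRR : (1 / R) ^ 2 ≤ 1 / R := by
    have : 1 / R ≤ 1 := by rw [div_le_one hR0]; linarith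
    have h0 : 0 < 1 / R := by positivity
    nlinarith
  calc _ ≤ ∑' n, (2 * (wt s R n ^ 2 * ‖∑ e ∈ nbrs, α e * u (n + e) + k n * u n‖ ^ 2)
        + 12 * (C / R) ^ 2 * ∑ e ∈ nbrs, wt s R n ^ 2 * ‖u (n + e)‖ ^ 2) :=
        Summable.tsum_le_tsum hpt (Summable.of_nonneg_of_le (fun _ => by positivity) hpt
          (hs1.add hs2)) (hs1.add hs2)
    _ ≤ 2 * ∑' n, wt s R n ^ 2 * ‖∑ e ∈ nbrs, α e * u (n + e) + k n * u n‖ ^ 2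
        + 12 * (C / R) ^ 2 * (6 * A * N) := by
        rw [hs1.tsum_add hs2, tsum_mul_left, tsum_mul_left]
        gcongr
    _ = 2 * ∑' n, wt s R n ^ 2 * ‖∑ e ∈ nbrs, α e * u (n + e) + k n * u n‖ ^ 2
        + 72 * A * C ^ 2 * ((1 / R) ^ 2 * N) := by ring
    _ ≤ _ := by gcongr

/-- A weight vanishing at infinity which dominates all lower-order terms. -/
def lowWt (s : ℝ) (V m : ℤ × ℤ → ℝ) (n : ℤ × ℤ) : ℝ := Lam n ^ (s - 1) + V n ^ 2 + (m n - 1) ^ 2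

lemma lowWt_nonneg (s : ℝ) (V m : ℤ × ℤ → ℝ) (n : ℤ × ℤ) : 0 ≤ lowWt s V m n := by
  have := Real.rpow_nonneg (Lam_pos n).le (s - 1)
  unfold lowWt; positivity

/-- Quantitative assumptions on the coefficients of `nbrSum u = 6 (lam - V) m u + …`. -/
structure CoeffBounds (a b s : ℝ) (V m : ℤ × ℤ → ℝ) (m₀ M B D : ℝ) : Prop where
  half_lt : 1 / 2 < s
  lt_one : s < 1
  threshold : ∀ L ∈ Set.Icc (6 * a) (6 * b), (L - 6) * (L + 2) * (L + 3) ≠ 0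
  pos : 0 < m₀
  le_m : ∀ n, m₀ ≤ m n
  m_le : ∀ n, |m n| ≤ M
  coeff_le : ∀ lam ∈ Set.Icc a b, ∀ n, |(lam - V n) * m n| ≤ B
  diff_le : ∀ lam ∈ Set.Icc a b, ∀ e ∈ posNbrs, ∀ n, Lam n ^ s * jap (dot2 (latPt n) (latPt e))
    * |(lam - V n) * m n - (lam - V (n + e)) * m (n + e)| ≤ D
  low_le : ∀ n, lowWt s V m n ≤ B
  low_tendsto : Tendsto (lowWt s V m) cofinite (nhds 0)
  no_eigenvalue : ∀ lam ∈ Set.Icc a b, ∀ v : ℤ × ℤ → ℂ, SqSummable v →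
      (∀ n, nbrSum v n = 6 * (((lam - V n) * m n : ℝ) : ℂ) * v n) → ∀ n, v n = 0

/-- `u` solves the resolvent equation at `lam + iρ` with source `g` controlled by `φ`. -/
structure IsSolution (s R G lam ρ : ℝ) (V m : ℤ × ℤ → ℝ) (u g φ : ℤ × ℤ → ℂ) : Prop where
  four_le : 4 ≤ R
  nonneg : 0 ≤ G
  rho_nonneg : 0 ≤ ρ
  rho_le : ρ ≤ 1
  sqSummable : SqSummable u
  sqSummable_source : SqSummable φ
  source_le : ∀ n, ‖g n‖ ≤ G * (wt s R n * ‖φ n‖)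
  eq : ∀ n, nbrSum u n
    = 6 * (((lam - V n) * m n : ℝ) * u n + (g n + Complex.I * (ρ * m n) * u n))

section

variable {a b s m₀ M B D : ℝ} {V m : ℤ × ℤ → ℝ}

lemma CoeffBounds.residual_le (H : CoeffBounds a b s V m m₀ M B D)
    {R G lam ρ : ℝ} {u g φ : ℤ × ℤ → ℂ} (S : IsSolution s R G lam ρ V m u g φ) :
    ∑' n, wt s R n ^ 2 * ‖nbrSum u n - 6 * (((lam - V n) * m n : ℝ) : ℂ) * u n‖ ^ 2
      ≤ 72 * (G ^ 2 * ∑' n, ‖φ n‖ ^ 2 + M ^ 2 * (ρ * ∑' n, ‖u n‖ ^ 2)) := by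
  have hs : 0 ≤ s := by linarith [H.half_lt]
  have hu : Summable fun n => ‖u n‖ ^ 2 := S.sqSummable
  have hφ : Summable fun n => ‖φ n‖ ^ 2 := S.sqSummable_source
  have hsum := ((hφ.mul_left (G ^ 2)).add ((hu.mul_left ρ).mul_left (M ^ 2))).mul_left 72
  have hpt : ∀ n, wt s R n ^ 2 * ‖nbrSum u n - 6 * (((lam - V n) * m n : ℝ) : ℂ) * u n‖ ^ 2
      ≤ 72 * (G ^ 2 * ‖φ n‖ ^ 2 + M ^ 2 * (ρ * ‖u n‖ ^ 2)) := by
    intro n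
    have e1 : nbrSum u n - 6 * (((lam - V n) * m n : ℝ) : ℂ) * u n
        = 6 * (g n + Complex.I * (ρ * m n) * u n) := by rw [S.eq]; ring
    have e2 : ‖g n‖ ^ 2 ≤ G ^ 2 * ‖φ n‖ ^ 2 := by
      rw [← mul_pow]
      refine pow_le_pow_left₀ (norm_nonneg _) ((S.source_le n).trans ?_) 2
      refine mul_le_mul_of_nonneg_left ?_ S.nonneg
      exact mul_le_of_le_one_left (norm_nonneg _) (wt_le_one hs S.four_le n)
    have e3 : ‖Complex.I * (ρ * m n) * u n‖ ^ 2 ≤ M ^ 2 * (ρ * ‖u n‖ ^ 2) := by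
      rw [norm_mul, norm_mul, norm_mul, Complex.norm_I, one_mul, Complex.norm_real,
        Complex.norm_real, Real.norm_eq_abs, Real.norm_eq_abs, abs_of_nonneg S.rho_nonneg]
      have h1 := H.m_le n
      have h2 : ρ ^ 2 ≤ ρ := by nlinarith [S.rho_nonneg, S.rho_le]
      have h3 : |m n| ^ 2 ≤ M ^ 2 := pow_le_pow_left₀ (abs_nonneg _) h1 2
      calc (ρ * |m n| * ‖u n‖) ^ 2 = |m n| ^ 2 * (ρ ^ 2 * ‖u n‖ ^ 2) := by ring
        _ ≤ M ^ 2 * (ρ * ‖u n‖ ^ 2) := by gcongr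
    have e4 := norm_add_sq_le_two (g n) (Complex.I * (ρ * m n) * u n)
    have e5 : ‖nbrSum u n - 6 * (((lam - V n) * m n : ℝ) : ℂ) * u n‖ ^ 2
        = 36 * ‖g n + Complex.I * (ρ * m n) * u n‖ ^ 2 := by
      rw [e1, norm_mul, mul_pow]; norm_num
    calc _ ≤ 1 * ‖nbrSum u n - 6 * (((lam - V n) * m n : ℝ) : ℂ) * u n‖ ^ 2 := by
          gcongr; exact wt_sq_le_one hs S.four_le n
      _ ≤ _ := by rw [e5]; linarith
  calc _ ≤ ∑' n, 72 * (G ^ 2 * ‖φ n‖ ^ 2 + M ^ 2 * (ρ * ‖u n‖ ^ 2)) :=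
        Summable.tsum_le_tsum hpt (Summable.of_nonneg_of_le (fun _ => by positivity) hpt hsum) hsum
    _ = _ := by
        rw [tsum_mul_left, (hφ.mul_left _).tsum_add ((hu.mul_left ρ).mul_left _), tsum_mul_left,
          tsum_mul_left, tsum_mul_left]

lemma SqSummable.wt_mul {R : ℝ} (hs : 0 ≤ s) (hR : 4 ≤ R) {u : ℤ × ℤ → ℂ} (hu : SqSummable u) :
    SqSummable fun n => (wt s R n : ℂ) * u n :=
  hu.mul_bounded (C := 1) fun n => by
    rw [Complex.norm_real, Real.norm_eq_abs, abs_of_pos (wt_pos hR n)]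
    exact wt_le_one hs hR n

lemma norm_sq_wt_mul {R : ℝ} (n : ℤ × ℤ) (z : ℂ) :
    ‖(wt s R n : ℂ) * z‖ ^ 2 = wt s R n ^ 2 * ‖z‖ ^ 2 := by
  rw [norm_mul, mul_pow, Complex.norm_real, Real.norm_eq_abs, sq_abs]

/-- The lower-order terms are absorbed thanks to the absence of eigenvalues. -/
lemma CoeffBounds.low_order_le (H : CoeffBounds a b s V m m₀ M B D) {δ : ℝ} (hδ : 0 < δ) :
    ∃ C : ℝ, 0 < C ∧ ∀ {R G lam ρ : ℝ} {u g φ : ℤ × ℤ → ℂ}, lam ∈ Set.Icc a b →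
    IsSolution s R G lam ρ V m u g φ →
    ∑' n, lowWt s V m n * (wt s R n ^ 2 * ‖u n‖ ^ 2)
      ≤ δ * ∑' n, wt s R n ^ 2 * ‖u n‖ ^ 2
        + C * (∑' n, wt s R n ^ 2 * ‖nbrSum u n - 6 * (((lam - V n) * m n : ℝ) : ℂ) * u n‖ ^ 2
          + 1 / R * ∑' n, wt s R n ^ 2 * ‖u n‖ ^ 2) := by
  have hs : 0 ≤ s := by linarith [H.half_lt]
  obtain ⟨C₁, hC₁, h₁⟩ := exists_tsum_le_of_no_eigenvalue (lowWt_nonneg s V m) H.low_le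
    H.low_tendsto H.coeff_le H.no_eigenvalue hδ
  obtain ⟨C₂, hC₂, h₂⟩ := tsum_wt_commute_le hs
  refine ⟨C₁ * (2 + C₂), by positivity, fun {R G lam ρ u g φ} hlam S => ?_⟩
  have hR0 : 0 < R := by linarith [S.four_le]
  have k₁ := h₁ lam hlam _ (S.sqSummable.wt_mul hs S.four_le)
  simp only [norm_sq_wt_mul] at k₁
  have k₂ := h₂ R S.four_le u (fun _ => 1) (fun n => -(6 * (((lam - V n) * m n : ℝ) : ℂ))) (6 * B)
    S.sqSummable (fun _ _ => by simp) (fun n => by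
      rw [norm_neg, norm_mul, Complex.norm_real, Real.norm_eq_abs]
      have := H.coeff_le lam hlam n
      simpa using this)
  simp only [one_mul, neg_mul, ← sub_eq_add_neg] at k₂
  change ∑' n, ‖nbrSum (fun n => (wt s R n : ℂ) * u n) n
      - 6 * (((lam - V n) * m n : ℝ) : ℂ) * ((wt s R n : ℂ) * u n)‖ ^ 2
    ≤ 2 * ∑' n, wt s R n ^ 2 * ‖nbrSum u n - 6 * (((lam - V n) * m n : ℝ) : ℂ) * u n‖ ^ 2 + _ at k₂
  have hN0 : 0 ≤ 1 / R * ∑' n, wt s R n ^ 2 * ‖u n‖ ^ 2 :=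
    mul_nonneg (by positivity) (tsum_nonneg fun n => by positivity)
  have hZ0 : 0 ≤ ∑' n, wt s R n ^ 2
      * ‖nbrSum u n - 6 * (((lam - V n) * m n : ℝ) : ℂ) * u n‖ ^ 2 :=
    tsum_nonneg fun n => by positivity
  refine k₁.trans ?_
  rw [mul_assoc C₁]
  gcongr
  refine k₂.trans ?_
  nlinarith [mul_nonneg hC₂.le hZ0]

end

section

variable {a b s m₀ M B D : ℝ} {V m : ℤ × ℤ → ℝ}

lemma wt_sq_mul_le_one {R : ℝ} (hs : 0 ≤ s) (hR : 4 ≤ R) (n : ℤ × ℤ) : |wt s R n ^ 2| ≤ 1 := by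
  rw [abs_of_nonneg (sq_nonneg _)]; exact wt_sq_le_one hs hR n

lemma CoeffBounds.sq_coeff_sub_le (H : CoeffBounds a b s V m m₀ M B D) {lam : ℝ}
    (hlam : lam ∈ Set.Icc a b) (n : ℤ × ℤ) :
    ((lam - V n) * m n - lam) ^ 2 ≤ 2 * (a ^ 2 + b ^ 2 + M ^ 2) * lowWt s V m n := by
  have h1 : lam ^ 2 ≤ a ^ 2 + b ^ 2 := by
    rcases le_total 0 lam with h | h <;> nlinarith [hlam.1, hlam.2, sq_nonneg a, sq_nonneg b]
  have h2 : m n ^ 2 ≤ M ^ 2 := by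
    rw [← sq_abs]; exact pow_le_pow_left₀ (abs_nonneg _) (H.m_le n) 2
  have h3 : V n ^ 2 ≤ lowWt s V m n := by
    have := Real.rpow_nonneg (Lam_pos n).le (s - 1)
    unfold lowWt; nlinarith [sq_nonneg (m n - 1)]
  have h4 : (m n - 1) ^ 2 ≤ lowWt s V m n := by
    have := Real.rpow_nonneg (Lam_pos n).le (s - 1)
    unfold lowWt; nlinarith [sq_nonneg (V n)]
  calc ((lam - V n) * m n - lam) ^ 2
      ≤ 2 * (lam ^ 2 * (m n - 1) ^ 2 + m n ^ 2 * V n ^ 2) := by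
        nlinarith [sq_nonneg (lam * (m n - 1) + m n * V n)]
    _ ≤ 2 * ((a ^ 2 + b ^ 2) * lowWt s V m n + M ^ 2 * lowWt s V m n) := by gcongr
    _ = _ := by ring

/-- The velocity bounds control the whole weighted norm, up to lower-order terms. -/
lemma CoeffBounds.weighted_norm_le (H : CoeffBounds a b s V m m₀ M B D) :
    ∃ K : ℝ, 0 < K ∧ ∀ {R G lam ρ : ℝ} {u g φ : ℤ × ℤ → ℂ}, lam ∈ Set.Icc a b →
    IsSolution s R G lam ρ V m u g φ → ∀ τ : ℝ, 0 < τ →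
    ∑' n, wt s R n ^ 2 * ‖u n‖ ^ 2
      ≤ K * (1 / R * ∑' n, wt s R n ^ 2 * ‖u n‖ ^ 2
        + ∑' n, lowWt s V m n * (wt s R n ^ 2 * ‖u n‖ ^ 2)
        + ∑' n, wt s R n ^ 2 * ‖nbrSum u n - 6 * (((lam - V n) * m n : ℝ) : ℂ) * u n‖ ^ 2
        + G * (τ * ∑' n, wt s R n ^ 2 * ‖u n‖ ^ 2 + 1 / τ * ∑' n, ‖φ n‖ ^ 2)
        + ρ * ∑' n, ‖u n‖ ^ 2) := by
  have hs : 0 ≤ s := by linarith [H.half_lt]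
  obtain ⟨C₁, hC₁, h₁⟩ := velocity_lower_bound H.threshold
  obtain ⟨C₂, hC₂, h₂⟩ := tsum_wt_commute_le hs
  obtain ⟨C₃, hC₃, h₃⟩ := velocity_le H.half_lt H.lt_one
  have hM : 0 ≤ M := (abs_nonneg _).trans (H.m_le 0)
  set A : ℝ := a ^ 2 + b ^ 2 + M ^ 2
  have hA : 0 ≤ A := by positivity
  refine ⟨C₁ * (2 * C₃ * (1 + |D| + M) + 3 * C₂ + 4 + 288 * A), by positivity,
    fun {R G lam ρ u g φ} hlam S τ hτ => ?_⟩
  have hR0 : 0 < R := by linarith [S.four_le]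
  have hu := S.sqSummable
  have hbd := wt_sq_mul_le_one (s := s) hs S.four_le
  have hv := hu.wt_mul hs S.four_le
  have hL : 6 * lam ∈ Set.Icc (6 * a) (6 * b) := ⟨by linarith [hlam.1], by linarith [hlam.2]⟩
  have k₁ := h₁ _ hL _ hv
  simp only [norm_sq_wt_mul] at k₁
  have kv1 := h₂ R S.four_le u (fun e => (e.1 : ℂ)) (fun _ => 0) 0 hu
    (fun e he => by simp only [nbrs, Finset.mem_insert, Finset.mem_singleton] at he
                    rcases he with rfl | rfl | rfl | rfl | rfl | rfl <;> simp) (by simp)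
  have kv2 := h₂ R S.four_le u (fun e => (e.2 : ℂ)) (fun _ => 0) 0 hu
    (fun e he => by simp only [nbrs, Finset.mem_insert, Finset.mem_singleton] at he
                    rcases he with rfl | rfl | rfl | rfl | rfl | rfl <;> simp) (by simp)
  have kn := h₂ R S.four_le u (fun _ => 1) (fun _ => -((6 * lam : ℝ) : ℂ)) |6 * lam| hu
    (fun _ _ => by simp) (fun n => by rw [norm_neg, Complex.norm_real, Real.norm_eq_abs])
  simp only [zero_mul, add_zero] at kv1 kv2
  simp only [one_mul, neg_mul, ← sub_eq_add_neg] at kn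
  change ∑' n, ‖vel1 (fun n => (wt s R n : ℂ) * u n) n‖ ^ 2
    ≤ 2 * ∑' n, wt s R n ^ 2 * ‖vel1 u n‖ ^ 2 + _ at kv1
  change ∑' n, ‖vel2 (fun n => (wt s R n : ℂ) * u n) n‖ ^ 2
    ≤ 2 * ∑' n, wt s R n ^ 2 * ‖vel2 u n‖ ^ 2 + _ at kv2
  change ∑' n, ‖nbrSum (fun n => (wt s R n : ℂ) * u n) n
      - ((6 * lam : ℝ) : ℂ) * ((wt s R n : ℂ) * u n)‖ ^ 2
    ≤ 2 * ∑' n, wt s R n ^ 2 * ‖nbrSum u n - ((6 * lam : ℝ) : ℂ) * u n‖ ^ 2 + _ at kn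
  have k₃ := h₃ R S.four_le G D M B ρ τ u g φ m (fun n => (lam - V n) * m n) S.nonneg hM
    S.rho_nonneg hτ hu S.sqSummable_source S.source_le H.m_le (H.coeff_le lam hlam)
    (H.diff_le lam hlam) S.eq
  have sv1 := hu.vel1.summable_mul_sq hbd
  have sv2 := hu.vel2.summable_mul_sq hbd
  simp only [mul_add] at k₃
  rw [sv1.tsum_add sv2] at k₃
  have sN := hu.summable_mul_sq hbd
  have sY : Summable fun n => lowWt s V m n * (wt s R n ^ 2 * ‖u n‖ ^ 2) :=
    Summable.of_nonneg_of_le (fun n => mul_nonneg (lowWt_nonneg s V m n) (by positivity))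
      (fun n => mul_le_mul_of_nonneg_right (H.low_le n) (by positivity)) (sN.mul_left B)
  have sP : SqSummable fun n => nbrSum u n - 6 * (((lam - V n) * m n : ℝ) : ℂ) * u n :=
    hu.nbrSum.sub (hu.mul_bounded (C := 6 * B) fun n => by
      rw [norm_mul, Complex.norm_real, Real.norm_eq_abs]
      simpa using H.coeff_le lam hlam n)
  have sZ := sP.summable_mul_sq hbd
  have hE : ∑' n, errWt s R n * ‖u n‖ ^ 2 ≤ ∑' n, lowWt s V m n * (wt s R n ^ 2 * ‖u n‖ ^ 2) := by
    have hpt : ∀ n, errWt s R n * ‖u n‖ ^ 2 ≤ lowWt s V m n * (wt s R n ^ 2 * ‖u n‖ ^ 2) := by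
      intro n
      have : Lam n ^ (s - 1) ≤ lowWt s V m n := by
        unfold lowWt; nlinarith [sq_nonneg (V n), sq_nonneg (m n - 1)]
      calc _ = Lam n ^ (s - 1) * (wt s R n ^ 2 * ‖u n‖ ^ 2) := by unfold errWt; ring
        _ ≤ _ := by gcongr
    exact Summable.tsum_le_tsum hpt (Summable.of_nonneg_of_le
      (fun n => mul_nonneg (errWt_nonneg n) (by positivity)) hpt sY) sY
  have hX : ∑' n, wt s R n ^ 2 * ‖nbrSum u n - ((6 * lam : ℝ) : ℂ) * u n‖ ^ 2
      ≤ 2 * ∑' n, wt s R n ^ 2 * ‖nbrSum u n - 6 * (((lam - V n) * m n : ℝ) : ℂ) * u n‖ ^ 2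
        + 144 * A * ∑' n, lowWt s V m n * (wt s R n ^ 2 * ‖u n‖ ^ 2) := by
    have hpt : ∀ n, wt s R n ^ 2 * ‖nbrSum u n - ((6 * lam : ℝ) : ℂ) * u n‖ ^ 2
        ≤ 2 * (wt s R n ^ 2 * ‖nbrSum u n - 6 * (((lam - V n) * m n : ℝ) : ℂ) * u n‖ ^ 2)
          + 144 * A * (lowWt s V m n * (wt s R n ^ 2 * ‖u n‖ ^ 2)) := by
      intro n
      have e1 : nbrSum u n - ((6 * lam : ℝ) : ℂ) * u n
          = (nbrSum u n - 6 * (((lam - V n) * m n : ℝ) : ℂ) * u n)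
            + ((6 * ((lam - V n) * m n - lam) : ℝ) : ℂ) * u n := by push_cast; ring
      have e2 := norm_add_sq_le_two (nbrSum u n - 6 * (((lam - V n) * m n : ℝ) : ℂ) * u n)
        (((6 * ((lam - V n) * m n - lam) : ℝ) : ℂ) * u n)
      rw [← e1, norm_mul (((6 * ((lam - V n) * m n - lam) : ℝ) : ℂ)), mul_pow, Complex.norm_real,
        Real.norm_eq_abs, sq_abs, mul_pow] at e2
      have e3 := mul_le_mul_of_nonneg_right (H.sq_coeff_sub_le hlam n) (sq_nonneg ‖u n‖)
      calc _ ≤ wt s R n ^ 2 * (2 * ‖nbrSum u n - 6 * (((lam - V n) * m n : ℝ) : ℂ) * u n‖ ^ 2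
              + 144 * (A * lowWt s V m n * ‖u n‖ ^ 2)) := by
            gcongr; linarith
        _ = _ := by ring
    have hR := (sZ.mul_left 2).add (sY.mul_left (144 * A))
    refine (Summable.tsum_le_tsum hpt (Summable.of_nonneg_of_le (fun n => by positivity) hpt hR)
      hR).trans_eq ?_
    rw [(sZ.mul_left 2).tsum_add (sY.mul_left _), tsum_mul_left, tsum_mul_left]
  have hE0 : 0 ≤ ∑' n, errWt s R n * ‖u n‖ ^ 2 :=
    tsum_nonneg fun n => mul_nonneg (errWt_nonneg n) (sq_nonneg _)
  have hY0 : 0 ≤ ∑' n, lowWt s V m n * (wt s R n ^ 2 * ‖u n‖ ^ 2) :=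
    tsum_nonneg fun n => mul_nonneg (lowWt_nonneg s V m n) (by positivity)
  have hN0 : 0 ≤ ∑' n, wt s R n ^ 2 * ‖u n‖ ^ 2 := tsum_nonneg fun n => by positivity
  have hU0 : 0 ≤ ∑' n, ‖u n‖ ^ 2 := tsum_nonneg fun n => by positivity
  have hΦ0 : 0 ≤ ∑' n, ‖φ n‖ ^ 2 := tsum_nonneg fun n => by positivity
  have hZ0 : 0 ≤ ∑' n, wt s R n ^ 2
      * ‖nbrSum u n - 6 * (((lam - V n) * m n : ℝ) : ℂ) * u n‖ ^ 2 :=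
    tsum_nonneg fun n => by positivity
  set N := ∑' n, wt s R n ^ 2 * ‖u n‖ ^ 2
  set Y := ∑' n, lowWt s V m n * (wt s R n ^ 2 * ‖u n‖ ^ 2)
  set Z := ∑' n, wt s R n ^ 2 * ‖nbrSum u n - 6 * (((lam - V n) * m n : ℝ) : ℂ) * u n‖ ^ 2
  set U := ∑' n, ‖u n‖ ^ 2
  set Φ := ∑' n, ‖φ n‖ ^ 2
  set E := ∑' n, errWt s R n * ‖u n‖ ^ 2
  set P₁ := ∑' n, wt s R n ^ 2 * ‖vel1 u n‖ ^ 2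
  set P₂ := ∑' n, wt s R n ^ 2 * ‖vel2 u n‖ ^ 2
  have hDE : D * E ≤ |D| * Y :=
    (mul_le_mul_of_nonneg_right (le_abs_self D) hE0).trans (by gcongr)
  have hRN : 0 ≤ 1 / R * N := by positivity
  have hT : 0 ≤ G * (τ * N + 1 / τ * Φ) := mul_nonneg S.nonneg (by positivity)
  have hρU : 0 ≤ ρ * U := mul_nonneg S.rho_nonneg hU0
  set T := G * (τ * N + 1 / τ * Φ)
  have hT' : G * (τ * N) + G * (1 / τ * Φ) = T := by ring
  set X := 1 / R * N
  have hsum : P₁ + P₂ ≤ C₃ * ((1 + |D| + M) * (X + Y + Z + T + ρ * U)) := by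
    have : X + D * E + T + M * (ρ * U) ≤ (1 + |D| + M) * (X + Y + Z + T + ρ * U) := by
      have h0 : 0 ≤ |D| := abs_nonneg _
      nlinarith [mul_nonneg h0 hRN, mul_nonneg h0 hZ0, mul_nonneg h0 hT, mul_nonneg h0 hρU,
        mul_nonneg hM hRN, mul_nonneg hM hZ0, mul_nonneg hM hT, mul_nonneg hM hY0]
    nlinarith [mul_le_mul_of_nonneg_left this hC₃.le]
  calc N ≤ C₁ * (2 * (P₁ + P₂) + 3 * C₂ * X + 4 * Z + 288 * A * Y) := by
        refine k₁.trans (mul_le_mul_of_nonneg_left ?_ hC₁.le)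
        linarith
    _ ≤ C₁ * (2 * (C₃ * ((1 + |D| + M) * (X + Y + Z + T + ρ * U)))
          + 3 * C₂ * (X + Y + Z + T + ρ * U) + 4 * (X + Y + Z + T + ρ * U)
          + 288 * A * (X + Y + Z + T + ρ * U)) := by
        gcongr <;> linarith
    _ = _ := by ring

/-- The weighted a priori estimate, uniform in the spectral parameter. -/
lemma CoeffBounds.a_priori (H : CoeffBounds a b s V m m₀ M B D) (G : ℝ → ℝ) :
    ∃ R : ℝ, 4 ≤ R ∧ ∃ K : ℝ, 0 < K ∧ ∀ {lam ρ : ℝ} {u g φ : ℤ × ℤ → ℂ}, lam ∈ Set.Icc a b →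
    IsSolution s R (G R) lam ρ V m u g φ →
    ∑' n, wt s R n ^ 2 * ‖u n‖ ^ 2 ≤ K * ∑' n, ‖φ n‖ ^ 2 := by
  have hs : 0 ≤ s := by linarith [H.half_lt]
  obtain ⟨K, hK, h₁⟩ := H.weighted_norm_le
  obtain ⟨C, hC, h₂⟩ := H.low_order_le (δ := 1 / (4 * K)) (by positivity)
  have hm₀ := H.pos
  set R : ℝ := max 4 (4 * K * (1 + C))
  have hR : 4 ≤ R := le_max_left _ _
  have hR0 : 0 < R := by linarith
  set c : ℝ := 1 + (1 + (1 + C) * (72 * M ^ 2)) / m₀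
  have hc : 0 < c := by positivity
  set τ : ℝ := 1 / (4 * K * (|G R| + 1) * c)
  have hτ : 0 < τ := by positivity
  refine ⟨R, hR, 4 * (K * ((1 + C) * (72 * G R ^ 2) + |G R| * c * (1 / τ))) + 1, by positivity,
    fun {lam ρ u g φ} hlam S => ?_⟩
  have k₁ := h₁ hlam S τ hτ
  have k₂ := h₂ hlam S
  have k₃ := H.residual_le S
  have k₄ := rho_tsum_le hs hR S.nonneg S.rho_nonneg hτ S.sqSummable S.sqSummable_source
    S.source_le H.le_m H.m_le S.eq
  have hN0 : 0 ≤ ∑' n, wt s R n ^ 2 * ‖u n‖ ^ 2 := tsum_nonneg fun n => by positivity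
  have hΦ0 : 0 ≤ ∑' n, ‖φ n‖ ^ 2 := tsum_nonneg fun n => by positivity
  set N := ∑' n, wt s R n ^ 2 * ‖u n‖ ^ 2
  set Y := ∑' n, lowWt s V m n * (wt s R n ^ 2 * ‖u n‖ ^ 2)
  set Z := ∑' n, wt s R n ^ 2 * ‖nbrSum u n - 6 * (((lam - V n) * m n : ℝ) : ℂ) * u n‖ ^ 2
  set U := ρ * ∑' n, ‖u n‖ ^ 2
  set Φ := ∑' n, ‖φ n‖ ^ 2
  set T := G R * (τ * N + 1 / τ * Φ) with hT
  have k₅ : U ≤ T / m₀ := by rw [le_div_iff₀ hm₀]; linarith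
  have hN1 : K * (1 + C) * (1 / R * N) ≤ 1 / 4 * N := by
    rw [← mul_assoc]
    gcongr
    rw [mul_one_div, div_le_iff₀ hR0]
    linarith [le_max_right 4 (4 * K * (1 + C))]
  have hτ1 : K * (|G R| * c * τ) ≤ 1 / 4 := by
    have h0 : 0 < 4 * K * (|G R| + 1) * c := by positivity
    have : τ * (4 * K * (|G R| + 1) * c) = 1 := one_div_mul_cancel h0.ne'
    have h1 : 0 < K * c * τ := by positivity
    nlinarith
  have hGe : |G R| = G R := abs_of_nonneg S.nonneg
  have hKδ : K * (1 / (4 * K) * N) = 1 / 4 * N := by field_simp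
  have hbig : N ≤ K * ((1 + C) * (1 / R * N)) + K * (1 / (4 * K) * N)
      + K * ((1 + C) * (72 * G R ^ 2) * Φ) + K * (c * T) := by
    have e1 : (1 + C) * Z ≤ (1 + C) * (72 * (G R ^ 2 * Φ + M ^ 2 * (T / m₀))) := by
      gcongr; exact k₃.trans (by gcongr)
    have e2 : c * T = T + T / m₀ + (1 + C) * (72 * (M ^ 2 * (T / m₀))) := by
      simp only [c]; field_simp; ring
    rw [← mul_add, ← mul_add, ← mul_add]
    refine k₁.trans (mul_le_mul_of_nonneg_left ?_ hK.le)
    rw [e2]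
    linarith
  have e3 : K * (c * T) = K * (|G R| * c * τ) * N + K * (|G R| * c * (1 / τ)) * Φ := by
    rw [hT, hGe]; ring
  have e4 := mul_le_mul_of_nonneg_right hτ1 hN0
  have e5 : K * ((1 + C) * (1 / R * N)) ≤ 1 / 4 * N := by rw [← mul_assoc]; exact hN1
  rw [e3, hKδ] at hbig
  nlinarith

end

/-! ### Checking the assumptions -/

lemma exists_abs_le_of_tendsto_cofinite {f : ℤ × ℤ → ℝ} (h : Tendsto f cofinite (nhds 0)) :
    ∃ C : ℝ, ∀ n, |f n| ≤ C := by
  obtain ⟨C, hC⟩ := h.abs.bddAbove_range_of_cofinite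
  exact ⟨C, fun n => hC ⟨n, rfl⟩⟩

lemma tendsto_Lam_cofinite : Tendsto Lam cofinite atTop := by
  refine tendsto_atTop_mono (fun n => ?_) ((Metric.cobounded_eq_cocompact (α := ℤ × ℤ) ▸
    cocompact_eq_cofinite (ℤ × ℤ)) ▸ tendsto_norm_cobounded_atTop)
  have h : ∀ t : ℝ, |t| ≤ jap t := fun t => Real.abs_le_sqrt (by linarith)
  rw [Prod.norm_def, Int.norm_eq_abs, Int.norm_eq_abs]
  exact max_le ((h _).trans (by unfold Lam; linarith [jap_pos (n.2 : ℝ)]))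
    ((h _).trans (by unfold Lam; linarith [jap_pos (n.1 : ℝ)]))

lemma tendsto_lowWt {s : ℝ} (hs : s < 1) {V m : ℤ × ℤ → ℝ} (hV : Tendsto V cofinite (nhds 0))
    (hm : Tendsto m cofinite (nhds 1)) : Tendsto (lowWt s V m) cofinite (nhds 0) := by
  have h1 : Tendsto (fun n => Lam n ^ (s - 1)) cofinite (nhds 0) := by
    have := (tendsto_rpow_neg_atTop (y := 1 - s) (by linarith)).comp tendsto_Lam_cofinite
    simpa [Function.comp_def] using this
  have h2 := (h1.add (hV.pow 2)).add ((hm.sub_const 1).pow 2)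
  rw [show lowWt s V m = fun n => Lam n ^ (s - 1) + V n ^ 2 + (m n - 1) ^ 2 from rfl]
  simpa using h2

lemma exists_diff_le {s ε : ℝ} (hsε : s ≤ ε) {q : ℤ × ℤ → ℝ}
    (h1 : ∃ C : ℝ, ∀ n : ℤ × ℤ, Lam n ^ ε * jap (n.1 : ℝ) * |q n - q (n.1 + 1, n.2)| ≤ C)
    (h2 : ∃ C : ℝ, ∀ n : ℤ × ℤ, Lam n ^ ε * jap (n.2 : ℝ) * |q n - q (n.1, n.2 + 1)| ≤ C)
    (h3 : ∃ C : ℝ, ∀ n : ℤ × ℤ,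
      Lam n ^ ε * jap ((n.1 : ℝ) - (n.2 : ℝ)) * |q n - q (n.1 + 1, n.2 - 1)| ≤ C) :
    ∃ C : ℝ, ∀ e ∈ posNbrs, ∀ n,
      Lam n ^ s * jap (dot2 (latPt n) (latPt e)) * |q n - q (n + e)| ≤ C := by
  obtain ⟨C₁, h1⟩ := h1
  obtain ⟨C₂, h2⟩ := h2
  obtain ⟨C₃, h3⟩ := h3
  refine ⟨max C₁ (max C₂ C₃), fun e he n => ?_⟩
  have hle : Lam n ^ s * jap (dot2 (latPt n) (latPt e)) * |q n - q (n + e)|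
      ≤ Lam n ^ ε * jap (dot2 (latPt n) (latPt e)) * |q n - q (n + e)| := by
    have := Real.rpow_le_rpow_of_exponent_le (one_le_Lam n) hsε
    have := (jap_pos (dot2 (latPt n) (latPt e))).le
    gcongr
  refine hle.trans ?_
  simp only [posNbrs, Finset.mem_insert, Finset.mem_singleton] at he
  rcases he with rfl | rfl | rfl
  · refine le_trans ?_ ((h1 n).trans (le_max_left _ _))
    simp [dot2, latPt, Prod.add_def]
  · refine le_trans ?_ ((h2 n).trans ((le_max_left _ _).trans (le_max_right _ _)))
    simp [dot2, latPt, Prod.add_def]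
  · refine le_trans ?_ ((h3 n).trans ((le_max_right _ _).trans (le_max_right _ _)))
    simp [dot2, latPt, Prod.add_def, sub_eq_add_neg]

lemma mul_abs_coeff_sub_le {w lam V V' m m' L M C₁ C₂ : ℝ} (hw : 0 ≤ w) (hL : |lam - V'| ≤ L)
    (hM : |m| ≤ M) (h₁ : w * |m - m'| ≤ C₁) (h₂ : w * |V - V'| ≤ C₂) :
    w * |(lam - V) * m - (lam - V') * m'| ≤ L * C₁ + M * C₂ := by
  have e : (lam - V) * m - (lam - V') * m' = (lam - V') * (m - m') - m * (V - V') := by ring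
  have h := abs_sub ((lam - V') * (m - m')) (m * (V - V'))
  rw [abs_mul, abs_mul] at h
  have hL0 := (abs_nonneg _).trans hL
  have hM0 := (abs_nonneg _).trans hM
  calc _ ≤ w * (|lam - V'| * |m - m'| + |m| * |V - V'|) := by rw [e]; gcongr
    _ = |lam - V'| * (w * |m - m'|) + |m| * (w * |V - V'|) := by ring
    _ ≤ _ := by gcongr

lemma lapPert_sqrt_mul {m : ℤ × ℤ → ℝ} (hm : ∀ n, 0 < m n) (v : ℤ × ℤ → ℂ) (n : ℤ × ℤ) :
    lapPert m (fun k => (Real.sqrt (m k) : ℂ) * v k) n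
      = 1 / 6 * (nbrSum v n / (Real.sqrt (m n) : ℂ)) := by
  have h0 : ∀ k, (Real.sqrt (m k) : ℂ) ≠ 0 := fun k =>
    Complex.ofReal_ne_zero.mpr (Real.sqrt_pos.mpr (hm k)).ne'
  have h : ∀ k, (Real.sqrt (m k) : ℂ) * v k / ((Real.sqrt (m n) * Real.sqrt (m k) : ℝ) : ℂ)
      = v k / (Real.sqrt (m n) : ℂ) := fun k => by
    have := h0 k; have := h0 n
    push_cast
    field_simp
  simp only [lapPert, h, nbrSum, sum_nbrs, Prod.add_def, sub_eq_add_neg, add_zero]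
  ring

lemma coeffBounds_of_decay {s ε : ℝ} (hs : 1 / 2 < s) (hs1 : s < 1) (hsε : s ≤ ε)
    {η V : ℤ × ℤ → ℝ} {c : ℝ} (hc : -1 < c) (hη : ∀ n, c ≤ η n)
    (hη0 : Tendsto η cofinite (nhds 0))
    (h1 : ∃ C : ℝ, ∀ n : ℤ × ℤ, Lam n ^ ε * jap (n.1 : ℝ) * |η n - η (n.1 + 1, n.2)| ≤ C)
    (h2 : ∃ C : ℝ, ∀ n : ℤ × ℤ, Lam n ^ ε * jap (n.2 : ℝ) * |η n - η (n.1, n.2 + 1)| ≤ C)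
    (h3 : ∃ C : ℝ, ∀ n : ℤ × ℤ,
      Lam n ^ ε * jap ((n.1 : ℝ) - (n.2 : ℝ)) * |η n - η (n.1 + 1, n.2 - 1)| ≤ C)
    (hV0 : Tendsto V cofinite (nhds 0))
    (hV1 : ∃ C : ℝ, ∀ n : ℤ × ℤ, Lam n ^ ε * jap (n.1 : ℝ) * |V n - V (n.1 + 1, n.2)| ≤ C)
    (hV2 : ∃ C : ℝ, ∀ n : ℤ × ℤ, Lam n ^ ε * jap (n.2 : ℝ) * |V n - V (n.1, n.2 + 1)| ≤ C)
    (hV3 : ∃ C : ℝ, ∀ n : ℤ × ℤ,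
      Lam n ^ ε * jap ((n.1 : ℝ) - (n.2 : ℝ)) * |V n - V (n.1 + 1, n.2 - 1)| ≤ C)
    {a b : ℝ} (hthr : Set.Icc a b ∩ ({-(1/2), -(1/3), 1} : Set ℝ) = ∅)
    {Ht : H2 →L[ℂ] H2}
    (hHt : ∀ (f : H2) (n : ℤ × ℤ),
      Ht f n = lapPert (fun k => 1 + η k) (⇑f) n + (V n : ℂ) * f n)
    (heig : ∀ lam ∈ Set.Icc a b, ∀ f : H2, Ht f = (lam : ℂ) • f → f = 0) :
    ∃ M B D : ℝ, CoeffBounds a b s V (fun n => 1 + η n) (1 + c) M B D := by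
  have hm0 : ∀ n, 0 < 1 + η n := fun n => by linarith [hη n]
  obtain ⟨Cη, hCη⟩ := exists_abs_le_of_tendsto_cofinite hη0
  obtain ⟨CV, hCV⟩ := exists_abs_le_of_tendsto_cofinite hV0
  have hlow : Tendsto (lowWt s V fun n => 1 + η n) cofinite (nhds 0) :=
    tendsto_lowWt hs1 hV0 (by simpa using hη0.const_add 1)
  obtain ⟨Cl, hCl⟩ := exists_abs_le_of_tendsto_cofinite hlow
  obtain ⟨C₁, hC₁⟩ := exists_diff_le hsε h1 h2 h3
  obtain ⟨C₂, hC₂⟩ := exists_diff_le hsε hV1 hV2 hV3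
  have hM : ∀ n, |1 + η n| ≤ 1 + Cη := fun n =>
    (abs_add_le _ _).trans (by simpa using hCη n)
  have hL : ∀ lam ∈ Set.Icc a b, ∀ n, |lam - V n| ≤ |a| + |b| + CV := by
    intro lam hlam n
    have : |lam| ≤ |a| + |b| := abs_le.mpr
      ⟨by linarith [neg_abs_le a, abs_nonneg b, hlam.1],
        by linarith [le_abs_self b, abs_nonneg a, hlam.2]⟩
    exact (abs_sub _ _).trans (add_le_add this (hCV n))
  have hM0 : 0 ≤ 1 + Cη := (abs_nonneg _).trans (hM 0)
  refine ⟨1 + Cη, max ((|a| + |b| + CV) * (1 + Cη)) Cl, (|a| + |b| + CV) * C₁ + (1 + Cη) * C₂,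
    hs, hs1, ?_, by linarith, fun n => by linarith [hη n], hM, fun lam hlam n => ?_,
    fun lam hlam e he n => ?_, fun n => (le_abs_self _).trans ((hCl n).trans (le_max_right _ _)),
    hlow, fun lam hlam v hv heq => ?_⟩
  · intro L hL h
    have hmem : L / 6 ∈ Set.Icc a b := ⟨by linarith [hL.1], by linarith [hL.2]⟩
    have hne : ∀ x ∈ ({-(1/2), -(1/3), 1} : Set ℝ), L / 6 ≠ x := fun x hx hLx =>
      Set.eq_empty_iff_forall_notMem.mp hthr (L / 6) ⟨hmem, hLx ▸ hx⟩
    rcases mul_eq_zero.mp h with h | h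
    · rcases mul_eq_zero.mp h with h | h
      · exact hne 1 (by simp) (by linarith)
      · exact hne (-(1/3)) (by simp) (by linarith)
    · exact hne (-(1/2)) (by simp) (by linarith)
  · rw [abs_mul]
    exact (mul_le_mul (hL lam hlam n) (hM n) (abs_nonneg _)
      ((abs_nonneg _).trans (hL lam hlam n))).trans (le_max_left _ _)
  · refine mul_abs_coeff_sub_le (mul_nonneg (Real.rpow_nonneg (Lam_pos n).le _) (jap_pos _).le)
      (hL lam hlam _) (hM n) ?_ (hC₂ e he n)
    simpa using hC₁ e he n
  · have hf : SqSummable fun n => (Real.sqrt (1 + η n) : ℂ) * v n :=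
      hv.mul_bounded (C := Real.sqrt (1 + Cη)) fun n => by
        rw [Complex.norm_real, Real.norm_eq_abs, abs_of_nonneg (Real.sqrt_nonneg _)]
        exact Real.sqrt_le_sqrt ((le_abs_self _).trans (hM n))
    have hroot : ∀ n, (Real.sqrt (1 + η n) : ℂ) ≠ 0 := fun n =>
      Complex.ofReal_ne_zero.mpr (Real.sqrt_pos.mpr (hm0 n)).ne'
    have hsq : ∀ n, (Real.sqrt (1 + η n) : ℂ) * Real.sqrt (1 + η n) = 1 + η n := fun n => by
      rw [← Complex.ofReal_mul, Real.mul_self_sqrt (hm0 n).le]; push_cast; rfl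
    have h0 := heig lam hlam hf.toH2 (by
      ext n
      have hcoe : ⇑hf.toH2 = fun n => (Real.sqrt (1 + η n) : ℂ) * v n := by
        funext k; simp
      rw [hHt, lp.coeFn_smul, Pi.smul_apply, smul_eq_mul, hcoe,
        lapPert_sqrt_mul hm0, heq n]
      have := hroot n
      field_simp
      push_cast
      linear_combination (-(lam : ℂ) + V n) * v n * hsq n)
    intro n
    have := congrArg (fun f : H2 => f n) h0
    simpa [hroot n] using this

/-! ### The limiting absorption principle -/

lemma SqSummable.summable_mul_conj {u w : ℤ × ℤ → ℂ} (hu : SqSummable u) (hw : SqSummable w) :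
    Summable fun n => w n * (starRingEnd ℂ) (u n) := by
  refine Summable.of_norm ?_
  have h := hw.summable_mul_norm hu (K := fun _ => 1) (C := 1) (by simp)
  simpa using h

lemma tsum_nbrSum_mul_conj {u w : ℤ × ℤ → ℂ} (hu : SqSummable u) (hw : SqSummable w) :
    ∑' n, nbrSum w n * (starRingEnd ℂ) (u n) = ∑' n, w n * (starRingEnd ℂ) (nbrSum u n) := by
  have e1 : ∀ n, nbrSum w n * (starRingEnd ℂ) (u n)
      = ∑ e ∈ nbrs, w (n + e) * (starRingEnd ℂ) (u n) := fun n => Finset.sum_mul _ _ _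
  have e2 : ∀ n, w n * (starRingEnd ℂ) (nbrSum u n)
      = ∑ e ∈ nbrs, w n * (starRingEnd ℂ) (u (n + e)) := fun n => by
    rw [nbrSum, map_sum, Finset.mul_sum]
  simp only [e1, e2]
  rw [Summable.tsum_finsetSum fun e _ => hu.summable_mul_conj (hw.shift e),
    Summable.tsum_finsetSum fun e _ => (hu.shift e).summable_mul_conj hw,
    ← sum_nbrs_neg fun e => ∑' n, w n * (starRingEnd ℂ) (u (n + e))]
  refine Finset.sum_congr rfl fun e _ => ?_
  rw [← tsum_shift (fun n => w n * (starRingEnd ℂ) (u (n + -e))) e]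
  simp

section

variable {V : ℤ × ℤ → ℝ} {Ht : H2 →L[ℂ] H2}

lemma sqSummable_div_sqrt {m : ℤ × ℤ → ℝ} {m₀ : ℝ} (hm₀ : 0 < m₀) (hm : ∀ n, m₀ ≤ m n)
    (f : H2) : SqSummable fun n => f n / (Real.sqrt (m n) : ℂ) := by
  have h := f.sqSummable.mul_bounded (K := fun n => ((1 / Real.sqrt (m n) : ℝ) : ℂ))
    (C := 1 / Real.sqrt m₀) fun n => by
      rw [Complex.norm_real, Real.norm_eq_abs, abs_of_nonneg (by positivity)]
      have := Real.sqrt_pos.mpr hm₀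
      have := Real.sqrt_le_sqrt (hm n)
      gcongr
  refine h.congr fun n => ?_
  push_cast
  rw [one_div_mul_eq_div]

lemma lapPert_eq {m : ℤ × ℤ → ℝ} (hm : ∀ n, 0 < m n) (f : ℤ × ℤ → ℂ) (n : ℤ × ℤ) :
    lapPert m f n
      = 1 / 6 * (nbrSum (fun k => f k / (Real.sqrt (m k) : ℂ)) n / (Real.sqrt (m n) : ℂ)) := by
  rw [← lapPert_sqrt_mul hm]
  congr 1
  funext k
  have : (Real.sqrt (m k) : ℂ) ≠ 0 :=
    Complex.ofReal_ne_zero.mpr (Real.sqrt_pos.mpr (hm k)).ne'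
  field_simp

lemma isSelfAdjoint_of_lapPert {m : ℤ × ℤ → ℝ} {m₀ : ℝ} (hm₀ : 0 < m₀) (hm : ∀ n, m₀ ≤ m n)
    (hHt : ∀ (f : H2) (n : ℤ × ℤ), Ht f n = lapPert m (⇑f) n + (V n : ℂ) * f n)
    {CV : ℝ} (hV : ∀ n, |V n| ≤ CV) : IsSelfAdjoint Ht := by
  rw [ContinuousLinearMap.isSelfAdjoint_iff_isSymmetric]
  intro f g
  have hpos : ∀ n, 0 < m n := fun n => hm₀.trans_le (hm n)
  have hu := sqSummable_div_sqrt hm₀ hm f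
  have hw := sqSummable_div_sqrt hm₀ hm g
  have hVf : SqSummable fun n => (V n : ℂ) * f n := f.sqSummable.mul_bounded (C := CV) fun n => by
    rw [Complex.norm_real, Real.norm_eq_abs]; exact hV n
  have key := tsum_nbrSum_mul_conj hu hw
  rw [lp.inner_eq_tsum, lp.inner_eq_tsum]
  set u := fun n => f n / (Real.sqrt (m n) : ℂ) with hu_def
  set w := fun n => g n / (Real.sqrt (m n) : ℂ) with hw_def
  have e1 : ∀ n, inner ℂ (Ht f n) (g n) = 1 / 6 * (w n * (starRingEnd ℂ) (nbrSum u n))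
      + g n * (starRingEnd ℂ) ((V n : ℂ) * f n) := fun n => by
    rw [hHt, lapPert_eq hpos, ← hu_def]
    simp only [RCLike.inner_apply, map_add, map_mul, map_div₀, Complex.conj_ofReal, hw_def, map_one,
      map_ofNat]
    ring
  have e2 : ∀ n, inner ℂ (f n) (Ht g n) = 1 / 6 * (nbrSum w n * (starRingEnd ℂ) (u n))
      + g n * (starRingEnd ℂ) ((V n : ℂ) * f n) := fun n => by
    rw [hHt, lapPert_eq hpos, ← hw_def]
    simp only [RCLike.inner_apply, map_mul, map_div₀, Complex.conj_ofReal, hu_def]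
    ring
  have s3 := hVf.summable_mul_conj g.sqSummable
  change ∑' n, inner ℂ (Ht f n) (g n) = ∑' n, inner ℂ (f n) (Ht g n)
  simp only [e1, e2]
  rw [((hu.nbrSum.summable_mul_conj hw).mul_left _).tsum_add s3,
    ((hu.summable_mul_conj hw.nbrSum).mul_left _).tsum_add s3, tsum_mul_left, tsum_mul_left, key]

lemma isUnit_sub_algebraMap {T : H2 →L[ℂ] H2} (hT : IsSelfAdjoint T) {z : ℂ} (hz : z.im ≠ 0) :
    IsUnit (T - algebraMap ℂ (H2 →L[ℂ] H2) z) := by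
  by_contra h
  have hmem : z ∈ spectrum ℂ T := by
    rw [spectrum.mem_iff]
    rwa [← neg_sub, IsUnit.neg_iff]
  have := congrArg Complex.im (hT.mem_spectrum_eq_re hmem)
  exact hz (by simpa using this)

/-- A resolvent equation for `Δ̃ + V` is, after division by `√m`, a lattice equation. -/
lemma nbrSum_div_sqrt_eq {m : ℤ × ℤ → ℝ} (hm : ∀ n, 0 < m n) {f h : ℤ × ℤ → ℂ} {lam ρ : ℝ}
    {n : ℤ × ℤ}
    (hf : lapPert m f n + (V n : ℂ) * f n - ((lam : ℂ) + (ρ : ℂ) * Complex.I) * f n = h n) :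
    nbrSum (fun k => f k / (Real.sqrt (m k) : ℂ)) n
      = 6 * (((lam - V n) * m n : ℝ) * (f n / (Real.sqrt (m n) : ℂ))
        + ((Real.sqrt (m n) : ℂ) * h n
          + Complex.I * (ρ * m n) * (f n / (Real.sqrt (m n) : ℂ)))) := by
  have h0 : (Real.sqrt (m n) : ℂ) ≠ 0 :=
    Complex.ofReal_ne_zero.mpr (Real.sqrt_pos.mpr (hm n)).ne'
  have hsq : (Real.sqrt (m n) : ℂ) * Real.sqrt (m n) = m n := by
    rw [← Complex.ofReal_mul, Real.mul_self_sqrt (hm n).le]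
  rw [← hf, lapPert_eq hm]
  push_cast
  rw [← hsq]
  field_simp
  ring

end

/-- The weighted resolvent bound, from the a priori estimate. -/
lemma CoeffBounds.resolvent_le {a b s ε m₀ M B D : ℝ} {V m : ℤ × ℤ → ℝ}
    (H : CoeffBounds a b s V m m₀ M B D) (hsε : s ≤ ε) {Ht W : H2 →L[ℂ] H2}
    (hHt : ∀ (f : H2) (n : ℤ × ℤ), Ht f n = lapPert m (⇑f) n + (V n : ℂ) * f n)
    (hW : ∀ (f : H2) (n : ℤ × ℤ), W f n = ((Lam n ^ (-ε) : ℝ) : ℂ) * f n) :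
    ∃ K : ℝ, 0 < K ∧ ∀ lam ∈ Set.Icc a b, ∀ ρ ∈ Set.Ioc (0 : ℝ) 1, ∀ f φ : H2,
      Ht f - ((lam : ℂ) + (ρ : ℂ) * Complex.I) • f = W φ → ‖W f‖ ^ 2 ≤ K * ‖φ‖ ^ 2 := by
  have hs : 0 ≤ s := by linarith [H.half_lt]
  have hpos : ∀ n, 0 < m n := fun n => H.pos.trans_le (H.le_m n)
  have hM : 0 ≤ M := (abs_nonneg _).trans (H.m_le 0)
  obtain ⟨R, hR, K, hK, h⟩ := H.a_priori fun R => Real.sqrt M * R ^ s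
  have hR0 : 0 < R := by linarith
  have hmM : ∀ n, m n ≤ M := fun n => (le_abs_self _).trans (H.m_le n)
  have hLam : ∀ n, Lam n ^ (-ε) ≤ R ^ s * wt s R n := fun n =>
    (Real.rpow_le_rpow_of_exponent_le (one_le_Lam n) (neg_le_neg hsε)).trans
      (Lam_rpow_neg_le_wt hs hR n)
  have hLam0 : ∀ n, 0 ≤ Lam n ^ (-ε) := fun n => Real.rpow_nonneg (Lam_pos n).le _
  refine ⟨(R ^ s) ^ 2 * M * K + 1, by positivity, fun lam hlam ρ hρ f φ hf => ?_⟩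
  have hu := sqSummable_div_sqrt H.pos H.le_m f
  have S : IsSolution s R (Real.sqrt M * R ^ s) lam ρ V m (fun n => f n / (Real.sqrt (m n) : ℂ))
      (fun n => (Real.sqrt (m n) : ℂ) * W φ n) φ := by
    refine ⟨hR, by positivity, hρ.1.le, hρ.2, hu, φ.sqSummable, fun n => ?_, fun n => ?_⟩
    · rw [hW, norm_mul, norm_mul, Complex.norm_real, Complex.norm_real, Real.norm_eq_abs,
        Real.norm_eq_abs, abs_of_nonneg (Real.sqrt_nonneg _), abs_of_nonneg (hLam0 n)]
      have h1 := Real.sqrt_le_sqrt (hmM n)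
      have h2 := hLam n
      have h3 := hLam0 n
      calc _ ≤ Real.sqrt M * (R ^ s * wt s R n * ‖φ n‖) := by gcongr
        _ = _ := by ring
    · refine nbrSum_div_sqrt_eq hpos (h := fun n => W φ n) ?_
      have := congrArg (fun g : H2 => g n) hf
      rw [← hHt]
      exact this
  have hN := h hlam S
  rw [H2.norm_sq, H2.norm_sq φ]
  have hsum := (summable_wt_sq hs hR hu).mul_left ((R ^ s) ^ 2 * M)
  have hpt : ∀ n, ‖W f n‖ ^ 2
      ≤ (R ^ s) ^ 2 * M * (wt s R n ^ 2 * ‖f n / (Real.sqrt (m n) : ℂ)‖ ^ 2) := by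
    intro n
    have e : ‖f n‖ ^ 2 = m n * ‖f n / (Real.sqrt (m n) : ℂ)‖ ^ 2 := by
      rw [norm_div, div_pow, Complex.norm_real, Real.norm_eq_abs, sq_abs,
        Real.sq_sqrt (hpos n).le]
      have := (hpos n).ne'
      field_simp
    rw [hW, norm_mul, mul_pow, Complex.norm_real, Real.norm_eq_abs, abs_of_nonneg (hLam0 n), e]
    have h1 := pow_le_pow_left₀ (hLam0 n) (hLam n) 2
    have h2 := hmM n
    have h3 := (hpos n).le
    calc _ ≤ (R ^ s * wt s R n) ^ 2 * (M * ‖f n / (Real.sqrt (m n) : ℂ)‖ ^ 2) := by gcongr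
      _ = _ := by ring
  have h1 := Summable.tsum_le_tsum hpt (W f).sqSummable hsum
  rw [tsum_mul_left] at h1
  have h2 : 0 ≤ ∑' n, ‖φ n‖ ^ 2 := tsum_nonneg fun n => by positivity
  have h3 := mul_le_mul_of_nonneg_left hN (show 0 ≤ (R ^ s) ^ 2 * M by positivity)
  linarith

/-- Limiting absorption principle for `H̃ = Δ̃ + V(Q)` on intervals avoiding
the thresholds `{-1/2, -1/3, 1}` and the eigenvalues of `H̃`. -/
theorem limiting_absorption_principle
    (ε : ℝ) (hε : 1/2 < ε) (η : ℤ × ℤ → ℝ)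
    (h0inf : ∃ c : ℝ, -1 < c ∧ ∀ n : ℤ × ℤ, c ≤ η n)
    (h0lim : Filter.Tendsto η Filter.cofinite (nhds 0))
    (h1 : ∃ C : ℝ, ∀ n : ℤ × ℤ,
      Lam n ^ ε * jap (n.1 : ℝ) * |η n - η (n.1 + 1, n.2)| ≤ C)
    (h2 : ∃ C : ℝ, ∀ n : ℤ × ℤ,
      Lam n ^ ε * jap (n.2 : ℝ) * |η n - η (n.1, n.2 + 1)| ≤ C)
    (h3 : ∃ C : ℝ, ∀ n : ℤ × ℤ,
      Lam n ^ ε * jap ((n.1 : ℝ) - (n.2 : ℝ)) * |η n - η (n.1 + 1, n.2 - 1)| ≤ C)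
    (h4 : ∃ C : ℝ, ∀ n : ℤ × ℤ, Lam n ^ ε * |η n| ≤ C)
    (V : ℤ × ℤ → ℝ)
    (hV0 : Filter.Tendsto V Filter.cofinite (nhds 0))
    (hV1 : ∃ C : ℝ, ∀ n : ℤ × ℤ,
      Lam n ^ ε * jap (n.1 : ℝ) * |V n - V (n.1 + 1, n.2)| ≤ C)
    (hV2 : ∃ C : ℝ, ∀ n : ℤ × ℤ,
      Lam n ^ ε * jap (n.2 : ℝ) * |V n - V (n.1, n.2 + 1)| ≤ C)
    (hV3 : ∃ C : ℝ, ∀ n : ℤ × ℤ,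
      Lam n ^ ε * jap ((n.1 : ℝ) - (n.2 : ℝ)) * |V n - V (n.1 + 1, n.2 - 1)| ≤ C)
    (Ht : H2 →L[ℂ] H2)
    (hHt : ∀ (f : H2) (n : ℤ × ℤ),
      Ht f n = lapPert (fun k => 1 + η k) (⇑f) n + (V n : ℂ) * f n)
    (W : H2 →L[ℂ] H2)
    (hW : ∀ (f : H2) (n : ℤ × ℤ), W f n = ((Lam n ^ (-ε) : ℝ) : ℂ) * f n)
    (a b : ℝ) (hab : a ≤ b)
    (hthr : Set.Icc a b ∩ ({-(1/2), -(1/3), 1} : Set ℝ) = ∅)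
    (heig : ∀ lam ∈ Set.Icc a b, ∀ f : H2, Ht f = (lam : ℂ) • f → f = 0) :
    ∃ M > 0, ∀ lam ∈ Set.Icc a b, ∀ ρ ∈ Set.Ioc (0 : ℝ) 1,
      IsUnit (Ht - algebraMap ℂ (H2 →L[ℂ] H2) ((lam : ℂ) + (ρ : ℂ) * Complex.I)) ∧
      ‖W ∘L Ring.inverse (Ht - algebraMap ℂ (H2 →L[ℂ] H2) ((lam : ℂ) + (ρ : ℂ) * Complex.I)) ∘L W‖
        ≤ M := by
  obtain ⟨c, hc, hη⟩ := h0inf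
  set s : ℝ := min ε (3 / 4)
  have hs : 1 / 2 < s := lt_min hε (by norm_num)
  have hs1 : s < 1 := (min_le_right _ _).trans_lt (by norm_num)
  obtain ⟨M, B, D, H⟩ := coeffBounds_of_decay hs hs1 (min_le_left _ _) hc hη h0lim h1 h2 h3
    hV0 hV1 hV2 hV3 hthr hHt heig
  obtain ⟨CV, hCV⟩ := exists_abs_le_of_tendsto_cofinite hV0
  have hsa : IsSelfAdjoint Ht := isSelfAdjoint_of_lapPert H.pos H.le_m hHt hCV
  obtain ⟨K, hK, hres⟩ := H.resolvent_le (min_le_left _ _) hHt hW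
  refine ⟨Real.sqrt K, Real.sqrt_pos.mpr hK, fun lam hlam ρ hρ => ?_⟩
  have hunit := isUnit_sub_algebraMap hsa (z := (lam : ℂ) + (ρ : ℂ) * Complex.I)
    (by simpa using hρ.1.ne')
  refine ⟨hunit, ContinuousLinearMap.opNorm_le_bound _ (Real.sqrt_nonneg _) fun φ => ?_⟩
  set T := Ht - algebraMap ℂ (H2 →L[ℂ] H2) ((lam : ℂ) + (ρ : ℂ) * Complex.I) with hT
  have hinv : T (Ring.inverse T (W φ)) = W φ := by
    rw [← mul_apply_eq_comp, Ring.mul_inverse_cancel _ hunit,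
      one_apply_eq_self]
  have h := hres lam hlam ρ hρ (Ring.inverse T (W φ)) φ (by
    rw [hT, sub_apply, Algebra.algebraMap_eq_smul_one,
      smul_apply, one_apply_eq_self] at hinv
    exact hinv)
  rw [← Real.sqrt_sq (norm_nonneg φ), ← Real.sqrt_mul hK.le]
  exact Real.le_sqrt_of_sq_le h
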